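/- Set c₁⁽⁰⁾ = π²/72 and c₁⁽¹⁾ = π²/24. For a squarefree positive integer n and an integral binary cubic form f, let w_n(f) denote the number of points [x:y] ∈ ℙ¹(ℤ/nℤ) with f(x,y) ≡ 0 (mod n); w_n is constant on GL₂(ℤ)-equivalence classes. Then for each i ∈ {0,1} and each ε > 0 there is a constant C_ε such that for all squarefree n ≥ 1 and all X ≥ 1: |∑_{[f]} w_n(f) − (σ(n)/n)·c₁⁽ⁱ⁾·X| ≤ C_ε·(n^{3+ε} + X^{5/6}·n^{1/2}), where the sum runs over GL₂(ℤ)-equivalence classes [f] of irreducible integral binary cubic forms with discriminant of sign i (positive for i=0, negative for i=1) and |Disc(f)| < X, and σ(n) is the sum of the divisors of n. -/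

import Mathlib

open Filter Asymptotics Real

/-- An integral binary cubic form `ax³ + bx²y + cxy² + dy³`, recorded as `(a,b,c,d)`. -/
abbrev BinaryCubic := ℤ × ℤ × ℤ × ℤ

/-- The homogeneous polynomial associated to a binary cubic form over a commutative ring. -/
noncomputable def toPoly {A : Type*} [CommRing A] (f : A × A × A × A) :
    MvPolynomial (Fin 2) A :=
  MvPolynomial.C f.1 * MvPolynomial.X 0 ^ 3 +
    MvPolynomial.C f.2.1 * MvPolynomial.X 0 ^ 2 * MvPolynomial.X 1 +
    MvPolynomial.C f.2.2.1 * MvPolynomial.X 0 * MvPolynomial.X 1 ^ 2 +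
    MvPolynomial.C f.2.2.2 * MvPolynomial.X 1 ^ 3

/-- `ActsTo γ f g` means `g = γ · f` under the twisted action
`(γ · f)(x,y) = (det γ)⁻¹ · f((x,y)·γ)`, expressed without inverses as
`(det γ) · (γ·f)(x,y) = f((x,y)·γ)`. -/
def ActsTo {A : Type*} [CommRing A] (γ : Matrix (Fin 2) (Fin 2) A)
    (f g : A × A × A × A) : Prop :=
  MvPolynomial.C γ.det * toPoly g =
    MvPolynomial.bind₁
      (fun j : Fin 2 =>
        MvPolynomial.C (γ 0 j) * MvPolynomial.X 0 + MvPolynomial.C (γ 1 j) * MvPolynomial.X 1)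
      (toPoly f)

/-- `GL₂(ℤ)`-equivalence of integral binary cubic forms (twisted action). -/
def FormEquiv (f g : BinaryCubic) : Prop :=
  ∃ γ : Matrix (Fin 2) (Fin 2) ℤ, IsUnit γ.det ∧ ActsTo γ f g

/-- The discriminant of a binary cubic form `(a,b,c,d)`:
`b²c² − 4ac³ − 4b³d − 27a²d² + 18abcd`. -/
def discF (f : BinaryCubic) : ℤ :=
  f.2.1 ^ 2 * f.2.2.1 ^ 2 - 4 * f.1 * f.2.2.1 ^ 3 - 4 * f.2.1 ^ 3 * f.2.2.2 -
    27 * f.1 ^ 2 * f.2.2.2 ^ 2 + 18 * f.1 * f.2.1 * f.2.2.1 * f.2.2.2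

/-- Irreducibility of a binary cubic form, as a polynomial over `ℚ`. -/
def IrredForm (f : BinaryCubic) : Prop :=
  Irreducible (MvPolynomial.map (Int.castRingHom ℚ) (toPoly f))

/-- The number of `GL₂(ℤ)`-equivalence classes of integral binary cubic forms
satisfying a property `P` (assumed `GL₂(ℤ)`-invariant). -/
noncomputable def countClasses (P : BinaryCubic → Prop) : ℕ :=
  Nat.card (Quot fun f g : { f : BinaryCubic // P f } => FormEquiv f.1 g.1)

/-- The projective line over `ℤ/nℤ`: pairs generating the unit ideal, modulo scaling
by units. -/
def ProjLine (n : ℕ) : Type :=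
  Quot fun v w : { v : ZMod n × ZMod n // Ideal.span {v.1, v.2} = ⊤ } =>
    ∃ u : (ZMod n)ˣ, w.1.1 = (u : ZMod n) * v.1.1 ∧ w.1.2 = (u : ZMod n) * v.1.2

/-- A representative of a point of the projective line. -/
noncomputable def ProjLine.rep {n : ℕ} (q : ProjLine n) : ZMod n × ZMod n :=
  (Classical.choose (Quot.exists_rep q)).1

/-- Evaluation of the binary cubic form `(a,b,c,d)` at `(x,y)`. -/
def evalForm {A : Type*} [CommRing A] (f : A × A × A × A) (v : A × A) : A :=
  f.1 * v.1 ^ 3 + f.2.1 * v.1 ^ 2 * v.2 + f.2.2.1 * v.1 * v.2 ^ 2 + f.2.2.2 * v.2 ^ 3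

/-- The number of roots of an integral binary cubic form in `ℙ¹(ℤ/nℤ)`. -/
noncomputable def wn (n : ℕ) (f : BinaryCubic) : ℕ :=
  Nat.card { q : ProjLine n //
    evalForm ((f.1 : ZMod n), (f.2.1 : ZMod n), (f.2.2.1 : ZMod n), (f.2.2.2 : ZMod n))
      q.rep = 0 }

/-- The sum of the weights `w` over the `GL₂(ℤ)`-classes of forms satisfying `P`
(`w` is assumed constant on classes; each class is counted via a representative). -/
noncomputable def classSum (P : BinaryCubic → Prop) (w : BinaryCubic → ℕ) : ℕ :=
  ∑ᶠ q : Quot fun f g : { f : BinaryCubic // P f } => FormEquiv f.1 g.1,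
    w (Classical.choose (Quot.exists_rep q)).1

/-! ### Algebra of integral binary cubic forms -/

theorem eval_toPoly {A : Type*} [CommRing A] (f : A × A × A × A) (t : Fin 2 → A) :
    MvPolynomial.eval t (toPoly f) = evalForm f (t 0, t 1) := by
  simp [toPoly, evalForm]

theorem actsTo_iff {A : Type*} [CommRing A] [IsDomain A] [Infinite A]
    (γ : Matrix (Fin 2) (Fin 2) A) (f g : A × A × A × A) :
    ActsTo γ f g ↔ ∀ x y : A, γ.det * evalForm g (x, y) =
      evalForm f (γ 0 0 * x + γ 1 0 * y, γ 0 1 * x + γ 1 1 * y) := by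
  have key : ∀ t : Fin 2 → A, MvPolynomial.eval t (MvPolynomial.bind₁
      (fun j : Fin 2 =>
        MvPolynomial.C (γ 0 j) * MvPolynomial.X 0 + MvPolynomial.C (γ 1 j) * MvPolynomial.X 1)
      (toPoly f)) =
      evalForm f (γ 0 0 * t 0 + γ 1 0 * t 1, γ 0 1 * t 0 + γ 1 1 * t 1) := by
    intro t
    simp [toPoly, evalForm]
  constructor
  · intro h x y
    have := congrArg (MvPolynomial.eval ![x, y]) h
    rw [key, map_mul, eval_toPoly] at this
    simpa using this
  · intro h
    apply MvPolynomial.funext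
    intro t
    rw [key, map_mul, eval_toPoly]
    simpa using h (t 0) (t 1)

theorem evalForm_ext {f g : BinaryCubic} (h : ∀ x y, evalForm f (x, y) = evalForm g (x, y)) :
    f = g := by
  obtain ⟨a, b, c, d⟩ := f
  obtain ⟨a', b', c', d'⟩ := g
  have h1 := h 1 0
  have h2 := h 0 1
  have h3 := h 1 1
  have h4 := h 1 (-1)
  simp only [evalForm] at h1 h2 h3 h4
  simp only [Prod.mk.injEq]
  refine ⟨?_, ?_, ?_, ?_⟩ <;> linarith

theorem isUnit_int_sq {t : ℤ} (h : IsUnit t) : t * t = 1 := by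
  rcases Int.isUnit_iff.1 h with rfl | rfl <;> norm_num

theorem FormEquiv.refl (f : BinaryCubic) : FormEquiv f f :=
  ⟨1, by simp, by rw [actsTo_iff]; intro x y; simp⟩

theorem FormEquiv.symm {f g : BinaryCubic} (h : FormEquiv f g) : FormEquiv g f := by
  obtain ⟨γ, hu, h⟩ := h
  rw [actsTo_iff] at h
  have hd := isUnit_int_sq hu
  have hdet : (γ.det • γ.adjugate).det = γ.det := by
    rw [Matrix.det_smul, Matrix.det_adjugate]
    simp only [Fintype.card_fin, Nat.add_one_sub_one, pow_one]
    linear_combination γ.det * hd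
  refine ⟨γ.det • γ.adjugate, by rwa [hdet], ?_⟩
  rw [actsTo_iff]
  intro x y
  rw [hdet]
  simp only [Matrix.adjugate_fin_two, Matrix.smul_apply, smul_eq_mul, Matrix.of_apply,
    Matrix.cons_val', Matrix.cons_val_zero, Matrix.cons_val_one, Matrix.cons_val_fin_one]
  set D := γ.det with hD
  rw [Matrix.det_fin_two] at hD
  have h' := h (D * γ 1 1 * x + D * -γ 1 0 * y) (D * -γ 0 1 * x + D * γ 0 0 * y)
  have e1 : γ 0 0 * (D * γ 1 1 * x + D * -γ 1 0 * y) +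
      γ 1 0 * (D * -γ 0 1 * x + D * γ 0 0 * y) = x := by
    linear_combination x * hd - D * x * hD
  have e2 : γ 0 1 * (D * γ 1 1 * x + D * -γ 1 0 * y) +
      γ 1 1 * (D * -γ 0 1 * x + D * γ 0 0 * y) = y := by
    linear_combination y * hd - D * y * hD
  rw [e1, e2] at h'
  rw [← h', ← mul_assoc, hd, one_mul]

theorem FormEquiv.trans {f g k : BinaryCubic} (h : FormEquiv f g) (h' : FormEquiv g k) :
    FormEquiv f k := by
  obtain ⟨γ, hu, h⟩ := h
  obtain ⟨δ, hu', h'⟩ := h'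
  rw [actsTo_iff] at h h'
  refine ⟨δ * γ, by rw [Matrix.det_mul]; exact hu'.mul hu, ?_⟩
  rw [actsTo_iff]
  intro x y
  rw [Matrix.det_mul, mul_comm δ.det, mul_assoc, h', h]
  simp only [Matrix.mul_apply, Fin.sum_univ_two]
  congr 2 <;> ring

theorem discF_eq_of_formEquiv {f g : BinaryCubic} (h : FormEquiv f g) : discF f = discF g := by
  obtain ⟨γ, hu, h⟩ := h
  rw [actsTo_iff] at h
  have hd := isUnit_int_sq hu
  obtain ⟨a, b, c, d⟩ := f
  obtain ⟨a', b', c', d'⟩ := g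
  have h1 := h 1 0
  have h2 := h 0 1
  have h3 := h 1 1
  have h4 := h 1 (-1)
  rw [Matrix.det_fin_two] at *
  generalize γ 0 0 = p at *
  generalize γ 0 1 = q at *
  generalize γ 1 0 = r at *
  generalize γ 1 1 = s at *
  simp only [evalForm] at h1 h2 h3 h4
  set D := p * s - q * r with hD
  have ea : a' = D * (a * p ^ 3 + b * p ^ 2 * q + c * p * q ^ 2 + d * q ^ 3) := by
    linear_combination (-a') * hd + D * h1
  have ed : d' = D * (a * r ^ 3 + b * r ^ 2 * s + c * r * s ^ 2 + d * s ^ 3) := by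
    linear_combination (-d') * hd + D * h2
  have ec : c' = D * (3 * a * p * r ^ 2 + b * (2 * p * r * s + q * r ^ 2)
      + c * (2 * q * r * s + p * s ^ 2) + 3 * d * q * s ^ 2) := by
    have : 2 * c' = 2 * (D * (3 * a * p * r ^ 2 + b * (2 * p * r * s + q * r ^ 2)
      + c * (2 * q * r * s + p * s ^ 2) + 3 * d * q * s ^ 2)) := by
      linear_combination (-2 * c') * hd + D * (h3 + h4 - 2 * h1)
    linarith
  have eb : b' = D * (3 * a * p ^ 2 * r + b * (2 * p * q * r + p ^ 2 * s)
      + c * (2 * p * q * s + q ^ 2 * r) + 3 * d * q ^ 2 * s) := by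
    have : 2 * b' = 2 * (D * (3 * a * p ^ 2 * r + b * (2 * p * q * r + p ^ 2 * s)
      + c * (2 * p * q * s + q ^ 2 * r) + 3 * d * q ^ 2 * s)) := by
      linear_combination (-2 * b') * hd + D * (h3 - h4 - 2 * h2)
    linarith
  simp only [discF]
  rw [ea, eb, ec, ed]
  have h10 : D ^ 10 = 1 := by
    have : D ^ 10 = (D * D) ^ 5 := by ring
    rw [this, hd, one_pow]
  have : ∀ T : ℤ, T = D ^ 10 * T := fun T => by rw [h10, one_mul]
  rw [this (b ^ 2 * c ^ 2 - 4 * a * c ^ 3 - 4 * b ^ 3 * d - 27 * a ^ 2 * d ^ 2 + 18 * a * b * c * d)]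
  have e : D ^ 10 = D ^ 4 * (p * s - q * r) ^ 6 := by rw [← hD]; ring
  rw [e]
  clear_value D
  ring

theorem eval_map_toPoly (f : BinaryCubic) (t : Fin 2 → ℚ) :
    MvPolynomial.eval t (MvPolynomial.map (Int.castRingHom ℚ) (toPoly f)) =
      f.1 * t 0 ^ 3 + f.2.1 * t 0 ^ 2 * t 1 + f.2.2.1 * t 0 * t 1 ^ 2 + f.2.2.2 * t 1 ^ 3 := by
  simp [toPoly]

theorem irredForm_of_no_zero {f : BinaryCubic}
    (h : ∀ r s : ℤ, evalForm f (r, s) = 0 → r = 0 ∧ s = 0) : IrredForm f := by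
  set F := MvPolynomial.map (Int.castRingHom ℚ) (toPoly f) with hF
  have ha : f.1 ≠ 0 := by
    intro h0
    have := h 1 0 (by simp [evalForm, h0])
    simp at this
  let φ : MvPolynomial (Fin 2) ℚ →ₐ[ℚ] Polynomial ℚ :=
    MvPolynomial.aeval ![Polynomial.X, 1]
  have hφF : φ F = Polynomial.C (f.1 : ℚ) * Polynomial.X ^ 3 + Polynomial.C (f.2.1 : ℚ) * Polynomial.X ^ 2
      + Polynomial.C (f.2.2.1 : ℚ) * Polynomial.X + Polynomial.C (f.2.2.2 : ℚ) := by
    simp [φ, hF, toPoly]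
  have haq : (f.1 : ℚ) ≠ 0 := by exact_mod_cast ha
  have hdeg : (φ F).natDegree = 3 := by
    rw [hφF]; exact Polynomial.natDegree_cubic haq
  have hirr : Irreducible (φ F) := by
    apply Polynomial.irreducible_of_degree_le_three_of_not_isRoot
    · rw [hdeg]; simp
    · intro x hx
      rw [Polynomial.IsRoot, hφF] at hx
      simp only [Polynomial.eval_add, Polynomial.eval_mul, Polynomial.eval_C, Polynomial.eval_pow,
        Polynomial.eval_X] at hx
      have hden : (x.den : ℚ) ≠ 0 := by exact_mod_cast x.den_nz
      have hx' : x = x.num / x.den := (Rat.num_div_den x).symm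
      have := h x.num x.den (by
        simp only [evalForm]
        have : ((f.1 : ℚ) * x.num ^ 3 + f.2.1 * x.num ^ 2 * x.den + f.2.2.1 * x.num * x.den ^ 2 +
            f.2.2.2 * x.den ^ 3) = 0 := by
          rw [hx'] at hx
          field_simp at hx
          linear_combination hx
        exact_mod_cast this)
      exact x.den_nz (by exact_mod_cast this.2)
  have hle : ∀ G : MvPolynomial (Fin 2) ℚ, (φ G).natDegree ≤ G.totalDegree := by
    intro G
    have := MvPolynomial.aeval_natDegree_le (R := ℚ) G (m := G.totalDegree) le_rfl
      (![Polynomial.X, 1] : Fin 2 → Polynomial ℚ) (n := 1) (by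
        intro i; fin_cases i <;> simp)
    simpa using this
  have htot : F.totalDegree ≤ 3 := by
    have hmon : toPoly f = MvPolynomial.monomial (Finsupp.single 0 3) f.1 +
      MvPolynomial.monomial (Finsupp.single 0 2 + Finsupp.single 1 1) f.2.1 +
      MvPolynomial.monomial (Finsupp.single 0 1 + Finsupp.single 1 2) f.2.2.1 +
      MvPolynomial.monomial (Finsupp.single 1 3) f.2.2.2 := by
      simp [toPoly, MvPolynomial.monomial_eq, Finsupp.prod_add_index', pow_add, mul_assoc]
    have hm : ∀ (s : Fin 2 →₀ ℕ) (c : ℤ), s 0 + s 1 = 3 →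
        (MvPolynomial.monomial s c).totalDegree ≤ 3 := by
      intro s c hs
      refine (MvPolynomial.totalDegree_monomial_le _ _).trans ?_
      rw [Finsupp.sum_fintype _ _ (by simp)]
      simp [hs]
    have : (toPoly f).totalDegree ≤ 3 := by
      rw [hmon]
      refine (MvPolynomial.totalDegree_add _ _).trans (max_le ?_ (hm _ _ (by simp)))
      refine (MvPolynomial.totalDegree_add _ _).trans (max_le ?_ (hm _ _ (by simp)))
      exact (MvPolynomial.totalDegree_add _ _).trans
        (max_le (hm _ _ (by simp)) (hm _ _ (by simp)))
    exact (Finset.sup_mono (MvPolynomial.support_map_subset _ _)).trans this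
  have hF0 : F ≠ 0 := by
    intro h0
    rw [h0, map_zero] at hdeg
    simp at hdeg
  have unit_of : ∀ G H : MvPolynomial (Fin 2) ℚ, F = G * H → IsUnit (φ G) → IsUnit G := by
    intro G H hGH hu
    have hG0 : G ≠ 0 := by rintro rfl; simp at hGH; exact hF0 hGH
    have hH0 : H ≠ 0 := by rintro rfl; simp at hGH; exact hF0 hGH
    have h1 := MvPolynomial.totalDegree_mul_of_isDomain hG0 hH0
    have h2 : (φ G).natDegree = 0 := Polynomial.natDegree_eq_zero_of_isUnit hu
    have h3 : (φ H).natDegree = 3 := by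
      have h4 : φ F = φ G * φ H := by rw [hGH, map_mul]
      have h5 : φ F ≠ 0 := hirr.ne_zero
      rw [h4] at h5
      have h6 := Polynomial.natDegree_mul (left_ne_zero_of_mul h5) (right_ne_zero_of_mul h5)
      rw [← h4, hdeg, h2] at h6
      omega
    have h7 := hle H
    rw [← hGH] at h1
    have h8 : G.totalDegree = 0 := by omega
    rw [MvPolynomial.totalDegree_eq_zero_iff_eq_C] at h8
    rw [h8]
    apply IsUnit.map
    rw [isUnit_iff_ne_zero]
    intro h9
    rw [h9] at h8
    exact hG0 (by simpa using h8)
  refine ⟨fun hu => ?_, fun {G H} hGH => ?_⟩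
  · exact hirr.not_isUnit (hu.map φ)
  · rw [← hF] at hGH
    rcases hirr.isUnit_or_isUnit (by rw [hGH, map_mul]) with h1 | h1
    · exact Or.inl (unit_of G H hGH h1)
    · exact Or.inr (unit_of H G (by rw [hGH, mul_comm]) h1)

theorem not_isUnit_of_eval_zero {G : MvPolynomial (Fin 2) ℚ} {t : Fin 2 → ℚ}
    (h : MvPolynomial.eval t G = 0) : ¬ IsUnit G := fun hu => by
  have := hu.map (MvPolynomial.eval t)
  rw [h] at this
  exact not_isUnit_zero this

theorem IrredForm.no_zero {f : BinaryCubic} (hf : IrredForm f) (r s : ℤ)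
    (h : evalForm f (r, s) = 0) : r = 0 ∧ s = 0 := by
  obtain ⟨a, b, c, d⟩ := f
  simp only [evalForm] at h
  have hq : (a : ℚ) * r ^ 3 + b * r ^ 2 * s + c * r * s ^ 2 + d * s ^ 3 = 0 := by exact_mod_cast h
  by_contra hrs
  by_cases hs : s = 0
  · subst hs
    have hr : r ≠ 0 := fun h0 => hrs ⟨h0, rfl⟩
    have ha : a = 0 := by simpa [hr] using h
    have key : MvPolynomial.map (Int.castRingHom ℚ) (toPoly (a, b, c, d)) =
        MvPolynomial.X 1 * (MvPolynomial.C (b : ℚ) * MvPolynomial.X 0 ^ 2 +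
        MvPolynomial.C (c : ℚ) * MvPolynomial.X 0 * MvPolynomial.X 1 +
        MvPolynomial.C (d : ℚ) * MvPolynomial.X 1 ^ 2) := by
      simp [toPoly, ha]; ring
    rcases hf.isUnit_or_isUnit key with h1 | h1
    · exact not_isUnit_of_eval_zero (t := 0) (by simp) h1
    · exact not_isUnit_of_eval_zero (t := 0) (by simp) h1
  · have hsq : (s : ℚ) ≠ 0 := by exact_mod_cast hs
    set θ : ℚ := r / s with hθ
    have hroot : (a : ℚ) * θ ^ 3 + b * θ ^ 2 + c * θ + d = 0 := by
      rw [hθ]; field_simp; linear_combination hq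
    have key : MvPolynomial.map (Int.castRingHom ℚ) (toPoly (a, b, c, d)) =
        (MvPolynomial.X 0 - MvPolynomial.C θ * MvPolynomial.X 1) *
        (MvPolynomial.C (a : ℚ) * MvPolynomial.X 0 ^ 2 +
        MvPolynomial.C (b + a * θ : ℚ) * MvPolynomial.X 0 * MvPolynomial.X 1 +
        MvPolynomial.C (c + b * θ + a * θ ^ 2 : ℚ) * MvPolynomial.X 1 ^ 2) := by
      apply MvPolynomial.funext
      intro t
      rw [eval_map_toPoly]
      simp
      linear_combination (t 1) ^ 3 * hroot
    rcases hf.isUnit_or_isUnit key with h1 | h1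
    · exact not_isUnit_of_eval_zero (t := 0) (by simp) h1
    · exact not_isUnit_of_eval_zero (t := 0) (by simp) h1

/-- A form is irreducible exactly when it has no nontrivial integral zero. -/
theorem irredForm_iff (f : BinaryCubic) :
    IrredForm f ↔ ∀ r s : ℤ, evalForm f (r, s) = 0 → r = 0 ∧ s = 0 :=
  ⟨fun hf r s => hf.no_zero r s, irredForm_of_no_zero⟩

theorem irredForm_of_formEquiv {f g : BinaryCubic} (h : FormEquiv f g) (hf : IrredForm f) :
    IrredForm g := by
  rw [irredForm_iff] at *
  obtain ⟨γ, hu, h⟩ := h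
  rw [actsTo_iff] at h
  have hd := isUnit_int_sq hu
  intro r s hrs
  have h1 := h r s
  rw [hrs, mul_zero] at h1
  obtain ⟨e1, e2⟩ := hf _ _ h1.symm
  rw [Matrix.det_fin_two] at hd
  constructor
  · linear_combination (-r) * hd + (γ 0 0 * γ 1 1 - γ 0 1 * γ 1 0) * (γ 1 1 * e1 - γ 1 0 * e2)
  · linear_combination (-s) * hd + (γ 0 0 * γ 1 1 - γ 0 1 * γ 1 0) * (γ 0 0 * e2 - γ 0 1 * e1)

theorem IrredForm.fst_ne_zero {f : BinaryCubic} (hf : IrredForm f) : f.1 ≠ 0 := by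
  intro h
  rw [irredForm_iff] at hf
  have := hf 1 0 (by simp [evalForm, h])
  simp at this

/-! ### Roots of a binary cubic form on the projective line over `ℤ/nℤ` -/

/-- The reduction of an integral form modulo `n`. -/
def reduceForm (n : ℕ) (f : BinaryCubic) : ZMod n × ZMod n × ZMod n × ZMod n :=
  ((f.1 : ZMod n), (f.2.1 : ZMod n), (f.2.2.1 : ZMod n), (f.2.2.2 : ZMod n))

theorem evalForm_smul {A : Type*} [CommRing A] (f : A × A × A × A) (u x y : A) :
    evalForm f (u * x, u * y) = u ^ 3 * evalForm f (x, y) := by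
  simp only [evalForm]; ring

/-- Unimodular pairs over `ℤ/nℤ`. -/
abbrev UnimodPair (n : ℕ) : Type :=
  { v : ZMod n × ZMod n // Ideal.span {v.1, v.2} = ⊤ }

/-- The class in `ProjLine n` of a unimodular pair. -/
def ProjLine.mk {n : ℕ} (v : UnimodPair n) : ProjLine n := Quot.mk _ v

theorem ProjLine.mk_eq_iff {n : ℕ} (v w : UnimodPair n) :
    ProjLine.mk v = ProjLine.mk w ↔
      ∃ u : (ZMod n)ˣ, w.1.1 = (u : ZMod n) * v.1.1 ∧ w.1.2 = (u : ZMod n) * v.1.2 := by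
  have heq : Equivalence (fun v w : UnimodPair n =>
      ∃ u : (ZMod n)ˣ, w.1.1 = (u : ZMod n) * v.1.1 ∧ w.1.2 = (u : ZMod n) * v.1.2) := by
    refine ⟨fun v => ⟨1, by simp⟩, fun {v w} ⟨u, h1, h2⟩ => ⟨u⁻¹, by simp [h1, h2]⟩,
      fun {v w z} ⟨u, h1, h2⟩ ⟨u', h3, h4⟩ => ⟨u' * u, ?_⟩⟩
    rw [h3, h4, h1, h2]
    simp [mul_assoc]
  exact Quot.eq.trans (heq.eqvGen_iff)

theorem ProjLine.mk_rep {n : ℕ} (q : ProjLine n) :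
    ∃ v : UnimodPair n, ProjLine.mk v = q ∧ q.rep = v.1 :=
  ⟨Classical.choose (Quot.exists_rep q), Classical.choose_spec (Quot.exists_rep q), rfl⟩

theorem evalForm_rep_mk {n : ℕ} (v : UnimodPair n) (F : ZMod n × ZMod n × ZMod n × ZMod n) :
    evalForm F (ProjLine.mk v).rep = 0 ↔ evalForm F v.1 = 0 := by
  obtain ⟨w, hw, hr⟩ := (ProjLine.mk v).mk_rep
  rw [hr]
  rw [ProjLine.mk_eq_iff] at hw
  obtain ⟨u, h1, h2⟩ := hw
  have : v.1 = ((u : ZMod n) * w.1.1, (u : ZMod n) * w.1.2) := Prod.ext h1 h2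
  rw [this, evalForm_smul]
  constructor
  · intro h
    have : evalForm F (w.1.1, w.1.2) = 0 := h
    rw [this, mul_zero]
  · intro h
    exact (((u ^ 3).isUnit.mul_right_eq_zero).1 (by simpa using h) : evalForm F w.1 = 0)

theorem wn_eq (n : ℕ) (f : BinaryCubic) :
    wn n f = Nat.card { q : ProjLine n // evalForm (reduceForm n f) q.rep = 0 } := rfl

theorem span_pair_eq_top_iff {R : Type*} [CommRing R] (x y : R) :
    Ideal.span {x, y} = ⊤ ↔ IsCoprime x y := by
  rw [Ideal.eq_top_iff_one, Ideal.mem_span_pair]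
  rfl

instance (n : ℕ) [NeZero n] : Finite (ProjLine n) := by
  unfold ProjLine; infer_instance

theorem wn_le_of_formEquiv {n : ℕ} [NeZero n] {f g : BinaryCubic} (h : FormEquiv f g) :
    wn n g ≤ wn n f := by
  obtain ⟨γ, hu, h⟩ := h
  set D := γ.det with hD
  rw [Matrix.det_fin_two] at hD
  have hdd := isUnit_int_sq hu
  unfold ActsTo at h
  -- transport the identity to `ZMod n`
  have hev : ∀ x y : ZMod n, (D : ZMod n) * evalForm (reduceForm n g) (x, y) =
      evalForm (reduceForm n f) ((γ 0 0 : ZMod n) * x + (γ 1 0 : ZMod n) * y,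
        (γ 0 1 : ZMod n) * x + (γ 1 1 : ZMod n) * y) := by
    intro x y
    have := congrArg (MvPolynomial.aeval (R := ℤ) ![x, y]) h
    simpa [toPoly, evalForm, reduceForm] using this
  have hDD : (D : ZMod n) * D = 1 := by exact_mod_cast congrArg (Int.cast : ℤ → ZMod n) hdd
  have hD' : (D : ZMod n) = (γ 0 0 : ZMod n) * γ 1 1 - (γ 0 1 : ZMod n) * γ 1 0 := by
    rw [hD]; push_cast; ring
  generalize (γ 0 0 : ZMod n) = p at *
  generalize (γ 0 1 : ZMod n) = q at *
  generalize (γ 1 0 : ZMod n) = r at *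
  generalize (γ 1 1 : ZMod n) = s at *
  generalize (D : ZMod n) = E at *
  let T : UnimodPair n → UnimodPair n := fun v =>
    ⟨(p * v.1.1 + r * v.1.2, q * v.1.1 + s * v.1.2), by
      have := v.2
      rw [span_pair_eq_top_iff] at this ⊢
      obtain ⟨α, β, hab⟩ := this
      exact ⟨E * (α * s - β * q), E * (β * p - α * r), by
        simp only
        linear_combination hDD + E * E * hab - E * (α * v.1.1 + β * v.1.2) * hD'⟩⟩
  let T' : ProjLine n → ProjLine n := Quot.map T (by
    rintro v w ⟨u, h1, h2⟩
    refine ⟨u, ?_, ?_⟩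
    · simp only [T, h1, h2]; ring
    · simp only [T, h1, h2]; ring)
  have hT' : ∀ v, T' (ProjLine.mk v) = ProjLine.mk (T v) := fun v => rfl
  rw [wn_eq, wn_eq]
  refine Nat.card_le_card_of_injective
    (fun q : { q : ProjLine n // evalForm (reduceForm n g) q.rep = 0 } =>
      (⟨T' q.1, ?_⟩ : { q : ProjLine n // evalForm (reduceForm n f) q.rep = 0 })) ?_
  · obtain ⟨q, hq⟩ := q
    obtain ⟨v, rfl, hr⟩ := q.mk_rep
    simp only
    rw [hT', evalForm_rep_mk]
    rw [evalForm_rep_mk] at hq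
    have := hev v.1.1 v.1.2
    rw [show evalForm (reduceForm n g) (v.1.1, v.1.2) = 0 from hq, mul_zero] at this
    exact this.symm
  · rintro ⟨q, hq⟩ ⟨q', hq'⟩ hqq
    obtain ⟨v, rfl, hr⟩ := q.mk_rep
    obtain ⟨w, rfl, hr'⟩ := q'.mk_rep
    simp only [Subtype.mk.injEq, hT'] at hqq ⊢
    rw [ProjLine.mk_eq_iff] at hqq ⊢
    obtain ⟨u, h1, h2⟩ := hqq
    simp only [T] at h1 h2
    refine ⟨u, ?_, ?_⟩
    · linear_combination (-w.1.1 + u * v.1.1) * hDD + E * (s * h1 - r * h2) +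
        E * (w.1.1 - u * v.1.1) * hD'
    · linear_combination (-w.1.2 + u * v.1.2) * hDD + E * (p * h2 - q * h1) +
        E * (w.1.2 - u * v.1.2) * hD'

theorem wn_eq_of_formEquiv {n : ℕ} [NeZero n] {f g : BinaryCubic} (h : FormEquiv f g) :
    wn n f = wn n g :=
  le_antisymm (wn_le_of_formEquiv h.symm) (wn_le_of_formEquiv h)

/-- The number of affine roots `t` of `f(t,1)` modulo `m`. -/
noncomputable def rootCount (m : ℕ) (f : BinaryCubic) : ℕ :=
  Nat.card { t : ZMod m // evalForm (reduceForm m f) (t, 1) = 0 }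

section CRT

variable {n e m : ℕ}

theorem zmod_eq_of_castHom_eq (he : e ∣ n) (hm : m ∣ n) (hn : e * m = n) (hco : e.Coprime m)
    (x y : ZMod n) (h1 : ZMod.castHom he (ZMod e) x = ZMod.castHom he (ZMod e) y)
    (h2 : ZMod.castHom hm (ZMod m) x = ZMod.castHom hm (ZMod m) y) : x = y := by
  subst hn
  apply (ZMod.chineseRemainder hco).injective
  have : ∀ z : ZMod (e * m), ZMod.chineseRemainder hco z =
      (ZMod.castHom he (ZMod e) z, ZMod.castHom hm (ZMod m) z) := by
    intro z
    have : (ZMod.chineseRemainder hco : ZMod (e * m) →+* ZMod e × ZMod m) =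
      (ZMod.castHom he (ZMod e)).prod (ZMod.castHom hm (ZMod m)) := Subsingleton.elim _ _
    exact congrArg (fun φ : ZMod (e * m) →+* ZMod e × ZMod m => φ z) this
  rw [this, this, h1, h2]

theorem exists_zmod_castHom (he : e ∣ n) (hm : m ∣ n) (hn : e * m = n) (hco : e.Coprime m)
    (s : ZMod e) (t : ZMod m) : ∃ x : ZMod n,
      ZMod.castHom he (ZMod e) x = s ∧ ZMod.castHom hm (ZMod m) x = t := by
  subst hn
  obtain ⟨z, hz⟩ := (ZMod.chineseRemainder hco).surjective (s, t)
  have : (ZMod.chineseRemainder hco : ZMod (e * m) →+* ZMod e × ZMod m) =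
      (ZMod.castHom he (ZMod e)).prod (ZMod.castHom hm (ZMod m)) := Subsingleton.elim _ _
  have h := congrArg (fun φ : ZMod (e * m) →+* ZMod e × ZMod m => φ z) this
  have h' : (s, t) = (ZMod.castHom he (ZMod e) z, ZMod.castHom hm (ZMod m) z) := hz.symm.trans h
  exact ⟨z, (congrArg Prod.fst h').symm, (congrArg Prod.snd h').symm⟩

theorem evalForm_map {A B : Type*} [CommRing A] [CommRing B] (φ : A →+* B) (f : A × A × A × A)
    (v : A × A) : φ (evalForm f v) =
      evalForm (φ f.1, φ f.2.1, φ f.2.2.1, φ f.2.2.2) (φ v.1, φ v.2) := by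
  simp [evalForm]

theorem castHom_evalForm (he : e ∣ n) (f : BinaryCubic) (v : ZMod n × ZMod n) :
    ZMod.castHom he (ZMod e) (evalForm (reduceForm n f) v) =
      evalForm (reduceForm e f) (ZMod.castHom he (ZMod e) v.1, ZMod.castHom he (ZMod e) v.2) := by
  rw [evalForm_map]
  simp only [reduceForm, map_intCast]

theorem isUnit_of_castHom (he : e ∣ n) (hm : m ∣ n) (hn : e * m = n) (hco : e.Coprime m)
    (x : ZMod n) (h1 : IsUnit (ZMod.castHom he (ZMod e) x))
    (h2 : IsUnit (ZMod.castHom hm (ZMod m) x)) : IsUnit x := by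
  obtain ⟨s, hs⟩ := h1.exists_right_inv
  obtain ⟨t, ht⟩ := h2.exists_right_inv
  obtain ⟨y, rfl, rfl⟩ := exists_zmod_castHom he hm hn hco s t
  refine IsUnit.of_mul_eq_one y (zmod_eq_of_castHom_eq he hm hn hco _ _ ?_ ?_)
  · rw [map_mul, hs, map_one]
  · rw [map_mul, ht, map_one]

end CRT

theorem coprime_div_of_squarefree {n e : ℕ} (hn : Squarefree n) (he : e ∣ n) :
    e.Coprime (n / e) := by
  obtain ⟨m, rfl⟩ := he
  have he0 : 0 < e := Nat.pos_of_ne_zero (by rintro rfl; simp at hn)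
  rw [Nat.mul_div_cancel_left _ he0]
  exact Nat.coprime_of_squarefree_mul hn

/-- Stratification of the projective line over `ℤ/nℤ` by the divisor `e = gcd(y, n)`. -/
theorem wn_eq_sum {n : ℕ} (hn : Squarefree n) (f : BinaryCubic) :
    wn n f = ∑ e ∈ n.divisors, if (e : ℤ) ∣ f.1 then rootCount (n / e) f else 0 := by
  have hn0 : n ≠ 0 := hn.ne_zero
  have : NeZero n := ⟨hn0⟩
  have hdiv : ∀ e : n.divisors, e.1 ∣ n := fun e => Nat.dvd_of_mem_divisors e.2
  have hmul : ∀ e : n.divisors, e.1 * (n / e.1) = n := fun e => Nat.mul_div_cancel' (hdiv e)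
  have hco : ∀ e : n.divisors, e.1.Coprime (n / e.1) := fun e =>
    coprime_div_of_squarefree hn (hdiv e)
  have hdiv' : ∀ e : n.divisors, n / e.1 ∣ n := fun e => Nat.div_dvd_of_dvd (hdiv e)
  have hx : ∀ (e : n.divisors) (t : ZMod (n / e.1)), ∃ x : ZMod n,
      ZMod.castHom (hdiv e) (ZMod e) x = 1 ∧ ZMod.castHom (hdiv' e) (ZMod (n / e.1)) x = t :=
    fun e t => exists_zmod_castHom _ _ (hmul e) (hco e) 1 t
  have hy : ∀ (e : n.divisors), ∃ y : ZMod n,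
      ZMod.castHom (hdiv e) (ZMod e) y = 0 ∧ ZMod.castHom (hdiv' e) (ZMod (n / e.1)) y = 1 :=
    fun e => exists_zmod_castHom _ _ (hmul e) (hco e) 0 1
  choose x hx1 hx2 using hx
  choose y hy1 hy2 using hy
  have huni : ∀ e t, Ideal.span {x e t, y e} = ⊤ := by
    intro e t
    rw [span_pair_eq_top_iff]
    obtain ⟨z, hz1, hz2⟩ := exists_zmod_castHom (hdiv e) (hdiv' e) (hmul e) (hco e) 1 0
    obtain ⟨w, hw1, hw2⟩ := exists_zmod_castHom (hdiv e) (hdiv' e) (hmul e) (hco e) 0 1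
    refine ⟨z, w, zmod_eq_of_castHom_eq (hdiv e) (hdiv' e) (hmul e) (hco e) _ _ ?_ ?_⟩
    · simp [-ZMod.castHom_apply, hx1, hy1, hz1, hw1]
    · simp [-ZMod.castHom_apply, hx2, hy2, hz2, hw2]
  let Ψ : (Σ e : n.divisors, ZMod (n / e.1)) → UnimodPair n := fun p =>
    ⟨(x p.1 p.2, y p.1), huni p.1 p.2⟩
  have hdvd : ∀ (e e' : n.divisors) (u : ZMod n), y e = u * y e' → e'.1 ∣ e.1 := by
    intro e e' u h
    have hg : e'.1.Coprime (n / e.1) := by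
      set g := Nat.gcd e'.1 (n / e.1) with hg
      have hge : g ∣ e'.1 := Nat.gcd_dvd_left _ _
      have hgm : g ∣ n / e.1 := Nat.gcd_dvd_right _ _
      have h1 : ZMod.castHom (hge.trans (hdiv e')) (ZMod g) (y e') = 0 := by
        have := congrArg (ZMod.castHom hge (ZMod g)) (hy1 e')
        rw [map_zero, ← RingHom.comp_apply] at this
        rw [← this]
        congr 1
        exact Subsingleton.elim _ _
      have h2 : ZMod.castHom (hge.trans (hdiv e')) (ZMod g) (y e) = 1 := by
        have := congrArg (ZMod.castHom hgm (ZMod g)) (hy2 e)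
        rw [map_one, ← RingHom.comp_apply] at this
        rw [← this]
        congr 1
        exact Subsingleton.elim _ _
      rw [h, map_mul, h1, mul_zero] at h2
      have : (1 : ZMod g) = 0 := h2.symm
      have h3 : Nat.Coprime e'.1 (n / e.1) ↔ g = 1 := Iff.rfl
      rw [h3]
      have := (ZMod.natCast_eq_zero_iff 1 g).1 (by exact_mod_cast this)
      exact Nat.dvd_one.1 this
    exact hg.dvd_of_dvd_mul_right (by rw [hmul e]; exact hdiv e')
  have hinj : Function.Injective (fun p => ProjLine.mk (Ψ p)) := by
    rintro ⟨e, t⟩ ⟨e', t'⟩ h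
    obtain ⟨u, h1, h2⟩ := (ProjLine.mk_eq_iff _ _).1 h
    simp only [Ψ] at h1 h2
    have hee : e = e' := by
      apply Subtype.ext
      refine Nat.dvd_antisymm (hdvd e' e u h2) (hdvd e e' (↑u⁻¹) ?_)
      rw [h2]; simp
    subst hee
    have hu : ZMod.castHom (hdiv' e) (ZMod (n / e.1)) (u : ZMod n) = 1 := by
      have := congrArg (ZMod.castHom (hdiv' e) (ZMod (n / e.1))) h2
      rw [map_mul, hy2, mul_one] at this
      exact this.symm
    have := congrArg (ZMod.castHom (hdiv' e) (ZMod (n / e.1))) h1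
    rw [map_mul, hx2, hx2, hu, one_mul] at this
    rw [this]
  have hsurj : ∀ q : ProjLine n, ∃ p, ProjLine.mk (Ψ p) = q := by
    intro q
    obtain ⟨⟨⟨a, b⟩, hv⟩, rfl, -⟩ := q.mk_rep
    set e0 := Nat.gcd b.val n with he0
    have hen : e0 ∣ n := Nat.gcd_dvd_right _ _
    let e : n.divisors := ⟨e0, Nat.mem_divisors.2 ⟨hen, hn0⟩⟩
    have hb0 : ZMod.castHom (hdiv e) (ZMod e.1) b = 0 := by
      rw [← ZMod.natCast_zmod_val b, map_natCast, ZMod.natCast_eq_zero_iff]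
      exact Nat.gcd_dvd_left _ _
    have hbu : IsUnit (ZMod.castHom (hdiv' e) (ZMod (n / e.1)) b) := by
      rw [← ZMod.natCast_zmod_val b, map_natCast, ZMod.isUnit_iff_coprime]
      have h1 : Nat.gcd b.val (n / e0) ∣ e0 := Nat.dvd_gcd (Nat.gcd_dvd_left _ _)
        ((Nat.gcd_dvd_right _ _).trans (Nat.div_dvd_of_dvd hen))
      exact Nat.eq_one_of_dvd_coprimes (hco e) h1 (Nat.gcd_dvd_right _ _)
    have hau : IsUnit (ZMod.castHom (hdiv e) (ZMod e.1) a) := by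
      rw [span_pair_eq_top_iff] at hv
      obtain ⟨α, β, h⟩ := hv
      have := congrArg (ZMod.castHom (hdiv e) (ZMod e.1)) h
      rw [map_add, map_mul, map_mul, hb0, mul_zero, add_zero, map_one] at this
      exact IsUnit.of_mul_eq_one_right _ this
    obtain ⟨binv, hbinv⟩ := hbu.exists_right_inv
    obtain ⟨u, hu1, hu2⟩ := exists_zmod_castHom (hdiv e) (hdiv' e) (hmul e) (hco e)
      (ZMod.castHom (hdiv e) (ZMod e.1) a) (ZMod.castHom (hdiv' e) (ZMod (n / e.1)) b)
    have huu : IsUnit u := isUnit_of_castHom (hdiv e) (hdiv' e) (hmul e) (hco e) u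
      (by rw [hu1]; exact hau) (by rw [hu2]; exact hbu)
    obtain ⟨u, rfl⟩ := huu
    refine ⟨⟨e, ZMod.castHom (hdiv' e) (ZMod (n / e.1)) a * binv⟩, ?_⟩
    rw [ProjLine.mk_eq_iff]
    refine ⟨u, zmod_eq_of_castHom_eq (hdiv e) (hdiv' e) (hmul e) (hco e) _ _ ?_ ?_,
      zmod_eq_of_castHom_eq (hdiv e) (hdiv' e) (hmul e) (hco e) _ _ ?_ ?_⟩
    · rw [map_mul, hu1, hx1, mul_one]
    · rw [map_mul, hu2, hx2]
      linear_combination (-(ZMod.castHom (hdiv' e) (ZMod (n / e.1)) a)) * hbinv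
    · rw [map_mul, hy1, hb0, mul_zero]
    · rw [map_mul, hu2, hy2, mul_one]
  have hzero : ∀ p, evalForm (reduceForm n f) (ProjLine.mk (Ψ p)).rep = 0 ↔
      ((p.1.1 : ℤ) ∣ f.1 ∧ evalForm (reduceForm (n / p.1.1) f) (p.2, 1) = 0) := by
    rintro ⟨e, t⟩
    rw [evalForm_rep_mk]
    have h1 := castHom_evalForm (hdiv e) f (Ψ ⟨e, t⟩).1
    have h2 := castHom_evalForm (hdiv' e) f (Ψ ⟨e, t⟩).1
    simp only [Ψ, hx1, hx2, hy1, hy2] at h1 h2 ⊢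
    have h3 : evalForm (reduceForm e.1 f) (1, 0) = (f.1 : ZMod e.1) := by
      simp [evalForm, reduceForm]
    rw [h3] at h1
    rw [← ZMod.intCast_zmod_eq_zero_iff_dvd, ← h1, ← h2]
    constructor
    · intro h; rw [h]; simp
    · rintro ⟨h4, h5⟩
      refine zmod_eq_of_castHom_eq (hdiv e) (hdiv' e) (hmul e) (hco e) _ _ ?_ ?_
      · rw [h4, map_zero]
      · rw [h5, map_zero]
  have hcard : wn n f = Nat.card { p : Σ e : n.divisors, ZMod (n / e.1) //
      (p.1.1 : ℤ) ∣ f.1 ∧ evalForm (reduceForm (n / p.1.1) f) (p.2, 1) = 0 } := by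
    rw [wn_eq]
    symm
    exact Nat.card_congr (Equiv.subtypeEquiv
      (Equiv.ofBijective _ ⟨hinj, fun q => hsurj q⟩) fun p => (hzero p).symm)
  have hfin : ∀ e : n.divisors, NeZero (n / e.1) := fun e =>
    ⟨by have := Nat.div_pos (Nat.le_of_dvd (Nat.pos_of_ne_zero hn0) (hdiv e))
          (Nat.pos_of_mem_divisors e.2)
        omega⟩
  have e1 : { p : Σ e : n.divisors, ZMod (n / e.1) //
      (p.1.1 : ℤ) ∣ f.1 ∧ evalForm (reduceForm (n / p.1.1) f) (p.2, 1) = 0 } ≃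
      Σ e : n.divisors, { t : ZMod (n / e.1) //
        (e.1 : ℤ) ∣ f.1 ∧ evalForm (reduceForm (n / e.1) f) (t, 1) = 0 } :=
    ⟨fun p => ⟨p.1.1, ⟨p.1.2, p.2⟩⟩, fun p => ⟨⟨p.1, p.2.1⟩, p.2.2⟩, fun _ => rfl, fun _ => rfl⟩
  rw [hcard, Nat.card_congr e1, Nat.card_sigma]
  rw [← Finset.sum_coe_sort n.divisors
    (fun e : ℕ => if (e : ℤ) ∣ f.1 then rootCount (n / e) f else 0)]
  refine Finset.sum_congr rfl fun e _ => ?_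
  split_ifs with h
  · simp only [h, true_and, rootCount]
  · simp only [h, false_and]
    simp

/-- The content of an integral form. -/
def contF (f : BinaryCubic) : ℕ :=
  Nat.gcd (Nat.gcd f.1.natAbs f.2.1.natAbs) (Nat.gcd f.2.2.1.natAbs f.2.2.2.natAbs)

theorem dvd_contF_iff {g : ℕ} {f : BinaryCubic} :
    g ∣ contF f ↔ (g : ℤ) ∣ f.1 ∧ (g : ℤ) ∣ f.2.1 ∧ (g : ℤ) ∣ f.2.2.1 ∧ (g : ℤ) ∣ f.2.2.2 := by
  simp only [contF, Nat.dvd_gcd_iff, Int.natCast_dvd, and_assoc]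

theorem rootCount_mul_le {e m : ℕ} [NeZero e] [NeZero m] (h : e.Coprime m) (f : BinaryCubic) :
    rootCount (e * m) f ≤ rootCount e f * rootCount m f := by
  unfold rootCount
  rw [← Nat.card_prod]
  have he : e ∣ e * m := dvd_mul_right _ _
  have hm : m ∣ e * m := dvd_mul_left _ _
  refine Nat.card_le_card_of_injective
    (fun t : { t : ZMod (e * m) // evalForm (reduceForm (e * m) f) (t, 1) = 0 } =>
      ((⟨ZMod.castHom he (ZMod e) t.1, ?_⟩, ⟨ZMod.castHom hm (ZMod m) t.1, ?_⟩) :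
        { t : ZMod e // evalForm (reduceForm e f) (t, 1) = 0 } ×
        { t : ZMod m // evalForm (reduceForm m f) (t, 1) = 0 })) ?_
  · have := castHom_evalForm he f (t.1, 1)
    rw [t.2, map_zero] at this
    simpa [-ZMod.castHom_apply] using this.symm
  · have := castHom_evalForm hm f (t.1, 1)
    rw [t.2, map_zero] at this
    simpa [-ZMod.castHom_apply] using this.symm
  · rintro ⟨t, ht⟩ ⟨t', ht'⟩ h'
    simp only [Prod.mk.injEq, Subtype.mk.injEq] at h' ⊢
    exact zmod_eq_of_castHom_eq he hm rfl h _ _ h'.1 h'.2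

theorem rootCount_prime_le {p : ℕ} (hp : p.Prime) (f : BinaryCubic) :
    rootCount p f ≤ 3 * Nat.gcd p (contF f) := by
  have : Fact p.Prime := ⟨hp⟩
  by_cases hc : p ∣ contF f
  · rw [Nat.gcd_eq_left hc]
    calc rootCount p f ≤ Nat.card (ZMod p) :=
          Nat.card_le_card_of_injective _ Subtype.val_injective
      _ = p := by simp
      _ ≤ 3 * p := by omega
  · have h1 : 1 ≤ Nat.gcd p (contF f) := Nat.gcd_pos_of_pos_left _ hp.pos
    have hP : rootCount p f ≤ 3 := by
      let P : Polynomial (ZMod p) := (Cubic.mk (f.1 : ZMod p) f.2.1 f.2.2.1 f.2.2.2).toPoly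
      have hP0 : P ≠ 0 := by
        intro h0
        apply hc
        rw [dvd_contF_iff]
        rw [Cubic.toPoly_eq_zero_iff, Cubic.ext_iff] at h0
        obtain ⟨h3, h2, h1, h00⟩ := h0
        exact ⟨(ZMod.intCast_zmod_eq_zero_iff_dvd _ _).1 h3,
          (ZMod.intCast_zmod_eq_zero_iff_dvd _ _).1 h2,
          (ZMod.intCast_zmod_eq_zero_iff_dvd _ _).1 h1,
          (ZMod.intCast_zmod_eq_zero_iff_dvd _ _).1 h00⟩
      calc rootCount p f ≤ Nat.card (P.roots.toFinset) := by
            refine Nat.card_le_card_of_injective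
              (fun t : { t : ZMod p // evalForm (reduceForm p f) (t, 1) = 0 } =>
                (⟨t.1, ?_⟩ : P.roots.toFinset)) ?_
            · rw [Multiset.mem_toFinset, Polynomial.mem_roots hP0, Polynomial.IsRoot]
              have := t.2
              simpa [P, Cubic.toPoly, evalForm, reduceForm] using this
            · intro t t' h
              exact Subtype.ext (by simpa using h)
        _ = P.roots.toFinset.card := by rw [Nat.card_eq_fintype_card, Fintype.card_coe]
        _ ≤ P.natDegree := (Multiset.toFinset_card_le _).trans (Polynomial.card_roots' P)
        _ ≤ 3 := Polynomial.natDegree_cubic_le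
    omega

theorem rootCount_le {m : ℕ} (hm : Squarefree m) (f : BinaryCubic) :
    rootCount m f ≤ 3 ^ m.primeFactors.card * Nat.gcd m (contF f) := by
  induction m using induction_on_primes with
  | zero => simp at hm
  | one =>
    have : rootCount 1 f ≤ Nat.card (ZMod 1) :=
      Nat.card_le_card_of_injective _ Subtype.val_injective
    simpa using this
  | prime_mul p a hp ih =>
    have hco := Nat.coprime_of_squarefree_mul hm
    have ha : Squarefree a := hm.squarefree_of_dvd (dvd_mul_left _ _)
    have : NeZero p := ⟨hp.ne_zero⟩
    have : NeZero a := ⟨ha.ne_zero⟩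
    refine (rootCount_mul_le hco f).trans ((Nat.mul_le_mul (rootCount_prime_le hp f)
      (ih ha)).trans (le_of_eq ?_))
    rw [hco.primeFactors_mul, Nat.Coprime.mul_gcd hco, Finset.card_union_of_disjoint
      hco.disjoint_primeFactors, hp.primeFactors, Finset.card_singleton]
    ring

theorem card_divisors_of_squarefree {n : ℕ} (hn : Squarefree n) :
    n.divisors.card = 2 ^ n.primeFactors.card := by
  rw [Nat.card_divisors hn.ne_zero, Finset.prod_congr rfl (g := fun _ => 2), Finset.prod_const]
  intro p hp
  rw [Nat.mem_primeFactors] at hp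
  have h1 := hn.natFactorization_le_one p
  have h2 := hp.1.factorization_pos_of_dvd hp.2.2 hp.2.1
  omega

theorem wn_le {n : ℕ} (hn : Squarefree n) (f : BinaryCubic) :
    wn n f ≤ 6 ^ n.primeFactors.card * Nat.gcd n (contF f) := by
  rw [wn_eq_sum hn]
  calc _ ≤ ∑ e ∈ n.divisors, 3 ^ n.primeFactors.card * Nat.gcd n (contF f) := by
        refine Finset.sum_le_sum fun e he => ?_
        have hd := Nat.div_dvd_of_dvd (Nat.dvd_of_mem_divisors he)
        split_ifs
        · refine (rootCount_le (hn.squarefree_of_dvd hd) f).trans (Nat.mul_le_mul ?_ ?_)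
          · exact Nat.pow_le_pow_right (by norm_num)
              (Finset.card_le_card (Nat.primeFactors_mono hd hn.ne_zero))
          · exact Nat.le_of_dvd (Nat.gcd_pos_of_pos_left _ (Nat.pos_of_ne_zero hn.ne_zero))
              (Nat.gcd_dvd_gcd_of_dvd_left _ hd)
        · exact Nat.zero_le _
    _ = _ := by
        rw [Finset.sum_const, card_divisors_of_squarefree hn, smul_eq_mul, ← mul_assoc, ← mul_pow]
        norm_num

theorem pow_card_primeFactors_le (A : ℝ) (hA : 1 ≤ A) (δ : ℝ) (hδ : 0 < δ) :
    ∃ C : ℝ, 0 < C ∧ ∀ n : ℕ, Squarefree n → A ^ n.primeFactors.card ≤ C * (n : ℝ) ^ δ := by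
  obtain ⟨P, hP⟩ := exists_nat_ge (A ^ (1 / δ))
  have hA0 : 0 < A := by linarith
  refine ⟨A ^ (P + 1), by positivity, fun n hn => ?_⟩
  have h1 : (n : ℝ) ^ δ = ∏ p ∈ n.primeFactors, (p : ℝ) ^ δ := by
    conv_lhs => rw [← Nat.prod_primeFactors_of_squarefree hn]
    rw [Nat.cast_prod, Real.finsetProd_rpow]
    intro i _; positivity
  have h2 : A ^ n.primeFactors.card ≤
      ∏ p ∈ n.primeFactors, ((if p ≤ P then A else 1) * (p : ℝ) ^ δ) := by
    rw [← Finset.prod_const]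
    refine Finset.prod_le_prod (fun _ _ => hA0.le) fun p hp => ?_
    have hp1 : (1 : ℝ) ≤ p := by
      exact_mod_cast (Nat.prime_of_mem_primeFactors hp).one_lt.le
    split_ifs with h
    · exact le_mul_of_one_le_right hA0.le (Real.one_le_rpow hp1 hδ.le)
    · rw [one_mul]
      have : A ^ (1 / δ) ≤ p := hP.trans (by exact_mod_cast (by omega : P ≤ p))
      calc A = (A ^ (1 / δ)) ^ δ := by
            rw [← Real.rpow_mul hA0.le, one_div_mul_cancel hδ.ne', Real.rpow_one]
        _ ≤ _ := Real.rpow_le_rpow (by positivity) this hδ.le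
  have h3 : ∏ p ∈ n.primeFactors, (if p ≤ P then A else (1 : ℝ)) ≤ A ^ (P + 1) := by
    rw [← Finset.prod_filter, Finset.prod_const]
    refine pow_le_pow_right₀ hA ?_
    calc _ ≤ (Finset.range (P + 1)).card := by
          refine Finset.card_le_card fun p hp => ?_
          rw [Finset.mem_filter] at hp
          exact Finset.mem_range.2 (by omega)
      _ = P + 1 := by simp
  rw [Finset.prod_mul_distrib, ← h1] at h2
  exact h2.trans (mul_le_mul_of_nonneg_right h3 (by positivity))

/-! ### Real binary cubic forms and their points in the upper half plane

The Boolean `s` records the sign of the discriminant (`true` for positive). -/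

/-- The form `Re((p+qi)(x-zy)³)` (if `s`) or `Re((p+qi)(x-zy))·|x-zy|²` (otherwise),
where `z = u+vi`, by its coefficients. -/
def paramForm (s : Bool) (p q u v : ℝ) : ℝ × ℝ × ℝ × ℝ :=
  bif s then
    (p, -3 * u * p + 3 * q * v, 3 * u ^ 2 * p - 6 * u * v * q - 3 * v ^ 2 * p,
      -u ^ 3 * p + 3 * u ^ 2 * v * q + 3 * u * v ^ 2 * p - v ^ 3 * q)
  else
    (p, -3 * u * p + q * v, 3 * u ^ 2 * p - 2 * u * v * q + v ^ 2 * p,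
      -u ^ 3 * p + u ^ 2 * v * q - u * v ^ 2 * p + v ^ 3 * q)

/-- The discriminant of a real binary cubic form. -/
def discR (f : ℝ × ℝ × ℝ × ℝ) : ℝ :=
  f.2.1 ^ 2 * f.2.2.1 ^ 2 - 4 * f.1 * f.2.2.1 ^ 3 - 4 * f.2.1 ^ 3 * f.2.2.2 -
    27 * f.1 ^ 2 * f.2.2.2 ^ 2 + 18 * f.1 * f.2.1 * f.2.2.1 * f.2.2.2

/-- The discriminant of `paramForm s 1 0 0 1`, up to sign. -/
def discConst (s : Bool) : ℝ := bif s then 108 else 4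

theorem discConst_pos (s : Bool) : 0 < discConst s := by cases s <;> norm_num [discConst]

/-- The discriminant multiplied by the sign encoded by `s`. -/
def sdisc (s : Bool) (f : ℝ × ℝ × ℝ × ℝ) : ℝ := bif s then discR f else -discR f

theorem sdisc_paramForm (s : Bool) (p q u v : ℝ) :
    sdisc s (paramForm s p q u v) = discConst s * ((p ^ 2 + q ^ 2) * v ^ 3) ^ 2 := by
  cases s <;> simp only [sdisc, discR, paramForm, discConst, cond_true, cond_false] <;> ring

/-- Unified evaluation: `Re(Γζ³)` or `Re(Γζ)|ζ|²`. -/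
noncomputable def pointEval (s : Bool) (Γ ζ : ℂ) : ℝ :=
  bif s then (Γ * ζ ^ 3).re else (Γ * ζ).re * Complex.normSq ζ

theorem evalForm_paramForm (s : Bool) (p q u v x y : ℝ) :
    evalForm (paramForm s p q u v) (x, y) = pointEval s ⟨p, q⟩ (x - ⟨u, v⟩ * y) := by
  cases s <;> simp [evalForm, paramForm, pointEval, pow_succ, Complex.normSq_apply] <;> ring

theorem evalForm_ext_real {f g : ℝ × ℝ × ℝ × ℝ}
    (h : ∀ x y, evalForm f (x, y) = evalForm g (x, y)) : f = g := by
  obtain ⟨a, b, c, d⟩ := f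
  obtain ⟨a', b', c', d'⟩ := g
  have h1 := h 1 0
  have h2 := h 0 1
  have h3 := h 1 1
  have h4 := h 1 (-1)
  simp only [evalForm] at h1 h2 h3 h4
  simp only [Prod.mk.injEq]
  refine ⟨?_, ?_, ?_, ?_⟩ <;> linarith

/-- The form `f` has `z` as its associated point. -/
def HasPoint (s : Bool) (f : ℝ × ℝ × ℝ × ℝ) (z : ℂ) : Prop :=
  ∃ Γ : ℂ, ∀ x y : ℝ, evalForm f (x, y) = pointEval s Γ (x - z * y)

theorem hasPoint_iff (s : Bool) (f : ℝ × ℝ × ℝ × ℝ) (z : ℂ) :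
    HasPoint s f z ↔ ∃ p q, f = paramForm s p q z.re z.im := by
  constructor
  · rintro ⟨Γ, h⟩
    refine ⟨Γ.re, Γ.im, evalForm_ext_real fun x y => ?_⟩
    rw [h, evalForm_paramForm]
  · rintro ⟨p, q, rfl⟩
    exact ⟨⟨p, q⟩, fun x y => by rw [evalForm_paramForm]⟩

theorem exists_pointEval_mul (s : Bool) (Γ w : ℂ) :
    ∃ Γ' : ℂ, ∀ ζ, pointEval s Γ (w * ζ) = pointEval s Γ' ζ := by
  cases s
  · refine ⟨Γ * w * Complex.normSq w, fun ζ => ?_⟩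
    simp [pointEval, Complex.normSq_apply]
    ring
  · refine ⟨Γ * w ^ 3, fun ζ => ?_⟩
    simp only [pointEval, cond_true]
    ring_nf

theorem exists_pointEval_neg_conj (s : Bool) (Γ : ℂ) :
    ∃ Γ' : ℂ, ∀ ζ, pointEval s Γ (-(starRingEnd ℂ) ζ) = pointEval s Γ' ζ := by
  cases s
  · refine ⟨-(starRingEnd ℂ) Γ, fun ζ => ?_⟩
    simp [pointEval, Complex.normSq_apply]
  · refine ⟨-(starRingEnd ℂ) Γ, fun ζ => ?_⟩
    simp [pointEval, pow_succ]
    ring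

/-- Equivariance of the associated point under `SL₂(ℝ)`. -/
theorem HasPoint.smul {s : Bool} {f g : ℝ × ℝ × ℝ × ℝ} {z z' : ℂ} (h : HasPoint s f z)
    {a b c d : ℝ} (hz : z' * (c * z + d) = a * z + b)
    (hg : ∀ x y : ℝ, evalForm g (x, y) = evalForm f (d * x - b * y, -c * x + a * y)) :
    HasPoint s g z' := by
  obtain ⟨Γ, h⟩ := h
  obtain ⟨Γ', h'⟩ := exists_pointEval_mul s Γ (c * z + d)
  refine ⟨Γ', fun x y => ?_⟩
  rw [hg, h, ← h']
  congr 1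
  push_cast
  linear_combination (y : ℂ) * hz

/-- Equivariance of the associated point under reflection. -/
theorem HasPoint.reflect {s : Bool} {f g : ℝ × ℝ × ℝ × ℝ} {z : ℂ} (h : HasPoint s f z)
    (hg : ∀ x y : ℝ, evalForm g (x, y) = -evalForm f (-x, y)) :
    HasPoint s g (-(starRingEnd ℂ) z) := by
  obtain ⟨Γ, h⟩ := h
  obtain ⟨Γ', h'⟩ := exists_pointEval_neg_conj s (-Γ)
  refine ⟨Γ', fun x y => ?_⟩
  rw [hg, h, ← h']
  have : (-(starRingEnd ℂ) ((x : ℂ) - -(starRingEnd ℂ) z * y)) = ((-x : ℝ) : ℂ) - z * y := by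
    simp; ring
  rw [this]
  cases s <;> simp [pointEval] <;> ring

theorem paramForm_unique {s : Bool} {p q u v p' q' u' v' : ℝ} (hp : p ≠ 0) (hv : 0 < v)
    (hv' : 0 < v') (h : paramForm s p q u v = paramForm s p' q' u' v') :
    p = p' ∧ q = q' ∧ u = u' ∧ v = v' := by
  cases s
  · simp only [paramForm, cond_false, Prod.mk.injEq] at h
    obtain ⟨rfl, h1, h2, h3⟩ := h
    -- compare the real roots
    have hr : (u * p - q * v - (u' * p - q' * v')) *
        ((u * p - q * v - p * u') ^ 2 + p ^ 2 * v' ^ 2) = 0 := by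
      linear_combination (-(u * p - q * v) ^ 2) * h1 - (u * p - q * v) * p * h2 - p ^ 2 * h3
    have hpos : 0 < (u * p - q * v - p * u') ^ 2 + p ^ 2 * v' ^ 2 := by positivity
    have hr' := (mul_eq_zero.1 hr).resolve_right hpos.ne'
    have hu : u = u' := by
      have : p * (u - u') = 0 := by linear_combination (-1 / 2 : ℝ) * h1 - (1 / 2 : ℝ) * hr'
      linarith [(mul_eq_zero.1 this).resolve_left hp]
    subst hu
    have hvv : v = v' := by
      have : p * (v ^ 2 - v' ^ 2) = 0 := by linear_combination h2 + 2 * u * h1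
      have := (mul_eq_zero.1 this).resolve_left hp
      nlinarith
    subst hvv
    refine ⟨rfl, ?_, rfl, rfl⟩
    have : v * (q - q') = 0 := by linear_combination h1
    linarith [(mul_eq_zero.1 this).resolve_left hv.ne']
  · simp only [paramForm, cond_true, Prod.mk.injEq] at h
    obtain ⟨rfl, h1, h2, h3⟩ := h
    have hP : (p ^ 2 + q ^ 2) * v ^ 2 = (p ^ 2 + q' ^ 2) * v' ^ 2 := by
      linear_combination (1 / 9 : ℝ) * ((-3 * u * p + 3 * q * v) + (-3 * u' * p + 3 * q' * v')) * h1
        - (1 / 3 : ℝ) * p * h2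
    have hPpos : 0 < (p ^ 2 + q ^ 2) * v ^ 2 := by positivity
    have hu : u = u' := by
      have : (u - u') * ((p ^ 2 + q ^ 2) * v ^ 2) = 0 := by
        linear_combination (-u') * hP - (1 / 18 : ℝ) *
          ((3 * u ^ 2 * p - 6 * u * v * q - 3 * v ^ 2 * p) * h1 +
            (-3 * u' * p + 3 * q' * v') * h2 - 9 * p * h3)
      linarith [(mul_eq_zero.1 this).resolve_right hPpos.ne']
    subst hu
    have hq : q * v = q' * v' := by linear_combination (1 / 3 : ℝ) * h1
    have hvv : v = v' := by
      have : p ^ 2 * (v ^ 2 - v' ^ 2) = 0 := by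
        linear_combination hP - (q * v + q' * v') * hq
      have := (mul_eq_zero.1 this).resolve_left (by positivity)
      nlinarith
    subst hvv
    exact ⟨rfl, mul_right_cancel₀ hv.ne' hq, rfl, rfl⟩

theorem exists_paramForm_true {f : ℝ × ℝ × ℝ × ℝ} (ha : f.1 ≠ 0) (hD : 0 < discR f) :
    ∃ p q u v, 0 < v ∧ f = paramForm true p q u v := by
  obtain ⟨a, b, c, d⟩ := f
  simp only [discR] at ha hD
  set P := b ^ 2 - 3 * a * c with hP
  set Q := b * c - 9 * a * d with hQ
  set R := c ^ 2 - 3 * b * d with hR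
  set D := b ^ 2 * c ^ 2 - 4 * a * c ^ 3 - 4 * b ^ 3 * d - 27 * a ^ 2 * d ^ 2 + 18 * a * b * c * d
    with hDd
  have hP0 : 0 < P := by
    have h4 : 4 * P ^ 3 = (2 * b ^ 3 - 9 * a * b * c + 27 * a ^ 2 * d) ^ 2 + 27 * a ^ 2 * D := by
      rw [hP, hDd]; ring
    have : 0 < P ^ 3 := by
      have : 0 < 27 * a ^ 2 * D := by positivity
      nlinarith [sq_nonneg (2 * b ^ 3 - 9 * a * b * c + 27 * a ^ 2 * d)]
    by_contra hneg
    push Not at hneg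
    nlinarith [sq_nonneg P]
  have hPRQ : 4 * P * R - Q ^ 2 = 3 * D := by rw [hP, hQ, hR, hDd]; ring
  set v := √(3 * D) / (2 * P) with hv
  have hv0 : 0 < v := by positivity
  have hv2 : v ^ 2 = 3 * D / (4 * P ^ 2) := by
    rw [hv, div_pow, Real.sq_sqrt (by positivity)]; ring
  set u := -Q / (2 * P) with hu
  refine ⟨a, (b + 3 * u * a) / (3 * v), u, v, hv0, ?_⟩
  simp only [paramForm, cond_true, Prod.mk.injEq]
  have hqv : (b + 3 * u * a) / (3 * v) * v = (b + 3 * u * a) / 3 := by field_simp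
  set q := (b + 3 * u * a) / (3 * v)
  have hP' : P ≠ 0 := hP0.ne'
  refine ⟨trivial, by linear_combination (-3) * hqv, ?_, ?_⟩
  · have : 3 * u ^ 2 * a - 6 * u * v * q - 3 * v ^ 2 * a =
      3 * u ^ 2 * a - 2 * u * (b + 3 * u * a) - 3 * (3 * D / (4 * P ^ 2)) * a := by
      rw [← hv2]; linear_combination (-6 * u) * hqv
    rw [this, ← hPRQ, hu]
    field_simp
    rw [hP, hQ, hR]; ring
  · have : -u ^ 3 * a + 3 * u ^ 2 * v * q + 3 * u * v ^ 2 * a - v ^ 3 * q =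
      -u ^ 3 * a + u ^ 2 * (b + 3 * u * a) + 3 * u * (3 * D / (4 * P ^ 2)) * a -
        (3 * D / (4 * P ^ 2)) * ((b + 3 * u * a) / 3) := by
      rw [← hv2]; linear_combination (3 * u ^ 2 - v ^ 2) * hqv
    rw [this, ← hPRQ, hu]
    field_simp
    rw [hP, hQ, hR]; ring

theorem exists_root_of_cubic {a b c d : ℝ} (ha : a ≠ 0) :
    ∃ r, a * r ^ 3 + b * r ^ 2 + c * r + d = 0 := by
  wlog hpos : 0 < a generalizing a b c d
  · obtain ⟨r, hr⟩ := this (a := -a) (b := -b) (c := -c) (d := -d) (neg_ne_zero.2 ha)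
      (by have := lt_of_le_of_ne (not_lt.1 hpos) ha; linarith)
    exact ⟨r, by linear_combination -hr⟩
  set K := (|b| + |c| + |d|) / a + 1 with hK
  have hK1 : 1 ≤ K := by
    have : 0 ≤ (|b| + |c| + |d|) / a := by positivity
    linarith
  have haK : a * K = |b| + |c| + |d| + a := by rw [hK]; field_simp
  have hK2 : K ≤ K ^ 2 := by nlinarith
  have hK3 : 1 ≤ K ^ 2 := by nlinarith
  have hb := abs_le.1 (le_refl |b|)
  have hc := abs_le.1 (le_refl |c|)
  have hd := abs_le.1 (le_refl |d|)
  have e : a * K ^ 3 = (|b| + |c| + |d| + a) * K ^ 2 := by rw [← haK]; ring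
  have h1 : 0 ≤ a * K ^ 3 + b * K ^ 2 + c * K + d := by
    nlinarith [abs_nonneg b, abs_nonneg c, abs_nonneg d]
  have h2 : a * (-K) ^ 3 + b * (-K) ^ 2 + c * (-K) + d ≤ 0 := by
    nlinarith [abs_nonneg b, abs_nonneg c, abs_nonneg d]
  have hcont : ContinuousOn (fun r : ℝ => a * r ^ 3 + b * r ^ 2 + c * r + d)
    (Set.Icc (-K) K) := by fun_prop
  obtain ⟨r, -, hr⟩ := intermediate_value_Icc (by linarith) hcont ⟨h2, h1⟩
  exact ⟨r, hr⟩

theorem exists_paramForm_false {f : ℝ × ℝ × ℝ × ℝ} (ha : f.1 ≠ 0) (hD : discR f < 0) :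
    ∃ p q u v, 0 < v ∧ f = paramForm false p q u v := by
  obtain ⟨a, b, c, d⟩ := f
  simp only at ha
  obtain ⟨r, hr⟩ := exists_root_of_cubic (b := b) (c := c) (d := d) ha
  have hd : d = -(a * r ^ 3 + b * r ^ 2 + c * r) := by linarith
  subst hd
  set B := b + a * r with hB
  set E := c + B * r with hE
  have hdisc : discR (a, b, c, -(a * r ^ 3 + b * r ^ 2 + c * r)) =
      (B ^ 2 - 4 * a * E) * (a * r ^ 2 + B * r + E) ^ 2 := by
    rw [hE, hB]; simp only [discR]; ring
  rw [hdisc] at hD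
  have hneg : B ^ 2 - 4 * a * E < 0 := by
    by_contra hcon
    push Not at hcon
    have := mul_nonneg hcon (sq_nonneg (a * r ^ 2 + B * r + E))
    linarith
  set u := -B / (2 * a) with hu
  set v := √(4 * a * E - B ^ 2) / (2 * |a|) with hv
  have ha' : 0 < |a| := abs_pos.2 ha
  have hv0 : 0 < v := by
    have : 0 < 4 * a * E - B ^ 2 := by linarith
    positivity
  have hv2 : v ^ 2 = (4 * a * E - B ^ 2) / (4 * a ^ 2) := by
    rw [hv, div_pow, Real.sq_sqrt (by linarith), mul_pow, sq_abs]; ring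
  refine ⟨a, a * (u - r) / v, u, v, hv0, ?_⟩
  have hqv : a * (u - r) / v * v = a * (u - r) := by field_simp
  set q := a * (u - r) / v
  simp only [paramForm, cond_false, Prod.mk.injEq]
  refine ⟨trivial, ?_, ?_, ?_⟩
  · rw [add_comm, hqv, hu]; field_simp; rw [hB]; ring
  · have : 3 * u ^ 2 * a - 2 * u * v * q + v ^ 2 * a =
      3 * u ^ 2 * a - 2 * u * (a * (u - r)) + (4 * a * E - B ^ 2) / (4 * a ^ 2) * a := by
      rw [← hv2]; linear_combination (-2 * u) * hqv
    rw [this, hu]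
    field_simp
    rw [hE, hB]; ring
  · have : -u ^ 3 * a + u ^ 2 * v * q - u * v ^ 2 * a + v ^ 3 * q =
      -u ^ 3 * a + u ^ 2 * (a * (u - r)) - u * ((4 * a * E - B ^ 2) / (4 * a ^ 2)) * a +
        (4 * a * E - B ^ 2) / (4 * a ^ 2) * (a * (u - r)) := by
      rw [← hv2]; linear_combination (u ^ 2 + v ^ 2) * hqv
    rw [this, hu]
    field_simp
    rw [hE, hB]; ring

theorem exists_paramForm {s : Bool} {f : ℝ × ℝ × ℝ × ℝ} (ha : f.1 ≠ 0) (hD : 0 < sdisc s f) :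
    ∃ p q u v, 0 < v ∧ f = paramForm s p q u v := by
  cases s
  · exact exists_paramForm_false ha (by simpa [sdisc] using hD)
  · exact exists_paramForm_true ha (by simpa [sdisc] using hD)

/-! ### Reduced forms -/

/-- The polynomials whose signs describe reducedness: up to positive factors they are
`u`, `1 - 2u` and `u² + v² - 1`. -/
def redG (s : Bool) (i : Fin 3) (f : ℝ × ℝ × ℝ × ℝ) : ℝ :=
  bif s then
    ![9 * f.1 * f.2.2.2 - f.2.1 * f.2.2.1,
      f.2.1 ^ 2 - 3 * f.1 * f.2.2.1 + f.2.1 * f.2.2.1 - 9 * f.1 * f.2.2.2,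
      f.2.2.1 ^ 2 - 3 * f.2.1 * f.2.2.2 - f.2.1 ^ 2 + 3 * f.1 * f.2.2.1] i
  else
    ![f.1 * f.2.2.2 - f.2.1 * f.2.2.1,
      (f.1 + f.2.1) ^ 2 + f.1 * f.2.2.1 - f.1 * f.2.2.2 + f.2.1 * f.2.2.1,
      f.2.2.2 ^ 2 - f.1 ^ 2 + f.1 * f.2.2.1 - f.2.1 * f.2.2.2] i

/-- The three affine or quadratic expressions describing the half fundamental domain. -/
def halfDomG (i : Fin 3) (u v : ℝ) : ℝ := ![u, 1 - 2 * u, u ^ 2 + v ^ 2 - 1] i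

theorem redG_paramForm (s : Bool) {p q u v : ℝ} (hp : p ≠ 0) (hv : 0 < v) (i : Fin 3) :
    ∃ c, 0 < c ∧ redG s i (paramForm s p q u v) = c * halfDomG i u v := by
  have hp2 : 0 < p ^ 2 := by positivity
  have hv2 : 0 < v ^ 2 := by positivity
  have hpv : 0 < v ^ 2 * p ^ 2 := by positivity
  cases s
  · fin_cases i
    · refine ⟨2 * ((-2 * u * p + q * v) ^ 2 + v ^ 2 * p ^ 2), by positivity, ?_⟩
      simp [redG, paramForm, halfDomG]; ring
    · refine ⟨(-u * p + q * v + (1 - u) * p) ^ 2 + v ^ 2 * p ^ 2, by positivity, ?_⟩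
      simp [redG, paramForm, halfDomG]; ring
    · refine ⟨(p + u * (-u * p + q * v)) ^ 2 + v ^ 2 * (-u * p + q * v) ^ 2, ?_, ?_⟩
      · rcases eq_or_ne (-u * p + q * v) 0 with h | h
        · rw [h]; simpa using hp2
        · positivity
      · simp [redG, paramForm, halfDomG]; ring
  · fin_cases i
    · refine ⟨18 * (p ^ 2 + q ^ 2) * v ^ 2, by positivity, ?_⟩
      simp [redG, paramForm, halfDomG]; ring
    · refine ⟨9 * (p ^ 2 + q ^ 2) * v ^ 2, by positivity, ?_⟩
      simp [redG, paramForm, halfDomG]; ring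
    · refine ⟨9 * (p ^ 2 + q ^ 2) * v ^ 2, by positivity, ?_⟩
      simp [redG, paramForm, halfDomG]; ring

/-- Strict (if `o`) or weak positivity. -/
def posB (o : Bool) (t : ℝ) : Prop := bif o then 0 < t else 0 ≤ t

theorem posB_mul_iff {o : Bool} {c t : ℝ} (hc : 0 < c) : posB o (c * t) ↔ posB o t := by
  cases o <;> simp [posB, hc, mul_nonneg_iff_of_pos_left]

/-- The real forms that are (strictly, if `o`) reduced with `0 < ±Disc < X`. -/
def redRegion (s o : Bool) (X : ℝ) : Set (ℝ × ℝ × ℝ × ℝ) :=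
  {f | (∀ i, posB o (redG s i f)) ∧ 0 < sdisc s f ∧ sdisc s f < X}

/-- The (open, if `o`) right half of the standard fundamental domain. -/
def halfDom (o : Bool) : Set (ℝ × ℝ) := {z | 0 < z.2 ∧ ∀ i, posB o (halfDomG i z.1 z.2)}

theorem paramForm_mem_redRegion {s o : Bool} {X p q u v : ℝ} (hp : p ≠ 0) (hv : 0 < v) :
    paramForm s p q u v ∈ redRegion s o X ↔
      (u, v) ∈ halfDom o ∧ discConst s * ((p ^ 2 + q ^ 2) * v ^ 3) ^ 2 < X := by
  have hpos : 0 < discConst s * ((p ^ 2 + q ^ 2) * v ^ 3) ^ 2 := by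
    have := discConst_pos s
    positivity
  have hi : ∀ i, posB o (redG s i (paramForm s p q u v)) ↔ posB o (halfDomG i u v) := by
    intro i
    obtain ⟨c, hc, e⟩ := redG_paramForm s (q := q) (u := u) hp hv i
    rw [e, posB_mul_iff hc]
  simp only [redRegion, halfDom, Set.mem_ofPred_eq, hi, sdisc_paramForm, hpos, hv, true_and]

/-- An integral form viewed as a real form. -/
def castF (f : BinaryCubic) : ℝ × ℝ × ℝ × ℝ := (f.1, f.2.1, f.2.2.1, f.2.2.2)

theorem discR_castF (f : BinaryCubic) : discR (castF f) = discF f := by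
  simp [discR, castF, discF]

theorem sdisc_castF_eq {s : Bool} {f g : BinaryCubic} (h : FormEquiv f g) :
    sdisc s (castF f) = sdisc s (castF g) := by
  simp only [sdisc, discR_castF, discF_eq_of_formEquiv h]

/-- The form `(x,y) ↦ e·f(Ax+By, Cx+Dy)`. -/
def substForm {A : Type*} [CommRing A] (e a b c d : A) (f : A × A × A × A) : A × A × A × A :=
  (e * evalForm f (a, c),
    e * (3 * f.1 * a ^ 2 * b + f.2.1 * (a ^ 2 * d + 2 * a * b * c) +
      f.2.2.1 * (b * c ^ 2 + 2 * a * c * d) + 3 * f.2.2.2 * c ^ 2 * d),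
    e * (3 * f.1 * a * b ^ 2 + f.2.1 * (b ^ 2 * c + 2 * a * b * d) +
      f.2.2.1 * (a * d ^ 2 + 2 * b * c * d) + 3 * f.2.2.2 * c * d ^ 2),
    e * evalForm f (b, d))

theorem evalForm_substForm {A : Type*} [CommRing A] (e a b c d : A) (f : A × A × A × A) (x y : A) :
    evalForm (substForm e a b c d f) (x, y) = e * evalForm f (a * x + b * y, c * x + d * y) := by
  simp only [evalForm, substForm]; ring

theorem castF_substForm (e a b c d : ℤ) (f : BinaryCubic) :
    castF (substForm e a b c d f) = substForm (e : ℝ) a b c d (castF f) := by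
  simp [castF, substForm, evalForm]

theorem formEquiv_iff {f g : BinaryCubic} : FormEquiv f g ↔ ∃ a b c d : ℤ,
    ((a * d - b * c = 1 ∧ g = substForm 1 a b c d f) ∨
      (a * d - b * c = -1 ∧ g = substForm (-1) a b c d f)) := by
  constructor
  · rintro ⟨γ, hu, h⟩
    rw [actsTo_iff] at h
    refine ⟨γ 0 0, γ 1 0, γ 0 1, γ 1 1, ?_⟩
    rw [Matrix.det_fin_two] at *
    rcases Int.isUnit_iff.1 hu with h1 | h1
    · left
      refine ⟨by linarith, evalForm_ext fun x y => ?_⟩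
      rw [evalForm_substForm]
      have := h x y
      rw [h1] at this
      linarith
    · right
      refine ⟨by linarith, evalForm_ext fun x y => ?_⟩
      rw [evalForm_substForm]
      have := h x y
      rw [h1] at this
      linarith
  · rintro ⟨a, b, c, d, ⟨h, rfl⟩ | ⟨h, rfl⟩⟩
    · refine ⟨!![a, c; b, d], ?_, ?_⟩
      · rw [Matrix.det_fin_two_of, show a * d - c * b = 1 by linarith]; exact isUnit_one
      · rw [actsTo_iff]
        intro x y
        rw [Matrix.det_fin_two_of, show a * d - c * b = 1 by linarith, evalForm_substForm]
        simp
    · refine ⟨!![a, c; b, d], ?_, ?_⟩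
      · rw [Matrix.det_fin_two_of, show a * d - c * b = -1 by linarith]; exact isUnit_one.neg
      · rw [actsTo_iff]
        intro x y
        rw [Matrix.det_fin_two_of, show a * d - c * b = -1 by linarith, evalForm_substForm]
        simp

theorem formEquiv_neg (f : BinaryCubic) : FormEquiv f (-f) := by
  rw [formEquiv_iff]
  refine ⟨-1, 0, 0, -1, Or.inl ⟨by norm_num, ?_⟩⟩
  ext <;> simp [substForm, evalForm]

theorem castF_neg (f : BinaryCubic) : castF (-f) = -castF f := by
  simp [castF]

theorem redRegion_neg {s o : Bool} {X : ℝ} {f : ℝ × ℝ × ℝ × ℝ} :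
    -f ∈ redRegion s o X ↔ f ∈ redRegion s o X := by
  have h1 : ∀ i, redG s i (-f) = redG s i f := by
    intro i
    cases s <;> fin_cases i <;> simp [redG] <;> ring
  have h2 : sdisc s (-f) = sdisc s f := by
    cases s <;> simp [sdisc, discR] <;> ring
  simp [redRegion, h1, h2]

open UpperHalfPlane ModularGroup Modular in
/-- Every irreducible form is equivalent to a reduced one. -/
theorem exists_formEquiv_mem_redRegion {s : Bool} {X : ℝ} {f : BinaryCubic} (hf : IrredForm f)
    (hD : 0 < sdisc s (castF f)) (hX : sdisc s (castF f) < X) :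
    ∃ g, FormEquiv f g ∧ castF g ∈ redRegion s false X := by
  have key : ∃ g, FormEquiv f g ∧ ∃ z : ℂ, HasPoint s (castF g) z ∧ 0 < z.im ∧
      |z.re| ≤ 1 / 2 ∧ 1 ≤ Complex.normSq z := by
    have ha : (castF f).1 ≠ 0 := by simpa [castF] using hf.fst_ne_zero
    obtain ⟨p, q, u, v, hv, e⟩ := exists_paramForm ha hD
    let z : ℍ := ⟨⟨u, v⟩, hv⟩
    obtain ⟨γ, hγ⟩ := exists_smul_mem_fd z
    have hdet : γ 0 0 * γ 1 1 - γ 0 1 * γ 1 0 = 1 := by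
      have := γ.det_coe; rwa [Matrix.det_fin_two] at this
    refine ⟨substForm 1 (γ 1 1) (-γ 0 1) (-γ 1 0) (γ 0 0) f, formEquiv_iff.2 ⟨_, _, _, _,
      Or.inl ⟨by linarith, rfl⟩⟩, (γ • z : ℍ), ?_, (γ • z).im_pos, hγ.2, hγ.1⟩
    have hz : HasPoint s (castF f) (z : ℂ) := (hasPoint_iff _ _ _).2 ⟨p, q, e⟩
    refine hz.smul (a := γ 0 0) (b := γ 0 1) (c := γ 1 0) (d := γ 1 1) ?_ ?_
    · have h0 : ((γ 1 0 : ℝ) : ℂ) * (z : ℂ) + ((γ 1 1 : ℝ) : ℂ) ≠ 0 := by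
        have := UpperHalfPlane.denom_ne_zero (γ : GL (Fin 2) ℝ) z
        simpa [UpperHalfPlane.denom] using this
      rw [UpperHalfPlane.coe_specialLinearGroup_apply]
      simp only [algebraMap_int_eq, eq_intCast]
      rw [div_mul_cancel₀ _ h0]
    · intro x y
      rw [castF_substForm, evalForm_substForm]
      push_cast
      rw [one_mul]
      congr 2 <;> ring
  obtain ⟨g, hg, z, hz, hz0, hz1, hz2⟩ := key
  have main : ∀ g, FormEquiv f g → ∀ z : ℂ, HasPoint s (castF g) z → 0 < z.im → 0 ≤ z.re →
      z.re ≤ 1 / 2 → 1 ≤ Complex.normSq z → castF g ∈ redRegion s false X := by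
    intro g hg z hz hz0 h1 h2 h3
    have ha : (castF g).1 ≠ 0 := by simpa [castF] using (irredForm_of_formEquiv hg hf).fst_ne_zero
    have hX' : sdisc s (castF g) < X := by rwa [← sdisc_castF_eq hg]
    obtain ⟨p, q, e⟩ := (hasPoint_iff _ _ _).1 hz
    have hp : p ≠ 0 := by
      rw [e] at ha; cases s <;> simpa [paramForm] using ha
    rw [e, sdisc_paramForm] at hX'
    rw [e, paramForm_mem_redRegion hp hz0]
    refine ⟨⟨hz0, fun i => ?_⟩, hX'⟩
    rw [Complex.normSq_apply] at h3
    fin_cases i <;> simp [posB, halfDomG] <;> nlinarith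
  rcases le_total 0 z.re with h | h
  · exact ⟨g, hg, main g hg z hz hz0 h (abs_le.1 hz1).2 hz2⟩
  · have hg' : FormEquiv f (substForm (-1) (-1) 0 0 1 g) :=
      hg.trans (formEquiv_iff.2 ⟨_, _, _, _, Or.inr ⟨by norm_num, rfl⟩⟩)
    refine ⟨_, hg', main _ hg' _ (hz.reflect fun x y => ?_) (by simpa using hz0) (by simpa using h)
      ?_ (by simpa using hz2)⟩
    · rw [castF_substForm, evalForm_substForm]
      push_cast
      simp
    · have := (abs_le.1 hz1).1
      simp; linarith

open UpperHalfPlane ModularGroup Modular in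
/-- Two equivalent strictly reduced forms agree up to sign. -/
theorem eq_or_eq_neg_of_formEquiv {s : Bool} {X : ℝ} {f g : BinaryCubic} (h : FormEquiv f g)
    (haf : f.1 ≠ 0) (hag : g.1 ≠ 0) (hf : castF f ∈ redRegion s true X)
    (hg : castF g ∈ redRegion s true X) : g = f ∨ g = -f := by
  have ha : (castF f).1 ≠ 0 := by simpa [castF] using haf
  have ha' : (castF g).1 ≠ 0 := by simpa [castF] using hag
  obtain ⟨p, q, u, v, hv, e⟩ := exists_paramForm ha hf.2.1
  obtain ⟨p', q', u', v', hv', e'⟩ := exists_paramForm ha' hg.2.1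
  have hp : p ≠ 0 := by rw [e] at ha; cases s <;> simpa [paramForm] using ha
  have hp' : p' ≠ 0 := by rw [e'] at ha'; cases s <;> simpa [paramForm] using ha'
  have hd := ((paramForm_mem_redRegion hp hv).1 (e ▸ hf)).1
  have hd' := ((paramForm_mem_redRegion hp' hv').1 (e' ▸ hg)).1
  have h0 := hd.2 0
  have h1 := hd.2 1
  have h2 := hd.2 2
  have h0' := hd'.2 0
  have h1' := hd'.2 1
  have h2' := hd'.2 2
  simp [posB, halfDomG] at h0 h1 h2 h0' h1' h2'
  let z : ℍ := ⟨⟨u, v⟩, hv⟩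
  have hzd : z ∈ 𝒟ᵒ := by
    constructor
    · simp [z, Complex.normSq_apply]; nlinarith
    · show |u| < 1 / 2
      rw [abs_of_pos h0]; linarith
  -- the common argument for `SL₂(ℤ)`-equivalence
  have main : ∀ k : BinaryCubic, ∀ w : ℂ, ∀ hw : 0 < w.im, HasPoint s (castF k) w →
      1 < Complex.normSq w → |w.re| < 1 / 2 → k.1 ≠ 0 →
      ∀ a b c d : ℤ, a * d - b * c = 1 → k = substForm 1 a b c d f → k = f ∨ k = -f := by
    intro k w hw hk hw1 hw2 hk0 a b c d habcd hkf
    let γ : Matrix.SpecialLinearGroup (Fin 2) ℤ := ⟨!![d, -b; -c, a], by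
      rw [Matrix.det_fin_two_of]; linarith⟩
    have hz : HasPoint s (castF f) (z : ℂ) := (hasPoint_iff _ _ _).2 ⟨p, q, e⟩
    have hz' : HasPoint s (castF k) ((γ • z : ℍ) : ℂ) := by
      refine hz.smul (a := d) (b := -b) (c := -c) (d := a) ?_ ?_
      · have h0 : ((γ 1 0 : ℝ) : ℂ) * (z : ℂ) + ((γ 1 1 : ℝ) : ℂ) ≠ 0 := by
          have := UpperHalfPlane.denom_ne_zero (γ : GL (Fin 2) ℝ) z
          simpa [UpperHalfPlane.denom] using this
        rw [UpperHalfPlane.coe_specialLinearGroup_apply]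
        simp only [algebraMap_int_eq, eq_intCast]
        simp only [γ] at h0 ⊢
        simp at h0 ⊢
        rw [div_mul_cancel₀ _ h0]
      · intro x y
        rw [hkf, castF_substForm, evalForm_substForm]
        push_cast
        rw [one_mul]
        congr 2 <;> ring
    obtain ⟨p1, q1, e1⟩ := (hasPoint_iff _ _ _).1 hk
    obtain ⟨p2, q2, e2⟩ := (hasPoint_iff _ _ _).1 hz'
    have hp1 : p1 ≠ 0 := by
      have : (castF k).1 ≠ 0 := by simpa [castF] using hk0
      rw [e1] at this; cases s <;> simpa [paramForm] using this
    obtain ⟨-, -, e3, e4⟩ := paramForm_unique hp1 hw (γ • z).im_pos (e1.symm.trans e2)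
    have hγz : γ • z ∈ 𝒟ᵒ := by
      have : ((γ • z : ℍ) : ℂ) = w := (Complex.ext e3 e4).symm
      constructor
      · rw [this]; exact hw1
      · have h5 : (γ • z).re = w.re := e3.symm
        rw [h5]; exact hw2
    have hγ := eq_one_or_neg_one_of_mem_fdo_mem_fdo hzd hγz
    rw [hkf]
    rcases hγ with hγ | hγ
    · left
      have hm : !![d, -b; -c, a] = (1 : Matrix (Fin 2) (Fin 2) ℤ) := congrArg Subtype.val hγ
      have e00 := congrFun (congrFun hm 0) 0
      have e01 := congrFun (congrFun hm 0) 1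
      have e10 := congrFun (congrFun hm 1) 0
      have e11 := congrFun (congrFun hm 1) 1
      simp at e00 e01 e10 e11
      subst e00 e01 e10 e11
      ext <;> simp [substForm, evalForm]
    · right
      have hm : !![d, -b; -c, a] = -(1 : Matrix (Fin 2) (Fin 2) ℤ) := congrArg Subtype.val hγ
      have e00 := congrFun (congrFun hm 0) 0
      have e01 := congrFun (congrFun hm 0) 1
      have e10 := congrFun (congrFun hm 1) 0
      have e11 := congrFun (congrFun hm 1) 1
      simp at e00 e01 e10 e11
      subst e00 e01 e10 e11
      ext <;> simp [substForm, evalForm]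
  have hzg : HasPoint s (castF g) ⟨u', v'⟩ := (hasPoint_iff _ _ _).2 ⟨p', q', e'⟩
  obtain ⟨a, b, c, d, ⟨hdet, hg'⟩ | ⟨hdet, hg'⟩⟩ := formEquiv_iff.1 h
  · refine main g ⟨u', v'⟩ hv' hzg ?_ ?_ hag a b c d hdet hg'
    · simp [Complex.normSq_apply]; nlinarith
    · simp only; rw [abs_of_pos h0']; linarith
  · exfalso
    let k := substForm (-1) (-1) 0 0 1 g
    have hk : k = substForm 1 (-a) b (-c) d f := by
      refine evalForm_ext fun x y => ?_
      rw [evalForm_substForm, hg', evalForm_substForm, evalForm_substForm]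
      ring_nf
    have hkp : HasPoint s (castF k) (-(starRingEnd ℂ) ⟨u', v'⟩) := by
      refine hzg.reflect fun x y => ?_
      rw [castF_substForm, evalForm_substForm]
      push_cast
      simp
    have hk1 : k.1 = g.1 := by simp [k, substForm, evalForm]
    have hres := main k _ (by simpa using hv') hkp ?_ ?_ (by rwa [hk1]) (-a) b (-c) d
      (by linarith) hk
    · have hpt : HasPoint s (castF k) ⟨u, v⟩ := by
        rcases hres with h | h
        · rw [h]; exact (hasPoint_iff _ _ _).2 ⟨p, q, e⟩
        · rw [h, castF_neg, e]
          refine (hasPoint_iff _ _ _).2 ⟨-p, -q, ?_⟩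
          cases s <;> simp [paramForm] <;> refine ⟨?_, ?_, ?_⟩ <;> ring
      obtain ⟨p1, q1, e1⟩ := (hasPoint_iff _ _ _).1 hkp
      obtain ⟨p2, q2, e2⟩ := (hasPoint_iff _ _ _).1 hpt
      have hp1 : p1 ≠ 0 := by
        have : (castF k).1 ≠ 0 := by simpa [castF, hk1] using hag
        rw [e1] at this; cases s <;> simpa [paramForm] using this
      obtain ⟨-, -, e3, -⟩ := paramForm_unique hp1 (by simpa using hv') hv (e1.symm.trans e2)
      simp at e3
      linarith
    · simp [Complex.normSq_apply]; nlinarith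
    · simp; rw [abs_of_pos h0']; linarith

/-- The property of forms over whose classes we sum. -/
def ClassProp (s : Bool) (X : ℝ) (f : BinaryCubic) : Prop :=
  IrredForm f ∧ 0 < sdisc s (castF f) ∧ sdisc s (castF f) < X

open Classical in
/-- The sum over classes in terms of sums over (strictly) reduced forms. -/
theorem classSum_bounds {s : Bool} {X : ℝ} {n : ℕ} [NeZero n] {Sc So : Finset BinaryCubic}
    (hSc : ∀ f, f ∈ Sc ↔ IrredForm f ∧ castF f ∈ redRegion s false X)
    (hSo : ∀ f, f ∈ So ↔ IrredForm f ∧ castF f ∈ redRegion s true X) :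
    ∑ f ∈ So, wn n f ≤ 2 * classSum (ClassProp s X) (wn n) ∧
      2 * classSum (ClassProp s X) (wn n) + ∑ f ∈ So, wn n f ≤ 2 * ∑ f ∈ Sc, wn n f := by
  set r := fun f g : { f : BinaryCubic // ClassProp s X f } => FormEquiv f.1 g.1 with hr
  have hmk : ∀ f g : { f : BinaryCubic // ClassProp s X f }, Quot.mk r f = Quot.mk r g →
      FormEquiv f.1 g.1 := by
    intro f g h
    replace h := Quot.eqvGen_exact h
    induction h with
    | rel _ _ h => exact h
    | refl => exact FormEquiv.refl _
    | symm _ _ _ ih => exact ih.symm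
    | trans _ _ _ _ _ ih1 ih2 => exact ih1.trans ih2
  have hcp : ∀ f ∈ Sc, ClassProp s X f := fun f hf => by
    obtain ⟨h1, h2⟩ := (hSc f).1 hf
    exact ⟨h1, h2.2.1, h2.2.2⟩
  have hsub : So ⊆ Sc := by
    intro f hf
    obtain ⟨h1, h2⟩ := (hSo f).1 hf
    refine (hSc f).2 ⟨h1, fun i => ?_, h2.2⟩
    have := h2.1 i
    simp only [posB, cond_true, cond_false] at this ⊢
    exact this.le
  let cl : BinaryCubic → Option (Quot r) := fun f =>
    if h : ClassProp s X f then some (Quot.mk r ⟨f, h⟩) else none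
  have hsurj : ∀ q : Quot r, ∃ f ∈ Sc, cl f = some q := by
    intro q
    obtain ⟨⟨f, hf⟩, rfl⟩ := Quot.exists_rep q
    obtain ⟨g, hfg, hg⟩ := exists_formEquiv_mem_redRegion hf.1 hf.2.1 hf.2.2
    have hg' : g ∈ Sc := (hSc g).2 ⟨irredForm_of_formEquiv hfg hf.1, hg⟩
    refine ⟨g, hg', ?_⟩
    simp only [cl, dif_pos (hcp g hg')]
    exact congrArg some (Quot.sound hfg.symm)
  have hfin : Finite (Quot r) := by
    choose F hF hF' using hsurj
    refine Finite.of_injective (fun q => (⟨F q, hF q⟩ : Sc)) fun q q' h => ?_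
    have h : F q = F q' := congrArg Subtype.val h
    have := hF' q
    rw [h, hF' q'] at this
    exact (Option.some_injective _ this).symm
  let W : Quot r → ℕ := fun q => wn n (Classical.choose (Quot.exists_rep q)).1
  have hW : ∀ q f, f ∈ Sc → cl f = some q → wn n f = W q := by
    intro q f hf h
    simp only [cl, dif_pos (hcp f hf)] at h
    have h := Option.some_injective _ h
    refine wn_eq_of_formEquiv (hmk ⟨f, hcp f hf⟩ _ ?_)
    rw [h]
    exact (Classical.choose_spec (Quot.exists_rep q)).symm
  have := Fintype.ofFinite (Quot r)
  have hcs : classSum (ClassProp s X) (wn n) = ∑ q, W q := finsum_eq_sum_of_fintype _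
  have hsum : ∀ S ⊆ Sc, ∑ f ∈ S, wn n f = ∑ q, (S.filter fun f => cl f = some q).card * W q := by
    intro S hS
    have hmaps : ∀ f ∈ S, ∃ q, cl f = some q := fun f hf => by
      simp only [cl, dif_pos (hcp f (hS hf))]; exact ⟨_, rfl⟩
    rw [← Finset.sum_fiberwise_of_maps_to (s := S) (t := (Finset.univ : Finset (Option (Quot r))))
      (g := cl) (fun _ _ => Finset.mem_univ _), Fintype.sum_option]
    have h0 : (S.filter fun f => cl f = none) = ∅ := by
      rw [Finset.filter_eq_empty_iff]
      intro f hf h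
      obtain ⟨q, hq⟩ := hmaps f hf
      rw [hq] at h
      exact absurd h (by simp)
    rw [h0, Finset.sum_empty, zero_add]
    refine Finset.sum_congr rfl fun q _ => ?_
    rw [Finset.sum_congr rfl (g := fun _ => W q), Finset.sum_const, smul_eq_mul]
    intro f hf
    rw [Finset.mem_filter] at hf
    exact hW q f (hS hf.1) hf.2
  have hne : ∀ f ∈ So, f ≠ -f := by
    intro f hf h
    have h1 := ((hSo f).1 hf).1.fst_ne_zero
    have h2 : f.1 = -f.1 := congrArg Prod.fst h
    omega
  have hcard : ∀ q, (So.filter fun f => cl f = some q).card = 0 ∨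
      (So.filter fun f => cl f = some q).card = 2 := by
    intro q
    rcases (So.filter fun f => cl f = some q).eq_empty_or_nonempty with h | ⟨f, hf⟩
    · left; rw [h, Finset.card_empty]
    · right
      rw [Finset.mem_filter] at hf
      have hfS := hf.1
      have hf1 := (hSo f).1 hf.1
      have : (So.filter fun f => cl f = some q) = {f, -f} := by
        ext g
        rw [Finset.mem_filter, Finset.mem_insert, Finset.mem_singleton]
        constructor
        · rintro ⟨hg, hgq⟩
          have hg1 := (hSo g).1 hg
          refine eq_or_eq_neg_of_formEquiv ?_ hf1.1.fst_ne_zero hg1.1.fst_ne_zero hf1.2 hg1.2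
          have h1 := hf.2
          simp only [cl, dif_pos (hcp f (hsub hfS))] at h1
          simp only [cl, dif_pos (hcp g (hsub hg))] at hgq
          exact hmk ⟨f, hcp f (hsub hfS)⟩ ⟨g, hcp g (hsub hg)⟩
            (Option.some_injective _ (h1.trans hgq.symm))
        · rintro (rfl | rfl)
          · exact hf
          · have hm : -f ∈ So := (hSo _).2 ⟨irredForm_of_formEquiv (formEquiv_neg f) hf1.1, by
              rw [castF_neg, redRegion_neg]; exact hf1.2⟩
            refine ⟨hm, ?_⟩
            rw [← hf.2]
            simp only [cl, dif_pos (hcp f (hsub hfS)), dif_pos (hcp _ (hsub hm))]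
            exact congrArg some (Quot.sound (formEquiv_neg f).symm)
      rw [this, Finset.card_pair (hne f hfS)]
  have hcard' : ∀ q, 1 ≤ (Sc.filter fun f => cl f = some q).card := by
    intro q
    obtain ⟨f, hf, h⟩ := hsurj q
    exact Finset.card_pos.2 ⟨f, Finset.mem_filter.2 ⟨hf, h⟩⟩
  have hle : ∀ q, (So.filter fun f => cl f = some q).card ≤
      (Sc.filter fun f => cl f = some q).card := fun q =>
    Finset.card_le_card (Finset.filter_subset_filter _ hsub)
  rw [hcs, hsum So hsub, hsum Sc (Finset.Subset.refl _), Finset.mul_sum, Finset.mul_sum,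
    ← Finset.sum_add_distrib]
  constructor
  · refine Finset.sum_le_sum fun q _ => Nat.mul_le_mul_right _ ?_
    rcases hcard q with h | h <;> omega
  · refine Finset.sum_le_sum fun q _ => ?_
    rw [← add_mul, ← mul_assoc]
    refine Nat.mul_le_mul_right _ ?_
    have := hle q
    have := hcard' q
    rcases hcard q with h | h <;> omega

/-! ### Counting integer points in sets with few boundary points on each line -/

open MeasureTheory in
/-- `S` changes only at points of a set of at most `K` elements. -/
def StepSet (K : ℕ) (S : Set ℝ) : Prop :=
  ∃ Z : Finset ℝ, Z.card ≤ K ∧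
    ∀ x y, x ≤ y → (∀ z ∈ Z, ¬(x ≤ z ∧ z ≤ y)) → (x ∈ S ↔ y ∈ S)

theorem StepSet.inter {K L : ℕ} {S T : Set ℝ} (hS : StepSet K S) (hT : StepSet L T) :
    StepSet (K + L) (S ∩ T) := by
  classical
  obtain ⟨Z, hZ, h⟩ := hS
  obtain ⟨W, hW, h'⟩ := hT
  refine ⟨Z ∪ W, (Finset.card_union_le _ _).trans (by omega), fun x y hxy hz => ?_⟩
  rw [Set.mem_inter_iff, Set.mem_inter_iff,
    h x y hxy fun z hz' => hz z (Finset.mem_union_left _ hz'),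
    h' x y hxy fun z hz' => hz z (Finset.mem_union_right _ hz')]

/-- The positivity set of a polynomial. -/
theorem stepSet_polynomial (o : Bool) (p : Polynomial ℝ) {K : ℕ} (hp : p.natDegree ≤ K) :
    StepSet K {t | posB o (p.eval t)} := by
  classical
  rcases eq_or_ne p 0 with rfl | h0
  · exact ⟨∅, by simp, by simp⟩
  refine ⟨p.roots.toFinset, (Multiset.toFinset_card_le _).trans ((p.card_roots').trans hp),
    fun x y hxy hz => ?_⟩
  have hnz : ∀ z, x ≤ z → z ≤ y → p.eval z ≠ 0 := by
    intro z h1 h2 h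
    exact hz z (by simp [h0, h]) ⟨h1, h2⟩
  have hcont : ContinuousOn (fun t => p.eval t) (Set.Icc x y) := p.continuous.continuousOn
  have hsign : 0 < p.eval x ↔ 0 < p.eval y := by
    constructor
    · intro hx
      by_contra hy
      push Not at hy
      obtain ⟨z, hz1, hz2⟩ := intermediate_value_Icc' hxy hcont ⟨hy, hx.le⟩
      exact hnz z hz1.1 hz1.2 hz2
    · intro hy
      by_contra hx
      push Not at hx
      obtain ⟨z, hz1, hz2⟩ := intermediate_value_Icc hxy hcont ⟨hx, hy.le⟩
      exact hnz z hz1.1 hz1.2 hz2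
  have hx0 := hnz x le_rfl hxy
  have hy0 := hnz y hxy le_rfl
  cases o
  · simp only [posB, cond_false, Set.mem_ofPred_eq]
    rw [hx0.symm.le_iff_lt, hy0.symm.le_iff_lt, hsign]
  · simpa [posB] using hsign

open MeasureTheory

open Classical in
theorem StepSet.abs_sum_sub_volume_le {K M : ℕ} {S : Set ℝ} (hS : StepSet K S)
    (hm : MeasurableSet S) (hM : S ⊆ Set.Ico (-(M : ℝ)) M) :
    |∑ i ∈ Finset.Ico (-(M : ℤ)) M, (if (i : ℝ) ∈ S then (1 : ℝ) else 0) - volume.real S| ≤ K := by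
  obtain ⟨Z, hZ, h⟩ := hS
  have hU : S = ⋃ i ∈ Finset.Ico (-(M : ℤ)) M, S ∩ Set.Ico (i : ℝ) (i + 1) := by
    ext x
    simp only [Set.mem_iUnion, Finset.mem_Ico, Set.mem_inter_iff, Set.mem_Ico, exists_prop]
    constructor
    · intro hx
      have h1 := hM hx
      refine ⟨⌊x⌋, ⟨?_, ?_⟩, hx, Int.floor_le x, Int.lt_floor_add_one x⟩
      · rw [Int.le_floor]; push_cast; exact h1.1
      · rw [Int.floor_lt]; push_cast; exact h1.2
    · rintro ⟨_, _, hx, _⟩; exact hx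
  have hvol : volume.real S =
      ∑ i ∈ Finset.Ico (-(M : ℤ)) M, volume.real (S ∩ Set.Ico (i : ℝ) (i + 1)) := by
    conv_lhs => rw [hU]
    refine measureReal_biUnion_finset ?_ (fun i _ => hm.inter measurableSet_Ico) ?_
    · intro i _ j _ hij
      refine Set.disjoint_left.2 fun x hx hx' => hij ?_
      rw [← Int.floor_eq_iff.2 hx.2, Int.floor_eq_iff.2 hx'.2]
    · intro i _
      exact measure_ne_top_of_subset Set.inter_subset_right (by simp)
  rw [hvol, ← Finset.sum_sub_distrib]
  have hterm : ∀ i : ℤ, |(if (i : ℝ) ∈ S then (1 : ℝ) else 0) -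
      volume.real (S ∩ Set.Ico (i : ℝ) (i + 1))| ≤ ((Z.filter fun z => ⌊z⌋ = i).card : ℝ) := by
    intro i
    have hone : volume.real (Set.Ico (i : ℝ) (i + 1)) = 1 := by
      rw [Real.volume_real_Ico_of_le (by linarith)]; ring
    rcases (Z.filter fun z => ⌊z⌋ = i).eq_empty_or_nonempty with he | he
    · have hconst : ∀ y ∈ Set.Ico (i : ℝ) (i + 1), ((i : ℝ) ∈ S ↔ y ∈ S) := by
        intro y hy
        refine h _ _ hy.1 fun z hz hzi => ?_
        have : z ∈ Z.filter fun z => ⌊z⌋ = i :=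
          Finset.mem_filter.2 ⟨hz, Int.floor_eq_iff.2 ⟨hzi.1, hzi.2.trans_lt hy.2⟩⟩
        rw [he] at this
        simp at this
      rw [he, Finset.card_empty, Nat.cast_zero]
      by_cases hi : (i : ℝ) ∈ S
      · have : S ∩ Set.Ico (i : ℝ) (i + 1) = Set.Ico (i : ℝ) (i + 1) :=
          Set.inter_eq_right.2 fun y hy => (hconst y hy).1 hi
        rw [if_pos hi, this, hone]; simp
      · have : S ∩ Set.Ico (i : ℝ) (i + 1) = ∅ :=
          Set.eq_empty_of_forall_notMem fun y hy => hi ((hconst y hy.2).2 hy.1)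
        rw [if_neg hi, this]; simp
    · have h1 : (1 : ℝ) ≤ ((Z.filter fun z => ⌊z⌋ = i).card : ℝ) := by
        exact_mod_cast Finset.card_pos.2 he
      have h2 : volume.real (S ∩ Set.Ico (i : ℝ) (i + 1)) ≤ 1 := by
        refine le_trans ?_ hone.le
        exact measureReal_mono Set.inter_subset_right (by simp)
      have h3 : 0 ≤ volume.real (S ∩ Set.Ico (i : ℝ) (i + 1)) := measureReal_nonneg
      refine le_trans (abs_le.2 ?_) h1
      split_ifs <;> constructor <;> linarith
  refine (Finset.abs_sum_le_sum_abs _ _).trans ((Finset.sum_le_sum fun i _ => hterm i).trans ?_)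
  have : ∑ i ∈ Finset.Ico (-(M : ℤ)) M, (Z.filter fun z => ⌊z⌋ = i).card ≤ Z.card := by
    rw [← Finset.card_biUnion]
    · refine Finset.card_le_card fun z hz => ?_
      rw [Finset.mem_biUnion] at hz
      obtain ⟨_, _, hz⟩ := hz
      exact (Finset.mem_filter.1 hz).1
    · intro i _ j _ hij
      refine Finset.disjoint_left.2 fun z hz hz' => hij ?_
      rw [← (Finset.mem_filter.1 hz).2, (Finset.mem_filter.1 hz').2]
  exact_mod_cast this.trans hZ

/-- Summing the measures of the integral slices of a set. -/
theorem abs_sum_slice_sub_volume_le {α : Type*} [MeasurableSpace α] {μ : Measure α} [SFinite μ]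
    {K M : ℕ} {R : Set (ℝ × α)} {B : Set α} (hR : MeasurableSet R) (hB : MeasurableSet B)
    (hBt : μ B ≠ ⊤)
    (hsub : R ⊆ Set.Ico (-(M : ℝ)) M ×ˢ B) (hK : ∀ y, StepSet K {x | (x, y) ∈ R}) :
    |∑ i ∈ Finset.Ico (-(M : ℤ)) M, μ.real {y | ((i : ℝ), y) ∈ R} -
      (volume.prod μ).real R| ≤ K * μ.real B := by
  classical
  have hs : ∀ x : ℝ, MeasurableSet {y | (x, y) ∈ R} := fun x => measurable_prodMk_left hR
  have hs' : ∀ y : α, MeasurableSet {x | (x, y) ∈ R} := fun y => measurable_prodMk_right hR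
  have hsB : ∀ x : ℝ, {y | (x, y) ∈ R} ⊆ B := fun x y hy => (hsub hy).2
  have hfin : IsFiniteMeasure (μ.restrict B) := ⟨by
    rw [Measure.restrict_apply_univ]; exact hBt.lt_top⟩
  have h1 : ∀ i : ℤ, μ.real {y | ((i : ℝ), y) ∈ R} =
      ∫ y in B, (if ((i : ℝ), y) ∈ R then (1 : ℝ) else 0) ∂μ := by
    intro i
    have : (fun y => if ((i : ℝ), y) ∈ R then (1 : ℝ) else 0) =
        Set.indicator {y | ((i : ℝ), y) ∈ R} 1 := by
      ext y; simp [Set.indicator_apply]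
    rw [this, integral_indicator_one (hs i), measureReal_restrict_apply (hs i),
      Set.inter_eq_left.2 (hsB i)]
  have hint : ∀ i : ℤ, Integrable (fun y => if ((i : ℝ), y) ∈ R then (1 : ℝ) else 0)
      (μ.restrict B) := by
    intro i
    have : (fun y => if ((i : ℝ), y) ∈ R then (1 : ℝ) else 0) =
        Set.indicator {y | ((i : ℝ), y) ∈ R} 1 := by
      ext y; simp [Set.indicator_apply]
    rw [this]
    exact (integrable_const (1 : ℝ)).indicator (hs i)
  have hvle : ∀ y, volume.real {x | (x, y) ∈ R} ≤ 2 * M := by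
    intro y
    have : volume.real {x | (x, y) ∈ R} ≤ volume.real (Set.Ico (-(M : ℝ)) M) :=
      measureReal_mono (fun x hx => (hsub hx).1) (by simp)
    rw [Real.volume_real_Ico_of_le (by have : (0:ℝ) ≤ M := by positivity
                                       linarith)] at this
    linarith
  have hmeas : Measurable fun y => volume.real {x | (x, y) ∈ R} :=
    (measurable_measure_prodMk_right hR).ennreal_toReal
  have hint2 : Integrable (fun y => volume.real {x | (x, y) ∈ R}) (μ.restrict B) := by
    refine Integrable.mono' (integrable_const (2 * (M : ℝ))) hmeas.aestronglyMeasurable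
      (Filter.Eventually.of_forall fun y => ?_)
    rw [Real.norm_eq_abs, abs_of_nonneg measureReal_nonneg]
    exact hvle y
  have h2 : (volume.prod μ).real R = ∫ y in B, volume.real {x | (x, y) ∈ R} ∂μ := by
    rw [measureReal_def, Measure.prod_apply_symm hR]
    simp only [measureReal_def]
    rw [integral_toReal]
    · congr 1
      rw [← lintegral_indicator hB]
      refine lintegral_congr fun y => ?_
      rw [Set.indicator_apply]
      split_ifs with hy
      · rfl
      · rw [show (fun x => (x, y)) ⁻¹' R = ∅ from
          Set.eq_empty_of_forall_notMem fun x hx => hy (hsub hx).2]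
        simp
    · exact (measurable_measure_prodMk_right hR).aemeasurable
    · refine Filter.Eventually.of_forall fun y => ?_
      exact lt_of_le_of_lt (measure_mono (t := Set.Ico (-(M : ℝ)) M) fun x hx => (hsub hx).1)
        (by simp)
  rw [Finset.sum_congr rfl fun i _ => h1 i, ← integral_finsetSum _ fun i _ => hint i, h2,
    ← integral_sub (integrable_finsetSum _ fun i _ => hint i) hint2]
  have := norm_integral_le_of_norm_le_const (μ := μ.restrict B) (C := (K : ℝ))
    (f := fun y => ∑ i ∈ Finset.Ico (-(M : ℤ)) M, (if ((i : ℝ), y) ∈ R then (1 : ℝ) else 0) -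
      volume.real {x | (x, y) ∈ R}) (Filter.Eventually.of_forall fun y => by
        rw [Real.norm_eq_abs]
        exact (hK y).abs_sum_sub_volume_le (hs' y) fun x hx => (hsub hx).1)
  rw [Real.norm_eq_abs] at this
  refine this.trans (le_of_eq ?_)
  rw [measureReal_restrict_apply MeasurableSet.univ, Set.univ_inter]

open Classical in
/-- Counting integer points in a planar set contained in a box with sides `A` and `B`. -/
theorem abs_card_sub_volume_le {K M : ℕ} {R : Set (ℝ × ℝ)} (hR : MeasurableSet R)
    (hM : R ⊆ Set.Ico (-(M : ℝ)) M ×ˢ Set.Ico (-(M : ℝ)) M)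
    (hK : ∀ y, StepSet K {x | (x, y) ∈ R}) (hK' : ∀ x, StepSet K {y | (x, y) ∈ R})
    {x₀ y₀ A B : ℝ} (hA : 0 ≤ A) (hB : 0 ≤ B)
    (hbox : R ⊆ Set.Icc x₀ (x₀ + A) ×ˢ Set.Icc y₀ (y₀ + B)) :
    |∑ i ∈ Finset.Ico (-(M : ℤ)) M, ∑ j ∈ Finset.Ico (-(M : ℤ)) M,
      (if ((i : ℝ), (j : ℝ)) ∈ R then (1 : ℝ) else 0) - volume.real R| ≤ K * (A + B + 1) := by
  have h1 := abs_sum_slice_sub_volume_le (μ := (volume : Measure ℝ)) (M := M)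
    (B := Set.Icc y₀ (y₀ + B)) hR measurableSet_Icc (by simp)
    (fun z hz => ⟨(hM hz).1, (hbox hz).2⟩) hK
  rw [Real.volume_real_Icc_of_le (by linarith)] at h1
  have h2 : ∀ i ∈ Finset.Ico (-(M : ℤ)) M, |∑ j ∈ Finset.Ico (-(M : ℤ)) M,
      (if ((i : ℝ), (j : ℝ)) ∈ R then (1 : ℝ) else 0) -
        volume.real {y | ((i : ℝ), y) ∈ R}| ≤
      if i ∈ Finset.Icc ⌈x₀⌉ ⌊x₀ + A⌋ then (K : ℝ) else 0 := by
    intro i _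
    split_ifs with hi
    · exact (hK' i).abs_sum_sub_volume_le (measurable_prodMk_left hR) fun y hy => (hM hy).2
    · have : ∀ y, ((i : ℝ), y) ∉ R := by
        intro y hy
        refine hi ?_
        have := (hbox hy).1
        rw [Finset.mem_Icc, Int.ceil_le, Int.le_floor]
        exact this
      simp [this]
  have h3 : |∑ i ∈ Finset.Ico (-(M : ℤ)) M, ∑ j ∈ Finset.Ico (-(M : ℤ)) M,
      (if ((i : ℝ), (j : ℝ)) ∈ R then (1 : ℝ) else 0) -
        ∑ i ∈ Finset.Ico (-(M : ℤ)) M, volume.real {y | ((i : ℝ), y) ∈ R}| ≤ K * (A + 1) := by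
    rw [← Finset.sum_sub_distrib]
    refine (Finset.abs_sum_le_sum_abs _ _).trans ((Finset.sum_le_sum h2).trans ?_)
    rw [← Finset.sum_filter, Finset.sum_const, nsmul_eq_mul, mul_comm]
    refine mul_le_mul_of_nonneg_left ?_ (by positivity)
    have hc : ((Finset.Ico (-(M : ℤ)) M).filter fun i => i ∈ Finset.Icc ⌈x₀⌉ ⌊x₀ + A⌋).card ≤
        (Finset.Icc ⌈x₀⌉ ⌊x₀ + A⌋).card :=
      Finset.card_le_card fun i hi => (Finset.mem_filter.1 hi).2
    rw [Int.card_Icc] at hc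
    have h4 : ((⌊x₀ + A⌋ + 1 - ⌈x₀⌉).toNat : ℝ) ≤ A + 1 := by
      have h5 : ((⌊x₀ + A⌋ + 1 - ⌈x₀⌉ : ℤ) : ℝ) ≤ A + 1 := by
        push_cast
        linarith [Int.floor_le (x₀ + A), Int.le_ceil x₀]
      rcases le_total 0 (⌊x₀ + A⌋ + 1 - ⌈x₀⌉) with h | h
      · have : (((⌊x₀ + A⌋ + 1 - ⌈x₀⌉).toNat : ℤ) : ℝ) = ((⌊x₀ + A⌋ + 1 - ⌈x₀⌉ : ℤ) : ℝ) := by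
          rw [Int.toNat_of_nonneg h]
        rw [← this] at h5
        exact_mod_cast h5
      · rw [Int.toNat_of_nonpos h]; simp; linarith
    exact le_trans (by exact_mod_cast hc) h4
  have e : (volume : Measure (ℝ × ℝ)) = (volume : Measure ℝ).prod volume := rfl
  rw [e]
  have := abs_add_le _ _ |>.trans (add_le_add h3 h1)
  refine le_trans (le_of_eq ?_) (this.trans (le_of_eq ?_))
  · congr 1; ring
  · ring

/-! ### The lattices `{(i,j) : m ∣ xi + j}` -/

/-- There is a nonzero vector of sup-norm at most `k` in `{(i,j) : m ∣ xi + j}`. -/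
def HasShort (m x k : ℕ) : Prop :=
  ∃ i j : ℤ, (i ≠ 0 ∨ j ≠ 0) ∧ |i| ≤ k ∧ |j| ≤ k ∧ (m : ℤ) ∣ x * i + j

theorem hasShort_self {m : ℕ} (hm : 0 < m) (x : ℕ) : HasShort m x m :=
  ⟨0, m, Or.inr (by exact_mod_cast hm.ne'), by simp, by simp, by simp⟩

open Classical in
/-- The minimal sup-norm of a nonzero vector of `{(i,j) : m ∣ xi + j}`. -/
noncomputable def shortNorm (m x : ℕ) : ℕ :=
  if h : ∃ k, HasShort m x k then Nat.find h else 0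

theorem hasShort_shortNorm {m : ℕ} (hm : 0 < m) (x : ℕ) : HasShort m x (shortNorm m x) := by
  classical
  have h : ∃ k, HasShort m x k := ⟨m, hasShort_self hm x⟩
  rw [shortNorm, dif_pos h]
  exact Nat.find_spec h

theorem shortNorm_le {m : ℕ} (x : ℕ) {k : ℕ} (hk : HasShort m x k) : shortNorm m x ≤ k := by
  classical
  have h : ∃ k, HasShort m x k := ⟨k, hk⟩
  rw [shortNorm, dif_pos h]
  exact Nat.find_min' h hk

theorem one_le_shortNorm {m : ℕ} (hm : 0 < m) (x : ℕ) : 1 ≤ shortNorm m x := by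
  obtain ⟨i, j, hij, hi, hj, -⟩ := hasShort_shortNorm hm x
  by_contra h
  have h0 : shortNorm m x = 0 := by omega
  rw [h0] at hi hj
  have := abs_nonpos_iff.1 (by exact_mod_cast hi : |i| ≤ 0)
  have := abs_nonpos_iff.1 (by exact_mod_cast hj : |j| ≤ 0)
  omega

theorem shortNorm_sq_le {m : ℕ} (hm : 0 < m) (x : ℕ) : shortNorm m x ^ 2 ≤ m := by
  have hs : HasShort m x (Nat.sqrt m) := by
    have : NeZero m := ⟨hm.ne'⟩
    let S := Finset.range (Nat.sqrt m + 1) ×ˢ Finset.range (Nat.sqrt m + 1)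
    have hcard : (Finset.univ : Finset (ZMod m)).card < S.card := by
      rw [Finset.card_univ, ZMod.card, Finset.card_product, Finset.card_range]
      exact Nat.lt_succ_sqrt m
    obtain ⟨a, ha, b, hb, hab, h⟩ := Finset.exists_ne_map_eq_of_card_lt_of_maps_to hcard
      (f := fun a : ℕ × ℕ => ((x * a.1 + a.2 : ℤ) : ZMod m)) (fun _ _ => Finset.mem_univ _)
    rw [Finset.mem_product, Finset.mem_range, Finset.mem_range] at ha hb
    refine ⟨(a.1 : ℤ) - b.1, (a.2 : ℤ) - b.2, ?_, ?_, ?_, ?_⟩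
    · by_contra hcon
      push Not at hcon
      exact hab (Prod.ext (by omega) (by omega))
    · rw [abs_le]; omega
    · rw [abs_le]; omega
    · rw [ZMod.intCast_eq_intCast_iff_dvd_sub] at h
      refine (dvd_neg.2 h).trans (dvd_of_eq ?_)
      ring
  calc shortNorm m x ^ 2 ≤ Nat.sqrt m ^ 2 := Nat.pow_le_pow_left (shortNorm_le x hs) 2
    _ ≤ m := Nat.sqrt_le' m

theorem exists_two_mul_abs_sub_le (a : ℤ) {b : ℤ} (hb : b ≠ 0) :
    ∃ t : ℤ, 2 * |a - t * b| ≤ |b| := by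
  refine ⟨round ((a : ℚ) / b), ?_⟩
  have h := abs_sub_round ((a : ℚ) / b)
  have hb' : (b : ℚ) ≠ 0 := by exact_mod_cast hb
  have : |((a : ℚ) - round ((a : ℚ) / b) * b)| ≤ 1 / 2 * |(b : ℚ)| := by
    rw [show (a : ℚ) - round ((a : ℚ) / b) * b = ((a : ℚ) / b - round ((a : ℚ) / b)) * b by
      field_simp, abs_mul]
    exact mul_le_mul_of_nonneg_right h (abs_nonneg _)
  have h2 : ((2 * |a - round ((a : ℚ) / b) * b| : ℤ) : ℚ) ≤ ((|b| : ℤ) : ℚ) := by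
    push_cast
    linarith
  exact_mod_cast h2

theorem abs_mul_le_of_det {i j α β m M : ℤ} (hM : |i| = M) (hj : |j| ≤ M) (hMm : M ^ 2 ≤ m)
    (hdet : |i * β - j * α| = m) (hα : 2 * |α| ≤ M) : |α| * M ≤ 2 * m ∧ |β| * M ≤ 2 * m := by
  have hM0 : 0 ≤ M := hM ▸ abs_nonneg i
  have h1 : |α| * M ≤ M ^ 2 := by nlinarith [abs_nonneg α]
  refine ⟨by nlinarith, ?_⟩
  have h2 : |β| * M = |i * β| := by rw [abs_mul, hM, mul_comm]
  have h3 : |i * β| ≤ |i * β - j * α| + |j * α| := by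
    have := abs_add_le (i * β - j * α) (j * α)
    simpa using this
  have h4 : |j * α| ≤ M * |α| := by
    rw [abs_mul]; exact mul_le_mul_of_nonneg_right hj (abs_nonneg _)
  rw [h2]
  nlinarith

/-- A reduced basis of `{(i,j) : m ∣ xi + j}`. -/
theorem exists_reduced_basis {m : ℕ} (hm : 0 < m) (x : ℕ) : ∃ i j α β : ℤ,
    i * β - j * α = m ∧ (m : ℤ) ∣ x * i + j ∧ (m : ℤ) ∣ x * α + β ∧
    |i| ≤ shortNorm m x ∧ |j| ≤ shortNorm m x ∧
    |α| * shortNorm m x ≤ 2 * m ∧ |β| * shortNorm m x ≤ 2 * m := by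
  obtain ⟨i, j, hij, hi, hj, k, hk⟩ := hasShort_shortNorm hm x
  have hM1 := one_le_shortNorm hm x
  have hMm : ((shortNorm m x : ℕ) : ℤ) ^ 2 ≤ m := by exact_mod_cast shortNorm_sq_le hm x
  have hmin : ∀ i' j' : ℤ, (i' ≠ 0 ∨ j' ≠ 0) → (m : ℤ) ∣ x * i' + j' →
      |i'| < shortNorm m x → |j'| < shortNorm m x → False := by
    intro i' j' h0 hd h1 h2
    have : shortNorm m x ≤ shortNorm m x - 1 :=
      shortNorm_le x ⟨i', j', h0, by omega, by omega, hd⟩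
    omega
  have hgcd : IsCoprime i k := by
    rw [Int.isCoprime_iff_gcd_eq_one]
    by_contra hg
    set g := Int.gcd i k with hgd
    obtain ⟨i', hi'⟩ : (g : ℤ) ∣ i := Int.gcd_dvd_left i k
    obtain ⟨k', hk'⟩ : (g : ℤ) ∣ k := Int.gcd_dvd_right i k
    have hj' : j = g * (m * k' - x * i') := by
      have : j = m * k - x * i := by linarith
      rw [this, hk', hi']; ring
    set j' := (m : ℤ) * k' - x * i' with hj'd
    have hg0 : g ≠ 0 := by
      intro h
      rw [h] at hi' hj'
      simp at hi' hj'
      omega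
    have hg2 : (2 : ℤ) ≤ g := by
      have : 2 ≤ g := by omega
      exact_mod_cast this
    have aux : ∀ t t' : ℤ, t = g * t' → |t| ≤ shortNorm m x → |t'| < shortNorm m x := by
      intro t t' h h'
      rw [h, abs_mul, abs_of_pos (by linarith)] at h'
      have := abs_nonneg t'
      have hs : (1 : ℤ) ≤ shortNorm m x := by exact_mod_cast hM1
      nlinarith
    refine hmin i' j' ?_ ⟨k', by rw [hj'd]; ring⟩ (aux i i' hi' hi) (aux j j' hj' hj)
    by_contra hcon
    push Not at hcon
    rw [hi', hj', hcon.1, hcon.2] at hij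
    simp at hij
  obtain ⟨p, q, hpq⟩ := hgcd
  -- `p * i + q * k = 1`
  have hdet : ∀ t : ℤ, i * ((x * q + m * p) + t * j) - j * (-q + t * i) = m := by
    intro t
    have : j = m * k - x * i := by linarith
    rw [this]
    linear_combination (m : ℤ) * hpq
  have hdvd : ∀ t : ℤ, (m : ℤ) ∣ x * (-q + t * i) + ((x * q + m * p) + t * j) := fun t =>
    ⟨p + t * k, by linear_combination t * hk⟩
  have hmax : |i| = shortNorm m x ∨ |j| = shortNorm m x := by
    by_contra hcon
    push Not at hcon
    exact hmin i j hij ⟨k, hk⟩ (lt_of_le_of_ne hi hcon.1) (lt_of_le_of_ne hj hcon.2)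
  have hs : (1 : ℤ) ≤ shortNorm m x := by exact_mod_cast hM1
  rcases hmax with h | h
  · have hi0 : i ≠ 0 := by intro h0; rw [h0] at h; simp at h; omega
    obtain ⟨t, ht⟩ := exists_two_mul_abs_sub_le (-q) hi0
    refine ⟨i, j, _, _, hdet (-t), ⟨k, hk⟩, hdvd (-t), hi, hj, ?_⟩
    refine abs_mul_le_of_det h hj hMm (by rw [hdet]; simp) ?_
    rw [← h, neg_mul]; exact ht
  · have hj0 : j ≠ 0 := by intro h0; rw [h0] at h; simp at h; omega
    obtain ⟨t, ht⟩ := exists_two_mul_abs_sub_le (x * q + m * p) hj0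
    refine ⟨i, j, _, _, hdet (-t), ⟨k, hk⟩, hdvd (-t), hi, hj, ?_⟩
    refine (abs_mul_le_of_det h hi hMm ?_ ?_).symm
    · rw [abs_sub_comm, hdet]; simp
    · rw [← h, neg_mul]; exact ht

theorem card_hasShort_le {m K : ℕ} (hK : 1 ≤ K) (hKm : K < m) :
    ((Finset.range m).filter fun x => shortNorm m x ≤ K).card ≤ 6 * K ^ 2 := by
  classical
  have hm : 0 < m := by omega
  let S : ℕ → ℕ → Finset ℤ := fun i t =>
    Finset.Icc ⌈(((m * t : ℕ) : ℝ) - K) / i⌉ ⌊(((m * t : ℕ) : ℝ) + K) / i⌋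
  have hsub : ((Finset.range m).filter fun x => shortNorm m x ≤ K).image (fun x : ℕ => (x : ℤ)) ⊆
      (Finset.Icc 1 K).biUnion fun i => (Finset.range (i + 1)).biUnion fun t => S i t := by
    intro y hy
    rw [Finset.mem_image] at hy
    obtain ⟨x, hx, rfl⟩ := hy
    rw [Finset.mem_filter, Finset.mem_range] at hx
    obtain ⟨hxm, hxK⟩ := hx
    have h : ∃ i j : ℤ, 0 < i ∧ i ≤ K ∧ |j| ≤ K ∧ (m : ℤ) ∣ x * i + j := by
      obtain ⟨i, j, hij, hi, hj, hd⟩ := hasShort_shortNorm hm x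
      have hi' : |i| ≤ K := hi.trans (by exact_mod_cast hxK)
      have hj' : |j| ≤ K := hj.trans (by exact_mod_cast hxK)
      rcases lt_trichotomy i 0 with h0 | h0 | h0
      · refine ⟨-i, -j, by omega, ?_, by rwa [abs_neg], ?_⟩
        · rwa [abs_of_neg h0] at hi'
        · rw [show (x : ℤ) * -i + -j = -(x * i + j) by ring]
          exact dvd_neg.2 hd
      · exfalso
        rw [h0, mul_zero, zero_add] at hd
        have hj0 : j ≠ 0 := by tauto
        have := Int.le_of_dvd (abs_pos.2 hj0) ((dvd_abs _ _).2 hd)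
        omega
      · exact ⟨i, j, h0, by rwa [abs_of_pos h0] at hi', hj', hd⟩
    obtain ⟨i, j, hi0, hiK, hj, t, ht⟩ := h
    lift i to ℕ using hi0.le
    rw [abs_le] at hj
    have hi0' : 0 < i := by exact_mod_cast hi0
    have hxi : (x : ℤ) * i < m * i := by
      have : (x : ℤ) < m := by exact_mod_cast hxm
      nlinarith
    have hxi0 : (0 : ℤ) ≤ x * i := by positivity
    have hKm' : (K : ℤ) < m := by exact_mod_cast hKm
    have ht0 : 0 ≤ t := by
      by_contra hneg
      push Not at hneg
      have : (m : ℤ) * t ≤ m * (-1) := mul_le_mul_of_nonneg_left (by omega) (by omega)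
      omega
    have hti : t ≤ i := by
      by_contra hneg
      push Not at hneg
      have : (m : ℤ) * (i + 1) ≤ m * t := mul_le_mul_of_nonneg_left (by omega) (by omega)
      have e : (m : ℤ) * (i + 1) = m * i + m := by ring
      omega
    lift t to ℕ using ht0
    have hir : (0 : ℝ) < i := by exact_mod_cast hi0'
    have htr : ((x : ℝ) * i + j) = m * t := by exact_mod_cast ht
    have hj1 : (-(K : ℝ)) ≤ j := by exact_mod_cast hj.1
    have hj2 : (j : ℝ) ≤ K := by exact_mod_cast hj.2
    simp only [Finset.mem_biUnion, Finset.mem_Icc, Finset.mem_range, S]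
    refine ⟨i, ⟨by omega, by exact_mod_cast hiK⟩, t, by omega, ?_, ?_⟩
    · rw [Int.ceil_le, div_le_iff₀ hir]
      push_cast
      linarith
    · rw [Int.le_floor, le_div_iff₀ hir]
      push_cast
      linarith
  rw [← Finset.card_image_of_injective _ (Nat.cast_injective (R := ℤ))]
  refine (Finset.card_le_card hsub).trans ?_
  have hS : ∀ i ∈ Finset.Icc 1 K, ∀ t, ((S i t).card : ℝ) ≤ 2 * K / i + 1 := by
    intro i hi t
    have hi1 := (Finset.mem_Icc.1 hi).1
    have hir : (0 : ℝ) < i := by exact_mod_cast hi1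
    simp only [S, Int.card_Icc]
    set A := (((m * t : ℕ) : ℝ) - K) / i
    set B := (((m * t : ℕ) : ℝ) + K) / i
    have hBA : B - A = 2 * K / i := by simp only [A, B]; field_simp; ring
    have h5 : ((⌊B⌋ + 1 - ⌈A⌉ : ℤ) : ℝ) ≤ 2 * K / i + 1 := by
      push_cast
      linarith [Int.floor_le B, Int.le_ceil A]
    rcases le_total 0 (⌊B⌋ + 1 - ⌈A⌉) with h | h
    · have e : (((⌊B⌋ + 1 - ⌈A⌉).toNat : ℤ) : ℝ) = ((⌊B⌋ + 1 - ⌈A⌉ : ℤ) : ℝ) := by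
        rw [Int.toNat_of_nonneg h]
      rw [← e] at h5
      exact_mod_cast h5
    · rw [Int.toNat_of_nonpos h]
      simp only [Nat.cast_zero]
      positivity
  have hi : ∀ i ∈ Finset.Icc 1 K, ((Finset.range (i + 1)).biUnion fun t => S i t).card ≤ 6 * K := by
    intro i hi
    refine Finset.card_biUnion_le.trans ?_
    have : ((∑ t ∈ Finset.range (i + 1), (S i t).card : ℕ) : ℝ) ≤ 6 * K := by
      push_cast
      refine (Finset.sum_le_sum fun t _ => hS i hi t).trans ?_
      rw [Finset.sum_const, Finset.card_range, nsmul_eq_mul]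
      obtain ⟨h1, h2⟩ := Finset.mem_Icc.1 hi
      have hir : (1 : ℝ) ≤ i := by exact_mod_cast h1
      have hiK : (i : ℝ) ≤ K := by exact_mod_cast h2
      push_cast
      have e : ((i : ℝ) + 1) * (2 * K / i + 1) = 2 * K + i + 1 + 2 * K / i := by field_simp; ring
      have e2 : (2 : ℝ) * K / i ≤ 2 * K := div_le_self (by positivity) hir
      linarith
    exact_mod_cast this
  refine (Finset.card_biUnion_le_card_mul _ _ _ hi).trans ?_
  rw [Nat.card_Icc]
  have : K + 1 - 1 = K := by omega
  rw [this]
  nlinarith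

theorem inv_eq_sum_inv_add {k T : ℕ} (hk : 1 ≤ k) (hkT : k ≤ T) :
    (1 : ℝ) / k = ∑ j ∈ Finset.Ico k T, 1 / ((j : ℝ) * (j + 1)) + 1 / T := by
  induction T, hkT using Nat.le_induction with
  | base => simp
  | succ T hT ih =>
    rw [Finset.sum_Ico_succ_top hT, ih]
    have : (0 : ℝ) < T := by exact_mod_cast (by omega : 0 < T)
    push_cast
    field_simp
    ring

theorem sum_inv_shortNorm_le {m : ℕ} (hm : 0 < m) :
    ∑ x ∈ Finset.range m, (1 : ℝ) / shortNorm m x ≤ 8 * √m := by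
  have hm' : (0 : ℝ) < m := by exact_mod_cast hm
  set T := Nat.sqrt m with hT
  have hT1 : 1 ≤ T := by rw [hT, Nat.one_le_iff_ne_zero, Ne, Nat.sqrt_eq_zero]; omega
  have hTle : (T : ℝ) ≤ √m := Real.nat_sqrt_le_real_sqrt
  have hTge : √m ≤ T + 1 := Real.real_sqrt_le_nat_sqrt_succ
  have hle : ∀ x, shortNorm m x ≤ T := fun x => by
    rw [hT, Nat.le_sqrt']; exact shortNorm_sq_le hm x
  have h1 : ∀ x ∈ Finset.range m, (1 : ℝ) / shortNorm m x =
      ∑ j ∈ Finset.Ico 1 T, (if shortNorm m x ≤ j then 1 / ((j : ℝ) * (j + 1)) else 0) +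
        1 / T := by
    intro x _
    rw [inv_eq_sum_inv_add (one_le_shortNorm hm x) (hle x), ← Finset.sum_filter]
    congr 2
    ext j
    have := one_le_shortNorm hm x
    simp only [Finset.mem_Ico, Finset.mem_filter]
    omega
  rw [Finset.sum_congr rfl h1, Finset.sum_add_distrib, Finset.sum_comm, Finset.sum_const,
    Finset.card_range, nsmul_eq_mul]
  have h2 : ∀ j ∈ Finset.Ico 1 T, ∑ x ∈ Finset.range m,
      (if shortNorm m x ≤ j then 1 / ((j : ℝ) * (j + 1)) else 0) ≤ 6 := by
    intro j hj
    obtain ⟨hj1, hj2⟩ := Finset.mem_Ico.1 hj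
    rw [← Finset.sum_filter, Finset.sum_const, nsmul_eq_mul]
    have hjm : j < m := hj2.trans_le (Nat.sqrt_le_self m)
    have h3 : (((Finset.range m).filter fun x => shortNorm m x ≤ j).card : ℝ) ≤ 6 * (j : ℝ) ^ 2 := by
      exact_mod_cast card_hasShort_le hj1 hjm
    have hj0 : (0 : ℝ) < j := by exact_mod_cast hj1
    rw [mul_one_div, div_le_iff₀ (by positivity)]
    nlinarith
  have h4 := Finset.sum_le_sum h2
  rw [Finset.sum_const, Nat.card_Ico, nsmul_eq_mul] at h4
  have h5 : ((T - 1 : ℕ) : ℝ) ≤ T - 1 := by rw [Nat.cast_sub hT1]; simp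
  have hT0 : (1 : ℝ) ≤ T := by exact_mod_cast hT1
  have h6 : (m : ℝ) * (1 / T) ≤ 2 * √m := by
    have hs : (m : ℝ) = √m * √m := (Real.mul_self_sqrt hm'.le).symm
    rw [mul_one_div, div_le_iff₀ (by linarith)]
    nlinarith [Real.sqrt_nonneg (m : ℝ)]
  nlinarith

/-! ### Size of the coefficients of reduced forms -/

theorem exists_coeff_bounds {s o : Bool} {Y : ℝ} (hY : 0 < Y) {f : ℝ × ℝ × ℝ × ℝ} (ha : f.1 ≠ 0)
    (hf : f ∈ redRegion s o (discConst s * Y ^ 2)) :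
    ∃ r v : ℝ, 0 < r ∧ 0 < v ∧ 3 / 4 ≤ v ^ 2 ∧ r ^ 2 * v ^ 3 < Y ∧ |f.1| ≤ r ∧
      |f.2.1| ≤ 12 * (r * v) ∧ |f.2.2.1| ≤ 12 * (r * v ^ 2) ∧ |f.2.2.2| ≤ 12 * (r * v ^ 3) := by
  obtain ⟨p, q, u, v, hv, rfl⟩ := exists_paramForm ha hf.2.1
  have hp : p ≠ 0 := by cases s <;> simpa [paramForm] using ha
  obtain ⟨⟨-, hd⟩, hX⟩ := (paramForm_mem_redRegion hp hv).1 hf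
  have hd' : ∀ i, 0 ≤ halfDomG i u v := by
    intro i
    have := hd i
    cases o
    · simpa [posB] using this
    · exact le_of_lt (by simpa [posB] using this)
  have h0 : 0 ≤ u := by simpa [halfDomG] using hd' 0
  have h1 : 0 ≤ 1 - 2 * u := by simpa [halfDomG] using hd' 1
  have h2 : 0 ≤ u ^ 2 + v ^ 2 - 1 := by simpa [halfDomG] using hd' 2
  have hv2 : 3 / 4 ≤ v ^ 2 := by nlinarith
  have huv : u ≤ v := by nlinarith
  set r := √(p ^ 2 + q ^ 2) with hr
  have hpq : 0 < p ^ 2 + q ^ 2 := by positivity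
  have hr0 : 0 < r := Real.sqrt_pos.2 hpq
  have hr2 : r ^ 2 = p ^ 2 + q ^ 2 := Real.sq_sqrt hpq.le
  have hpr : |p| ≤ r := Real.abs_le_sqrt (by nlinarith)
  have hqr : |q| ≤ r := Real.abs_le_sqrt (by nlinarith)
  have hYr : r ^ 2 * v ^ 3 < Y := by
    rw [hr2]
    have := lt_of_mul_lt_mul_left hX (discConst_pos s).le
    exact lt_of_pow_lt_pow_left₀ 2 hY.le this
  have hmon : ∀ i j k : ℕ, i + j = k → ∀ z : ℝ, |z| ≤ r → |u ^ i * v ^ j * z| ≤ r * v ^ k := by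
    rintro i j k rfl z hz
    rw [abs_mul, abs_of_nonneg (by positivity), pow_add, mul_comm r]
    gcongr
  refine ⟨r, v, hr0, hv, hv2, hYr, ?_, ?_, ?_, ?_⟩
  · cases s <;> simpa [paramForm] using hpr
  · have e1 := abs_le.1 (hmon 1 0 1 rfl p hpr)
    have e2 := abs_le.1 (hmon 0 1 1 rfl q hqr)
    rw [abs_le]
    cases s <;> simp only [paramForm, cond_true, cond_false] <;> constructor <;> nlinarith
  · have e1 := abs_le.1 (hmon 2 0 2 rfl p hpr)
    have e2 := abs_le.1 (hmon 1 1 2 rfl q hqr)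
    have e3 := abs_le.1 (hmon 0 2 2 rfl p hpr)
    rw [abs_le]
    cases s <;> simp only [paramForm, cond_true, cond_false] <;> constructor <;> nlinarith
  · have e1 := abs_le.1 (hmon 3 0 3 rfl p hpr)
    have e2 := abs_le.1 (hmon 2 1 3 rfl q hqr)
    have e3 := abs_le.1 (hmon 1 2 3 rfl p hpr)
    have e4 := abs_le.1 (hmon 0 3 3 rfl q hqr)
    rw [abs_le]
    cases s <;> simp only [paramForm, cond_true, cond_false] <;> constructor <;> nlinarith

/-- Products of coefficients of reduced forms. -/
theorem coeff_bounds {s o : Bool} {Y : ℝ} (hY : 0 < Y) {a b c d : ℝ} (ha : a ≠ 0)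
    (hf : (a, b, c, d) ∈ redRegion s o (discConst s * Y ^ 2)) :
    a ^ 2 ≤ 2 * Y ∧ b ^ 2 ≤ 200 * Y ∧ |b| * |c| ≤ 200 * Y ∧ |a| * |d| ≤ 200 * Y ∧
      |a| * |c| ^ 3 ≤ 2000 * Y ^ 2 ∧ |a| * |c| ≤ 200 * Y := by
  obtain ⟨r, v, hr, hv, hv2, hYr, h1, h2, h3, h4⟩ := exists_coeff_bounds hY ha hf
  simp only at h1 h2 h3 h4
  have hv' : 43 / 50 ≤ v := by nlinarith
  have hr2 : 0 < r ^ 2 := by positivity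
  have hv3 : 1 / 2 ≤ v ^ 3 := by
    calc (1 : ℝ) / 2 ≤ (43 / 50) ^ 3 := by norm_num
      _ ≤ v ^ 3 := by gcongr
  have hrv : r ^ 2 * v ^ 2 ≤ 50 / 43 * Y := by
    have : r ^ 2 * v ^ 2 * (43 / 50) ≤ r ^ 2 * v ^ 2 * v := by gcongr
    nlinarith
  refine ⟨?_, ?_, ?_, ?_, ?_, ?_⟩
  · have : a ^ 2 ≤ r ^ 2 := by rw [← sq_abs]; gcongr
    nlinarith
  · have : b ^ 2 ≤ (12 * (r * v)) ^ 2 := by rw [← sq_abs]; gcongr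
    nlinarith
  · calc |b| * |c| ≤ 12 * (r * v) * (12 * (r * v ^ 2)) := by gcongr
      _ = 144 * (r ^ 2 * v ^ 3) := by ring
      _ ≤ 200 * Y := by linarith
  · calc |a| * |d| ≤ r * (12 * (r * v ^ 3)) := by gcongr
      _ = 12 * (r ^ 2 * v ^ 3) := by ring
      _ ≤ 200 * Y := by linarith
  · calc |a| * |c| ^ 3 ≤ r * (12 * (r * v ^ 2)) ^ 3 := by gcongr
      _ = 1728 * (r ^ 2 * v ^ 3) ^ 2 := by ring
      _ ≤ 1728 * Y ^ 2 := by gcongr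
      _ ≤ 2000 * Y ^ 2 := by nlinarith
  · calc |a| * |c| ≤ r * (12 * (r * v ^ 2)) := by gcongr
      _ = 12 * (r ^ 2 * v ^ 2) := by ring
      _ ≤ 200 * Y := by linarith

/-! ### Measurability and tameness of the region -/

theorem measurable_redG (s : Bool) (i : Fin 3) : Measurable (redG s i) := by
  have h : redG s i = fun f => redG s i f := rfl
  rw [h]
  cases s <;> fin_cases i <;> simp only [redG, cond_true, cond_false] <;> simp <;> fun_prop

theorem measurable_sdisc (s : Bool) : Measurable (sdisc s) := by
  have h : sdisc s = fun f => sdisc s f := rfl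
  rw [h]
  cases s <;> simp only [sdisc, discR, cond_true, cond_false] <;> fun_prop

theorem measurableSet_posB (o : Bool) : MeasurableSet {t | posB o t} := by
  cases o
  · exact measurableSet_Ici
  · exact measurableSet_Ioi

theorem measurableSet_redRegion (s o : Bool) (X : ℝ) : MeasurableSet (redRegion s o X) := by
  have h : redRegion s o X = (⋂ i, redG s i ⁻¹' {t | posB o t}) ∩ sdisc s ⁻¹' Set.Ioo 0 X := by
    ext f
    simp [redRegion]
  rw [h]
  exact (MeasurableSet.iInter fun i => measurable_redG s i (measurableSet_posB o)).inter
    (measurable_sdisc s measurableSet_Ioo)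

/-- The restriction of `redG` to a line, as a polynomial. -/
theorem exists_redG_line (s : Bool) (i : Fin 3) (P V : ℝ × ℝ × ℝ × ℝ) :
    ∃ p : Polynomial ℝ, p.natDegree ≤ 2 ∧ ∀ t, p.eval t = redG s i (P + t • V) := by
  obtain ⟨P1, P2, P3, P4⟩ := P
  obtain ⟨V1, V2, V3, V4⟩ := V
  open Polynomial in
  cases s <;> fin_cases i
  · refine ⟨(C P1 + X * C V1) * (C P4 + X * C V4) - (C P2 + X * C V2) * (C P3 + X * C V3),
      by compute_degree, fun t => by simp [redG, mul_comm t]⟩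
  · refine ⟨(C P1 + X * C V1 + (C P2 + X * C V2)) ^ 2 + (C P1 + X * C V1) * (C P3 + X * C V3) -
      (C P1 + X * C V1) * (C P4 + X * C V4) + (C P2 + X * C V2) * (C P3 + X * C V3),
      by compute_degree, fun t => by simp [redG, mul_comm t]⟩
  · refine ⟨(C P4 + X * C V4) ^ 2 - (C P1 + X * C V1) ^ 2 + (C P1 + X * C V1) * (C P3 + X * C V3) -
      (C P2 + X * C V2) * (C P4 + X * C V4), by compute_degree, fun t => by simp [redG, mul_comm t]⟩
  · refine ⟨C 9 * (C P1 + X * C V1) * (C P4 + X * C V4) - (C P2 + X * C V2) * (C P3 + X * C V3),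
      by compute_degree, fun t => by simp [redG, mul_comm t]⟩
  · refine ⟨(C P2 + X * C V2) ^ 2 - C 3 * (C P1 + X * C V1) * (C P3 + X * C V3) +
      (C P2 + X * C V2) * (C P3 + X * C V3) - C 9 * (C P1 + X * C V1) * (C P4 + X * C V4),
      by compute_degree, fun t => by simp [redG, mul_comm t]⟩
  · refine ⟨(C P3 + X * C V3) ^ 2 - C 3 * (C P2 + X * C V2) * (C P4 + X * C V4) -
      (C P2 + X * C V2) ^ 2 + C 3 * (C P1 + X * C V1) * (C P3 + X * C V3),
      by compute_degree, fun t => by simp [redG, mul_comm t]⟩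

theorem exists_sdisc_line (s : Bool) (P V : ℝ × ℝ × ℝ × ℝ) :
    ∃ p : Polynomial ℝ, p.natDegree ≤ 4 ∧ ∀ t, p.eval t = sdisc s (P + t • V) := by
  obtain ⟨P1, P2, P3, P4⟩ := P
  obtain ⟨V1, V2, V3, V4⟩ := V
  open Polynomial in
  have h : ∃ p : Polynomial ℝ, p.natDegree ≤ 4 ∧
      ∀ t, p.eval t = discR ((P1, P2, P3, P4) + t • (V1, V2, V3, V4)) := by
    refine ⟨(C P2 + X * C V2) ^ 2 * (C P3 + X * C V3) ^ 2 -
      C 4 * (C P1 + X * C V1) * (C P3 + X * C V3) ^ 3 -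
      C 4 * (C P2 + X * C V2) ^ 3 * (C P4 + X * C V4) -
      C 27 * (C P1 + X * C V1) ^ 2 * (C P4 + X * C V4) ^ 2 +
      C 18 * (C P1 + X * C V1) * (C P2 + X * C V2) * (C P3 + X * C V3) * (C P4 + X * C V4),
      by compute_degree, fun t => by simp [discR, mul_comm t]⟩
  obtain ⟨p, hp, h⟩ := h
  cases s
  · exact ⟨-p, by simpa using hp, fun t => by simp [sdisc, h]⟩
  · exact ⟨p, hp, fun t => by simp [sdisc, h]⟩

theorem stepSet_redRegion (s o : Bool) (X : ℝ) (P V : ℝ × ℝ × ℝ × ℝ) :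
    StepSet 14 {t : ℝ | P + t • V ∈ redRegion s o X} := by
  obtain ⟨p0, h0, e0⟩ := exists_redG_line s 0 P V
  obtain ⟨p1, h1, e1⟩ := exists_redG_line s 1 P V
  obtain ⟨p2, h2, e2⟩ := exists_redG_line s 2 P V
  obtain ⟨p, hp, e⟩ := exists_sdisc_line s P V
  have hp' : (Polynomial.C X - p).natDegree ≤ 4 :=
    (Polynomial.natDegree_sub_le _ _).trans (by simpa using hp)
  have := (((stepSet_polynomial o p0 h0).inter (stepSet_polynomial o p1 h1)).inter
    (stepSet_polynomial o p2 h2)).inter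
      ((stepSet_polynomial true p hp).inter (stepSet_polynomial true (Polynomial.C X - p) hp'))
  convert this using 1
  ext t
  simp [redRegion, e0, e1, e2, e, posB, Fin.forall_fin_succ, and_assoc]

/-! ### Counting points of a congruence sublattice of `ℤ²` in a tame planar region -/

open MeasureTheory in
theorem volume_real_preimage_affine {R : Set (ℝ × ℝ)} {i j α β m w : ℝ}
    (hdet : i * β - j * α = m) (hm : 0 < m) :
    volume.real {z : ℝ × ℝ | (z.1 * i + z.2 * α, z.1 * j + z.2 * β - w) ∈ R} =
      volume.real R / m := by
  set L := Matrix.toLin (Module.Basis.finTwoProd ℝ) (Module.Basis.finTwoProd ℝ) !![i, α; j, β]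
    with hL
  have hLdet : LinearMap.det L = m := by
    rw [hL, LinearMap.det_toLin, Matrix.det_fin_two_of]
    linarith
  have h : {z : ℝ × ℝ | (z.1 * i + z.2 * α, z.1 * j + z.2 * β - w) ∈ R} =
      L ⁻¹' ((fun z => z + (0, -w)) ⁻¹' R) := by
    ext z
    have : L z = (i * z.1 + α * z.2, j * z.1 + β * z.2) := by
      rw [hL, Matrix.toLin_finTwoProd_apply]
    simp only [Set.mem_ofPred_eq, Set.mem_preimage, this, Prod.mk_add_mk, add_zero]
    rw [mul_comm z.1, mul_comm z.2, mul_comm z.1, mul_comm z.2, sub_eq_add_neg]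
  rw [h, measureReal_def, Measure.addHaar_preimage_linearMap _ (by rw [hLdet]; exact hm.ne'),
    measure_preimage_add_right, ENNReal.toReal_mul, hLdet,
    ENNReal.toReal_ofReal (abs_nonneg _), abs_of_pos (inv_pos.2 hm), measureReal_def]
  field_simp

open MeasureTheory in
open Classical in
theorem abs_card_congr_sub_le {K M m : ℕ} (hm : 0 < m) (x : ℕ) (w : ℤ) {R : Set (ℝ × ℝ)}
    (hR : MeasurableSet R) {D : ℝ} (hD : 0 ≤ D) (hDM : D < M)
    (hbox : ∀ z ∈ R, |z.1| ≤ D ∧ |z.2| ≤ D)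
    (hK : ∀ P V : ℝ × ℝ, StepSet K {t : ℝ | P + t • V ∈ R}) :
    |∑ c ∈ Finset.Ico (-(M : ℤ)) M, ∑ d ∈ Finset.Ico (-(M : ℤ)) M,
      (if ((c : ℝ), (d : ℝ)) ∈ R ∧ (m : ℤ) ∣ w + x * c + d then (1 : ℝ) else 0) -
        volume.real R / m| ≤ K * (16 * D / shortNorm m x + 1) := by
  obtain ⟨i, j, α, β, hdet, hd1, hd2, hi, hj, hα, hβ⟩ := exists_reduced_basis hm x
  have hM1 := one_le_shortNorm hm x
  have hM1m := shortNorm_sq_le hm x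
  set M1 := shortNorm m x
  have hm' : (0 : ℝ) < m := by exact_mod_cast hm
  have hM1' : (1 : ℝ) ≤ M1 := by exact_mod_cast hM1
  have hM1m' : (M1 : ℝ) ^ 2 ≤ m := by exact_mod_cast hM1m
  have hdet' : (i : ℝ) * β - j * α = m := by exact_mod_cast hdet
  have hi' : |(i : ℝ)| ≤ M1 := by exact_mod_cast hi
  have hj' : |(j : ℝ)| ≤ M1 := by exact_mod_cast hj
  have hα' : |(α : ℝ)| * M1 ≤ 2 * m := by exact_mod_cast hα
  have hβ' : |(β : ℝ)| * M1 ≤ 2 * m := by exact_mod_cast hβ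
  set R' : Set (ℝ × ℝ) := {z | (z.1 * i + z.2 * α, z.1 * j + z.2 * β - w) ∈ R} with hR'
  set s₀ : ℝ := -(α * w) / m
  set t₀ : ℝ := i * w / m
  set E := 4 * D / M1 with hE
  have hE0 : 0 ≤ E := by positivity
  have hR'box : ∀ z ∈ R', |z.1 - s₀| ≤ E ∧ |z.2 - t₀| ≤ E := by
    intro z hz
    obtain ⟨h1, h2⟩ := hbox _ hz
    simp only at h1 h2
    set c := z.1 * i + z.2 * α with hc
    set d := z.1 * j + z.2 * β - w with hd
    have e1 : z.1 - s₀ = (β * c - α * d) / m := by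
      rw [eq_div_iff hm'.ne', sub_mul, div_mul_cancel₀ _ hm'.ne', hc, hd, ← hdet']
      ring
    have e2 : z.2 - t₀ = (i * d - j * c) / m := by
      rw [eq_div_iff hm'.ne', sub_mul, div_mul_cancel₀ _ hm'.ne', hc, hd, ← hdet']
      ring
    have hM0 : (0 : ℝ) < M1 := by linarith
    rw [e1, e2, abs_div, abs_div, abs_of_pos hm', div_le_iff₀ hm', div_le_iff₀ hm', hE,
      div_mul_eq_mul_div, le_div_iff₀ hM0, le_div_iff₀ hM0]
    constructor
    · calc |β * c - α * d| * M1 ≤ (|β * c| + |α * d|) * M1 := by gcongr; exact abs_sub _ _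
        _ = (|(β : ℝ)| * M1) * |c| + (|(α : ℝ)| * M1) * |d| := by rw [abs_mul, abs_mul]; ring
        _ ≤ 2 * m * D + 2 * m * D := by gcongr
        _ = 4 * D * m := by ring
    · calc |i * d - j * c| * M1 ≤ (|i * d| + |j * c|) * M1 := by gcongr; exact abs_sub _ _
        _ = (|(i : ℝ)| * |d| + |(j : ℝ)| * |c|) * M1 := by rw [abs_mul, abs_mul]
        _ ≤ (M1 * D + M1 * D) * M1 := by gcongr
        _ = 2 * D * M1 ^ 2 := by ring
        _ ≤ 2 * D * m := by gcongr
        _ ≤ 4 * D * m := by nlinarith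
  have hR'm : MeasurableSet R' := by
    have : Measurable fun z : ℝ × ℝ => (z.1 * i + z.2 * α, z.1 * j + z.2 * β - (w : ℝ)) := by
      fun_prop
    exact this hR
  have hvol : volume.real R' = volume.real R / m := volume_real_preimage_affine hdet' hm'
  obtain ⟨M', hM'⟩ := exists_nat_gt (|s₀| + |t₀| + E)
  have hR'M : R' ⊆ Set.Ico (-(M' : ℝ)) M' ×ˢ Set.Ico (-(M' : ℝ)) M' := by
    intro z hz
    obtain ⟨h1, h2⟩ := hR'box z hz
    rw [abs_le] at h1 h2
    have := neg_abs_le s₀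
    have := le_abs_self s₀
    have := neg_abs_le t₀
    have := le_abs_self t₀
    have := abs_nonneg s₀
    have := abs_nonneg t₀
    exact ⟨⟨by linarith, by linarith⟩, by linarith, by linarith⟩
  have key := abs_card_sub_volume_le (K := K) (M := M') hR'm hR'M
    (fun y => by
      have := hK (y * α, y * β - w) (i, j)
      convert this using 3 with t
      simp only [hR', Set.mem_ofPred_eq, Prod.smul_mk, smul_eq_mul, Prod.mk_add_mk]
      rw [add_comm, show t * (j : ℝ) + y * β - w = y * β - w + t * j by ring])
    (fun y => by
      have := hK (y * i, y * j - w) (α, β)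
      convert this using 3 with t
      simp only [hR', Set.mem_ofPred_eq, Prod.smul_mk, smul_eq_mul, Prod.mk_add_mk]
      rw [show y * (j : ℝ) + t * β - w = y * j - w + t * β by ring])
    (x₀ := s₀ - E) (y₀ := t₀ - E) (A := 2 * E) (B := 2 * E) (by positivity) (by positivity)
    (fun z hz => by
      obtain ⟨h1, h2⟩ := hR'box z hz
      rw [abs_le] at h1 h2
      exact ⟨⟨by linarith, by linarith⟩, by linarith, by linarith⟩)
  rw [hvol] at key
  have hsum : ∑ c ∈ Finset.Ico (-(M : ℤ)) M, ∑ d ∈ Finset.Ico (-(M : ℤ)) M,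
      (if ((c : ℝ), (d : ℝ)) ∈ R ∧ (m : ℤ) ∣ w + x * c + d then (1 : ℝ) else 0) =
      ∑ s ∈ Finset.Ico (-(M' : ℤ)) M', ∑ t ∈ Finset.Ico (-(M' : ℤ)) M',
        (if ((s : ℝ), (t : ℝ)) ∈ R' then (1 : ℝ) else 0) := by
    rw [← Finset.sum_product', ← Finset.sum_product']
    rw [Finset.sum_boole, Finset.sum_boole]
    congr 1
    have hmZ : (m : ℤ) ≠ 0 := by exact_mod_cast hm.ne'
    have hi1 : ∀ c d : ℤ, (m : ℤ) ∣ w + x * c + d → (m : ℤ) ∣ β * c - α * (d + w) := by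
      intro c d h
      have := dvd_sub (hd2.mul_right c) (h.mul_left α)
      refine this.trans (dvd_of_eq ?_)
      ring
    have hi2 : ∀ c d : ℤ, (m : ℤ) ∣ w + x * c + d → (m : ℤ) ∣ i * (d + w) - j * c := by
      intro c d h
      have := dvd_sub (h.mul_left i) (hd1.mul_right c)
      refine this.trans (dvd_of_eq ?_)
      ring
    have hinv1 : ∀ c d : ℤ, (m : ℤ) ∣ w + x * c + d →
        (β * c - α * (d + w)) / m * i + (i * (d + w) - j * c) / m * α = c := by
      intro c d h
      obtain ⟨k, hk⟩ := hi1 c d h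
      obtain ⟨l, hl⟩ := hi2 c d h
      rw [hk, hl, Int.mul_ediv_cancel_left _ hmZ, Int.mul_ediv_cancel_left _ hmZ]
      apply mul_left_cancel₀ hmZ
      linear_combination (-i) * hk - α * hl + c * hdet
    have hinv2 : ∀ c d : ℤ, (m : ℤ) ∣ w + x * c + d →
        (β * c - α * (d + w)) / m * j + (i * (d + w) - j * c) / m * β - w = d := by
      intro c d h
      obtain ⟨k, hk⟩ := hi1 c d h
      obtain ⟨l, hl⟩ := hi2 c d h
      rw [hk, hl, Int.mul_ediv_cancel_left _ hmZ, Int.mul_ediv_cancel_left _ hmZ]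
      apply mul_left_cancel₀ hmZ
      linear_combination (-j) * hk - β * hl + (d + w) * hdet
    refine Finset.card_nbij'
      (fun z => ((β * z.1 - α * (z.2 + w)) / m, (i * (z.2 + w) - j * z.1) / m))
      (fun z => (z.1 * i + z.2 * α, z.1 * j + z.2 * β - w)) ?_ ?_ ?_ ?_
    · rintro ⟨c, d⟩ h
      simp only [Finset.coe_filter, Set.mem_ofPred_eq] at h
      obtain ⟨-, hcd, hdv⟩ := h
      have hmem : ((((β * c - α * (d + w)) / m : ℤ) : ℝ), (((i * (d + w) - j * c) / m : ℤ) : ℝ)) ∈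
          R' := by
        rw [hR', Set.mem_ofPred_eq]
        convert hcd
        · dsimp only; exact_mod_cast hinv1 c d hdv
        · dsimp only; exact_mod_cast hinv2 c d hdv
      simp only [Finset.coe_filter, Set.mem_ofPred_eq, Finset.mem_product, Finset.mem_Ico]
      refine ⟨?_, hmem⟩
      obtain ⟨⟨h1, h2⟩, h3, h4⟩ := hR'M hmem
      simp only at h1 h2 h3 h4
      exact ⟨⟨by exact_mod_cast h1, by exact_mod_cast h2⟩, by exact_mod_cast h3,
        by exact_mod_cast h4⟩
    · rintro ⟨s, t⟩ h
      simp only [Finset.coe_filter, Set.mem_ofPred_eq] at h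
      obtain ⟨-, hst⟩ := h
      have hst' : (((s * i + t * α : ℤ) : ℝ), ((s * j + t * β - w : ℤ) : ℝ)) ∈ R := by
        push_cast
        exact hst
      simp only [Finset.coe_filter, Set.mem_ofPred_eq, Finset.mem_product, Finset.mem_Ico]
      refine ⟨?_, hst', ?_⟩
      · obtain ⟨h1, h2⟩ := hbox _ hst'
        simp only [abs_le] at h1 h2
        have a1 : (-(M : ℝ)) ≤ ((s * i + t * α : ℤ) : ℝ) := by linarith
        have a2 : ((s * i + t * α : ℤ) : ℝ) < M := by linarith
        have a3 : (-(M : ℝ)) ≤ ((s * j + t * β - w : ℤ) : ℝ) := by linarith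
        have a4 : ((s * j + t * β - w : ℤ) : ℝ) < M := by linarith
        exact ⟨⟨by exact_mod_cast a1, by exact_mod_cast a2⟩, by exact_mod_cast a3,
          by exact_mod_cast a4⟩
      · have := dvd_add (hd1.mul_left s) (hd2.mul_left t)
        refine this.trans (dvd_of_eq ?_)
        ring
    · rintro ⟨c, d⟩ h
      simp only [Finset.coe_filter, Set.mem_ofPred_eq] at h
      exact Prod.ext (hinv1 c d h.2.2) (hinv2 c d h.2.2)
    · rintro ⟨s, t⟩ -
      refine Prod.ext ?_ ?_
      · simp only
        rw [show β * (s * i + t * α) - α * (s * j + t * β - w + w) = s * (i * β - j * α) by ring,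
          hdet, Int.mul_ediv_cancel _ hmZ]
      · simp only
        rw [show i * (s * j + t * β - w + w) - j * (s * i + t * α) = t * (i * β - j * α) by ring,
          hdet, Int.mul_ediv_cancel _ hmZ]
  rw [hsum]
  refine key.trans (le_of_eq ?_)
  rw [hE]
  ring

/-! ### Points with prescribed leading coefficient -/

/-- The forms of `redRegion` with leading coefficient `a`, as triples `(b, c, d)`. -/
def redSlice (s o : Bool) (X a : ℝ) : Set (ℝ × ℝ × ℝ) := {y | (a, y) ∈ redRegion s o X}

theorem measurableSet_redSlice (s o : Bool) (X a : ℝ) : MeasurableSet (redSlice s o X a) :=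
  (measurableSet_redRegion s o X).preimage (measurable_const.prodMk measurable_id)

theorem card_filter_abs_le (S : Finset ℤ) {T : ℝ} (hT : 0 ≤ T) :
    ((S.filter fun b : ℤ => |(b : ℝ)| ≤ T).card : ℝ) ≤ 2 * T + 1 := by
  have h : (S.filter fun b : ℤ => |(b : ℝ)| ≤ T) ⊆ Finset.Icc (-⌊T⌋) ⌊T⌋ := by
    intro b hb
    rw [Finset.mem_filter, abs_le] at hb
    rw [Finset.mem_Icc]
    refine ⟨?_, Int.le_floor.2 hb.2.2⟩
    have : -b ≤ ⌊T⌋ := Int.le_floor.2 (by push_cast; linarith)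
    omega
  have h1 := Finset.card_le_card h
  rw [Int.card_Icc] at h1
  have h2 : (0 : ℤ) ≤ ⌊T⌋ := Int.floor_nonneg.2 hT
  have h3 : ((S.filter fun b : ℤ => |(b : ℝ)| ≤ T).card : ℤ) ≤ 2 * ⌊T⌋ + 1 := by omega
  have h4 : ((S.filter fun b : ℤ => |(b : ℝ)| ≤ T).card : ℝ) ≤ 2 * (⌊T⌋ : ℝ) + 1 := by
    exact_mod_cast h3
  have := Int.floor_le T
  linarith

set_option maxHeartbeats 1000000 in
open MeasureTheory in
open Classical in
theorem abs_slice_count_sub_le (s o : Bool) {Y : ℝ} (hY : 1 / 11 ≤ Y) {M m : ℕ} (hm : 0 < m)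
    (x : ℕ) {a : ℤ} (ha : a ≠ 0) (haY : (a : ℝ) ^ 2 ≤ 2 * Y) (hM : 200 * Y + 15 < M) :
    |∑ b ∈ Finset.Ico (-(M : ℤ)) M, ∑ c ∈ Finset.Ico (-(M : ℤ)) M, ∑ d ∈ Finset.Ico (-(M : ℤ)) M,
      (if castF (a, b, c, d) ∈ redRegion s o (discConst s * Y ^ 2) ∧
        (m : ℤ) ∣ a * x ^ 3 + b * x ^ 2 + c * x + d then (1 : ℝ) else 0) -
      volume.real (redSlice s o (discConst s * Y ^ 2) a) / m| ≤
      4000000 * ((Y ^ 2 / |(a : ℝ)|) ^ (1 / 3 : ℝ) * (Y / |(a : ℝ)|) / shortNorm m x + √Y) := by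
  have hY0 : 0 < Y := by linarith
  set R := redRegion s o (discConst s * Y ^ 2) with hR
  set A := |(a : ℝ)| with hA
  have haR : (a : ℝ) ≠ 0 := by exact_mod_cast ha
  have hA1 : 1 ≤ A := by
    rw [hA]
    exact_mod_cast Int.one_le_abs ha
  have hA0 : 0 < A := by linarith
  have hAY : A ^ 2 ≤ 2 * Y := by rwa [hA, sq_abs]
  set h := (Y ^ 2 / A) ^ (1 / 3 : ℝ) with hh
  have hh0 : 0 < h := by positivity
  have hh3 : h ^ 3 = Y ^ 2 / A := by
    rw [hh, ← Real.rpow_natCast, ← Real.rpow_mul (by positivity)]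
    norm_num
  have hM1 : (1 : ℝ) ≤ shortNorm m x := by exact_mod_cast one_le_shortNorm hm x
  have hM1m : (shortNorm m x : ℝ) ≤ m := by
    have : (shortNorm m x : ℝ) ^ 2 ≤ m := by exact_mod_cast shortNorm_sq_le hm x
    nlinarith
  set M1 : ℝ := (shortNorm m x : ℝ) with hM1d
  have hm' : (0 : ℝ) < m := by exact_mod_cast hm
  set r := √Y with hr
  have hr2 : r ^ 2 = Y := Real.sq_sqrt hY0.le
  have hr0 : 0 < r := Real.sqrt_pos.2 hY0
  have hr1 : 1 ≤ 4 * r := by nlinarith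
  have hAr : A ≤ 2 * r := by nlinarith
  have hrh : r ≤ 2 * h := by
    refine le_of_pow_le_pow_left₀ (n := 3) (by norm_num) (by positivity) ?_
    rw [mul_pow, hh3, ← mul_div_assoc, le_div_iff₀ hA0, ← hr2]
    nlinarith [pow_pos hr0 3]
  set D := 200 * Y / A with hD
  have hD0 : 0 ≤ D := by positivity
  have hDM : D < M := by
    have : D ≤ 200 * Y := div_le_self (by positivity) hA1
    linarith
  -- bounds for the points of the slices
  have hbd : ∀ b c d : ℝ, ((a : ℝ), b, c, d) ∈ R → |b| ≤ 15 * r ∧ |c| ≤ D ∧ |d| ≤ D ∧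
      |c| ≤ 13 * h := by
    intro b c d hf
    obtain ⟨-, hb, -, hd, hc, hc'⟩ := coeff_bounds hY0 haR hf
    refine ⟨?_, ?_, ?_, ?_⟩
    · refine abs_le_of_sq_le_sq ?_ (by positivity)
      nlinarith
    · rw [hD, le_div_iff₀ hA0, mul_comm]
      exact hc'
    · rw [hD, le_div_iff₀ hA0, mul_comm]
      exact hd
    · refine le_of_pow_le_pow_left₀ (n := 3) (by norm_num) (by positivity) ?_
      rw [mul_pow, hh3, ← mul_div_assoc, le_div_iff₀ hA0, mul_comm]
      nlinarith [sq_nonneg Y]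
  set R2 : ℝ → Set (ℝ × ℝ) := fun b => {z | ((a : ℝ), b, z) ∈ R} with hR2
  have hR2m : ∀ b, MeasurableSet (R2 b) := fun b =>
    (measurableSet_redRegion s o _).preimage
      (measurable_const.prodMk (measurable_const.prodMk measurable_id))
  have step1 : ∀ b : ℤ, |∑ c ∈ Finset.Ico (-(M : ℤ)) M, ∑ d ∈ Finset.Ico (-(M : ℤ)) M,
      (if castF (a, b, c, d) ∈ R ∧ (m : ℤ) ∣ a * x ^ 3 + b * x ^ 2 + c * x + d
        then (1 : ℝ) else 0) - volume.real (R2 b) / m| ≤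
      if |(b : ℝ)| ≤ 15 * r then 14 * (16 * D / M1 + 1) else 0 := by
    intro b
    split_ifs with hb
    · have := abs_card_congr_sub_le (K := 14) hm x (a * x ^ 3 + b * x ^ 2) (hR2m b) hD0 hDM
        (fun z hz => ⟨(hbd _ _ _ hz).2.1, (hbd _ _ _ hz).2.2.1⟩) (fun P V => by
          have := stepSet_redRegion s o (discConst s * Y ^ 2) ((a : ℝ), (b : ℝ), P) (0, 0, V)
          convert this using 3 with t
          simp [hR2, hR])
      rw [show ((14 : ℕ) : ℝ) = 14 by norm_num] at this
      convert this using 10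
      simp only [castF, hR2, Set.mem_ofPred_eq]
      rw [mul_comm (x : ℤ)]
    · have h1 : ∀ c d : ℝ, ((a : ℝ), (b : ℝ), c, d) ∉ R := fun c d hf => hb (hbd _ _ _ hf).1
      have h2 : R2 b = ∅ := by
        ext z
        simpa [hR2] using h1 z.1 z.2
      rw [h2]
      simp [castF, h1]
  have step2 : |∑ b ∈ Finset.Ico (-(M : ℤ)) M, volume.real (R2 b) -
      volume.real (redSlice s o (discConst s * Y ^ 2) a)| ≤ 14 * (4 * (13 * h) * D) := by
    have := abs_sum_slice_sub_volume_le (μ := (volume : Measure (ℝ × ℝ))) (K := 14) (M := M)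
      (B := Set.Icc (-(13 * h)) (13 * h) ×ˢ Set.Icc (-D) D)
      (measurableSet_redSlice s o (discConst s * Y ^ 2) a)
      (measurableSet_Icc.prod measurableSet_Icc)
      (by
        rw [Measure.volume_eq_prod, Measure.prod_prod, Real.volume_Icc, Real.volume_Icc]
        exact ENNReal.mul_ne_top ENNReal.ofReal_ne_top ENNReal.ofReal_ne_top)
      (fun z hz => by
        obtain ⟨hb, -, hd, hc⟩ := hbd _ _ _ hz
        rw [abs_le] at hb hc hd
        have hrM : 15 * r < M := by nlinarith
        exact ⟨⟨by linarith, by linarith⟩, hc, hd⟩)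
      (fun y => by
        have := stepSet_redRegion s o (discConst s * Y ^ 2) ((a : ℝ), 0, y) (0, 1, 0)
        convert this using 3 with t
        simp [redSlice])
    refine this.trans (le_of_eq ?_)
    rw [Measure.volume_eq_prod, measureReal_prod_prod, Real.volume_real_Icc_of_le (by linarith),
      Real.volume_real_Icc_of_le (by linarith)]
    push_cast
    ring
  set N : ℤ → ℝ := fun b => ∑ c ∈ Finset.Ico (-(M : ℤ)) M, ∑ d ∈ Finset.Ico (-(M : ℤ)) M,
      (if castF (a, b, c, d) ∈ R ∧ (m : ℤ) ∣ a * x ^ 3 + b * x ^ 2 + c * x + d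
        then (1 : ℝ) else 0) with hN
  set V := volume.real (redSlice s o (discConst s * Y ^ 2) a)
  have hsplit : ∑ b ∈ Finset.Ico (-(M : ℤ)) M, N b - V / m =
      ∑ b ∈ Finset.Ico (-(M : ℤ)) M, (N b - volume.real (R2 b) / m) +
        (∑ b ∈ Finset.Ico (-(M : ℤ)) M, volume.real (R2 b) - V) / m := by
    rw [Finset.sum_sub_distrib, ← Finset.sum_div]
    ring
  rw [hsplit]
  have b1 : |∑ b ∈ Finset.Ico (-(M : ℤ)) M, (N b - volume.real (R2 b) / m)| ≤
      (2 * (15 * r) + 1) * (14 * (16 * D / M1 + 1)) := by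
    refine (Finset.abs_sum_le_sum_abs _ _).trans
      ((Finset.sum_le_sum fun b _ => step1 b).trans ?_)
    rw [← Finset.sum_filter, Finset.sum_const, nsmul_eq_mul]
    have := card_filter_abs_le (Finset.Ico (-(M : ℤ)) M) (T := 15 * r) (by positivity)
    gcongr
  have b2 : |(∑ b ∈ Finset.Ico (-(M : ℤ)) M, volume.real (R2 b) - V) / m| ≤
      14 * (4 * (13 * h) * D) / M1 := by
    rw [abs_div, abs_of_pos hm']
    gcongr
  have hM0 : (0 : ℝ) < M1 := by linarith
  calc _ ≤ (2 * (15 * r) + 1) * (14 * (16 * D / M1 + 1)) + 14 * (4 * (13 * h) * D) / M1 :=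
        (abs_add_le _ _).trans (add_le_add b1 b2)
    _ ≤ (34 * r) * (14 * (16 * D / M1 + 1)) + 14 * (4 * (13 * h) * D) / M1 := by
        gcongr; linarith
    _ = 7616 * (r * (D / M1)) + 476 * r + 728 * (h * (D / M1)) := by ring
    _ ≤ 7616 * (2 * h * (D / M1)) + 476 * r + 728 * (h * (D / M1)) := by gcongr
    _ = 3192000 * (h * (Y / A) / M1) + 476 * r := by rw [hD]; ring
    _ ≤ 4000000 * (h * (Y / A) / M1 + r) := by
        have : 0 ≤ h * (Y / A) / M1 := by positivity
        nlinarith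

/-! ### The volume of the slices: change of variables -/

/-- The linear map of `ℝ³` with given rows. -/
noncomputable def rowsCLM (r₁ r₂ r₃ : ℝ × ℝ × ℝ) : (ℝ × ℝ × ℝ) →L[ℝ] (ℝ × ℝ × ℝ) :=
  let row := fun r : ℝ × ℝ × ℝ => r.1 • ContinuousLinearMap.fst ℝ ℝ (ℝ × ℝ) +
    r.2.1 • (ContinuousLinearMap.fst ℝ ℝ ℝ).comp (ContinuousLinearMap.snd ℝ ℝ (ℝ × ℝ)) +
    r.2.2 • (ContinuousLinearMap.snd ℝ ℝ ℝ).comp (ContinuousLinearMap.snd ℝ ℝ (ℝ × ℝ))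
  (row r₁).prod ((row r₂).prod (row r₃))

theorem rowsCLM_apply (r₁ r₂ r₃ z : ℝ × ℝ × ℝ) : rowsCLM r₁ r₂ r₃ z =
    (r₁.1 * z.1 + r₁.2.1 * z.2.1 + r₁.2.2 * z.2.2, r₂.1 * z.1 + r₂.2.1 * z.2.1 + r₂.2.2 * z.2.2,
      r₃.1 * z.1 + r₃.2.1 * z.2.1 + r₃.2.2 * z.2.2) := by
  simp [rowsCLM]

/-- `ℝ × ℝ × ℝ` in coordinates. -/
def prodEquivFun : (ℝ × ℝ × ℝ) ≃ₗ[ℝ] (Fin 3 → ℝ) where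
  toFun z := ![z.1, z.2.1, z.2.2]
  invFun w := (w 0, w 1, w 2)
  map_add' z w := by ext i; fin_cases i <;> simp
  map_smul' c z := by ext i; fin_cases i <;> simp
  left_inv z := by simp
  right_inv w := by ext i; fin_cases i <;> simp

theorem det_rowsCLM (r₁ r₂ r₃ : ℝ × ℝ × ℝ) : (rowsCLM r₁ r₂ r₃).det =
    r₁.1 * (r₂.2.1 * r₃.2.2 - r₂.2.2 * r₃.2.1) - r₁.2.1 * (r₂.1 * r₃.2.2 - r₂.2.2 * r₃.1) +
      r₁.2.2 * (r₂.1 * r₃.2.1 - r₂.2.1 * r₃.1) := by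
  set f : (ℝ × ℝ × ℝ) →ₗ[ℝ] (ℝ × ℝ × ℝ) := (rowsCLM r₁ r₂ r₃ : (ℝ × ℝ × ℝ) →ₗ[ℝ] (ℝ × ℝ × ℝ))
    with hf
  have h : (rowsCLM r₁ r₂ r₃).det = LinearMap.det f := rfl
  have hfa : ∀ z, f z = rowsCLM r₁ r₂ r₃ z := fun _ => rfl
  rw [h, ← LinearMap.det_toMatrix (Module.Basis.ofEquivFun prodEquivFun), Matrix.det_fin_three]
  simp only [LinearMap.toMatrix_apply, hfa, rowsCLM_apply]
  simp [prodEquivFun]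
  ring

/-- The last three coefficients of `paramForm s p q u v`. -/
def paramTail (s : Bool) (p : ℝ) (z : ℝ × ℝ × ℝ) : ℝ × ℝ × ℝ := (paramForm s p z.1 z.2.1 z.2.2).2

theorem paramForm_fst (s : Bool) (p q u v : ℝ) : (paramForm s p q u v).1 = p := by
  cases s <;> rfl

theorem paramForm_eq (s : Bool) (p q u v : ℝ) :
    paramForm s p q u v = (p, paramTail s p (q, u, v)) := by
  cases s <;> rfl

/-- The Jacobian constant of the parametrization. -/
def jacConst (s : Bool) : ℝ := bif s then 36 else 4

theorem exists_hasFDerivAt_paramTail (s : Bool) (p : ℝ) (z : ℝ × ℝ × ℝ) :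
    ∃ L : (ℝ × ℝ × ℝ) →L[ℝ] (ℝ × ℝ × ℝ), HasFDerivAt (paramTail s p) L z ∧
      |L.det| = jacConst s * (z.2.2 ^ 4 * (p ^ 2 + z.1 ^ 2)) := by
  obtain ⟨q, u, v⟩ := z
  have hq : HasFDerivAt (fun z : ℝ × ℝ × ℝ => z.1) (ContinuousLinearMap.fst ℝ ℝ (ℝ × ℝ)) (q, u, v) :=
    hasFDerivAt_fst
  have hs : HasFDerivAt (fun z : ℝ × ℝ × ℝ => z.2) (ContinuousLinearMap.snd ℝ ℝ (ℝ × ℝ)) (q, u, v) :=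
    hasFDerivAt_snd
  have hu := hs.fst
  have hv := hs.snd
  cases s
  · refine ⟨rowsCLM (v, -3 * p, q) (-2 * u * v, 6 * u * p - 2 * v * q, -2 * u * q + 2 * v * p)
      (u ^ 2 * v + v ^ 3, -3 * u ^ 2 * p + 2 * u * v * q - v ^ 2 * p,
        u ^ 2 * q - 2 * u * v * p + 3 * v ^ 2 * q), ?_, ?_⟩
    · have h1 := ((hu.const_mul (-3)).mul_const p).add (hq.mul hv)
      have h2 := ((((hu.pow 2).const_mul 3).mul_const p).sub (((hu.const_mul 2).mul hv).mul hq)).add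
        ((hv.pow 2).mul_const p)
      have h3 := ((((hu.pow 3).neg.mul_const p).add (((hu.pow 2).mul hv).mul hq)).sub
        ((hu.mul (hv.pow 2)).mul_const p)).add ((hv.pow 3).mul hq)
      have h := h1.prodMk (h2.prodMk h3)
      refine HasFDerivAt.congr_fderiv h ?_
      refine ContinuousLinearMap.ext fun w => ?_
      rw [rowsCLM_apply]
      simp
      refine ⟨?_, ?_, ?_⟩ <;> ring
    · rw [det_rowsCLM]
      rw [show jacConst false * (v ^ 4 * (p ^ 2 + q ^ 2)) = |-(4 * (v ^ 4 * (p ^ 2 + q ^ 2)))| by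
        rw [abs_neg, abs_of_nonneg (by positivity), jacConst, cond_false]]
      congr 1
      ring
  · refine ⟨rowsCLM (3 * v, -3 * p, 3 * q)
      (-6 * u * v, 6 * u * p - 6 * v * q, -6 * u * q - 6 * v * p)
      (3 * u ^ 2 * v - v ^ 3, -3 * u ^ 2 * p + 6 * u * v * q + 3 * v ^ 2 * p,
        3 * u ^ 2 * q + 6 * u * v * p - 3 * v ^ 2 * q), ?_, ?_⟩
    · have h1 := ((hu.const_mul (-3)).mul_const p).add ((hq.const_mul 3).mul hv)
      have h2 := ((((hu.pow 2).const_mul 3).mul_const p).sub (((hu.const_mul 6).mul hv).mul hq)).sub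
        (((hv.pow 2).const_mul 3).mul_const p)
      have h3 := ((((hu.pow 3).neg.mul_const p).add ((((hu.pow 2).const_mul 3).mul hv).mul hq)).add
        (((hu.const_mul 3).mul (hv.pow 2)).mul_const p)).sub ((hv.pow 3).mul hq)
      have h := h1.prodMk (h2.prodMk h3)
      refine HasFDerivAt.congr_fderiv h ?_
      refine ContinuousLinearMap.ext fun w => ?_
      rw [rowsCLM_apply]
      simp
      refine ⟨?_, ?_, ?_⟩ <;> ring
    · rw [det_rowsCLM]
      rw [show jacConst true * (v ^ 4 * (p ^ 2 + q ^ 2)) = |36 * (v ^ 4 * (p ^ 2 + q ^ 2))| by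
        rw [abs_of_nonneg (by positivity), jacConst, cond_true]]
      congr 1
      ring

theorem measurableSet_halfDom (o : Bool) : MeasurableSet (halfDom o) := by
  have h : halfDom o = {z | 0 < z.2} ∩ ⋂ i, {z | posB o (halfDomG i z.1 z.2)} := by
    ext z
    simp [halfDom]
  rw [h]
  refine (measurableSet_lt measurable_const measurable_snd).inter (MeasurableSet.iInter fun i => ?_)
  have : Measurable fun z : ℝ × ℝ => halfDomG i z.1 z.2 := by
    fin_cases i <;> simp [halfDomG] <;> fun_prop
  exact this (measurableSet_posB o)

/-- Parameters of the reduced forms with given leading coefficient. -/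
def paramDom (o : Bool) (Y a : ℝ) : Set (ℝ × ℝ × ℝ) :=
  {z | z.2 ∈ halfDom o ∧ (a ^ 2 + z.1 ^ 2) * z.2.2 ^ 3 < Y}

theorem measurableSet_paramDom (o : Bool) (Y a : ℝ) : MeasurableSet (paramDom o Y a) :=
  (measurable_snd (measurableSet_halfDom o)).inter
    (measurableSet_lt (f := fun z : ℝ × ℝ × ℝ => (a ^ 2 + z.1 ^ 2) * z.2.2 ^ 3) (by fun_prop)
      measurable_const)

theorem paramTail_image {s o : Bool} {Y a : ℝ} (hY : 0 < Y) (ha : a ≠ 0) :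
    paramTail s a '' paramDom o Y a = redSlice s o (discConst s * Y ^ 2) a := by
  have key : ∀ q u v : ℝ, 0 < v → ((a, paramTail s a (q, u, v)) ∈
      redRegion s o (discConst s * Y ^ 2) ↔ (q, u, v) ∈ paramDom o Y a) := by
    intro q u v hv
    rw [← paramForm_eq, paramForm_mem_redRegion ha hv, paramDom, Set.mem_ofPred_eq,
      mul_lt_mul_iff_right₀ (discConst_pos s), pow_lt_pow_iff_left₀ (by positivity) hY.le two_ne_zero]
  ext y
  constructor
  · rintro ⟨⟨q, u, v⟩, hz, rfl⟩
    exact (key q u v hz.1.1).2 hz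
  · intro hy
    obtain ⟨p, q, u, v, hv, h⟩ := exists_paramForm (s := s) (f := (a, y)) ha hy.2.1
    obtain rfl : a = p := by
      have := congrArg Prod.fst h
      rwa [paramForm_fst] at this
    have h2 : y = paramTail s a (q, u, v) := congrArg Prod.snd h
    subst h2
    exact ⟨(q, u, v), (key q u v hv).1 hy, rfl⟩

open MeasureTheory in
theorem volume_redSlice_eq {s o : Bool} {Y a : ℝ} (hY : 0 < Y) (ha : a ≠ 0) :
    volume (redSlice s o (discConst s * Y ^ 2) a) =
      ∫⁻ z in paramDom o Y a, ENNReal.ofReal (jacConst s * (z.2.2 ^ 4 * (a ^ 2 + z.1 ^ 2))) := by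
  choose L hL hdet using fun z => exists_hasFDerivAt_paramTail s a z
  have hinj : Set.InjOn (paramTail s a) (paramDom o Y a) := by
    rintro ⟨q, u, v⟩ hz ⟨q', u', v'⟩ hz' h
    have : paramForm s a q u v = paramForm s a q' u' v' := by rw [paramForm_eq, paramForm_eq, h]
    obtain ⟨-, rfl, rfl, rfl⟩ := paramForm_unique ha hz.1.1 hz'.1.1 this
    rfl
  have : (volume : Measure (ℝ × ℝ)).IsAddHaarMeasure :=
    inferInstanceAs ((volume : Measure ℝ).prod (volume : Measure ℝ)).IsAddHaarMeasure
  have : (volume : Measure (ℝ × ℝ × ℝ)).IsAddHaarMeasure :=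
    inferInstanceAs ((volume : Measure ℝ).prod (volume : Measure (ℝ × ℝ))).IsAddHaarMeasure
  rw [← paramTail_image hY ha, ← lintegral_abs_det_fderiv_eq_addHaar_image volume
    (measurableSet_paramDom o Y a) (fun z _ => (hL z).hasFDerivWithinAt) hinj]
  simp only [hdet]

/-! ### Integrals over the fundamental domain -/

theorem volume_disc (K : ℝ) :
    volume {z : ℝ × ℝ | z.1 ^ 2 + z.2 ^ 2 < K} = ENNReal.ofReal (π * max K 0) := by
  rcases le_or_gt K 0 with hK | hK
  · rw [max_eq_right hK, mul_zero, ENNReal.ofReal_zero]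
    convert measure_empty (μ := (volume : Measure (ℝ × ℝ)))
    ext z
    simp only [Set.mem_ofPred_eq, Set.mem_empty_iff_false, iff_false, not_lt]
    nlinarith [sq_nonneg z.1, sq_nonneg z.2]
  · have h := Complex.volume_preserving_equiv_real_prod.symm.measure_preimage_equiv
      (Metric.ball (0 : ℂ) (√K))
    rw [Complex.volume_ball] at h
    have h2 : (Complex.measurableEquivRealProd.symm ⁻¹' Metric.ball (0 : ℂ) (√K)) =
        {z : ℝ × ℝ | z.1 ^ 2 + z.2 ^ 2 < K} := by
      ext z
      have h1 : ‖Complex.measurableEquivRealProd.symm z‖ ^ 2 = z.1 ^ 2 + z.2 ^ 2 := by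
        rw [← Complex.normSq_eq_norm_sq, Complex.normSq_apply,
          Complex.measurableEquivRealProd_symm_apply]
        ring
      rw [Set.mem_preimage, Metric.mem_ball, dist_zero_right, Real.lt_sqrt (norm_nonneg _), h1]
      rfl
    rw [h2] at h
    rw [h, max_eq_left hK.le, ← ENNReal.ofReal_pow (Real.sqrt_nonneg _), Real.sq_sqrt hK.le,
      mul_comm, ENNReal.ofReal_mul Real.pi_pos.le]
    congr 1
    rw [← NNReal.coe_real_pi, ENNReal.ofReal_coe_nnreal]

/-- A nonnegative weight, antitone in `t` and supported on `t < K`. -/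
structure IsWeight (w : ℝ → ℝ → ℝ) : Prop where
  measurable : Measurable (Function.uncurry w)
  nonneg : ∀ K t, 0 < K → 0 ≤ w K t
  anti : ∀ K, 0 < K → Antitone (w K)
  le : ∀ K t, 0 < K → 0 ≤ t → w K t ≤ K
  eq_zero : ∀ K t, K ≤ t → w K t = 0

theorem isWeight_ite : IsWeight fun K t => if t < K then K else 0 where
  measurable := Measurable.ite (measurableSet_lt measurable_snd measurable_fst) measurable_fst
    measurable_const
  nonneg K t hK := by split_ifs <;> linarith
  anti K hK x y hxy := by
    dsimp only
    split_ifs <;> linarith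
  le K t hK _ := by split_ifs <;> linarith
  eq_zero K t h := if_neg (not_lt.2 h)

theorem isWeight_max : IsWeight fun K t => max (K - t) 0 where
  measurable := by unfold Function.uncurry; fun_prop
  nonneg K t _ := le_max_right _ _
  anti K _ x y hxy := max_le_max (by linarith) le_rfl
  le K t hK ht := max_le (by linarith) hK.le
  eq_zero K t h := max_eq_right (by linarith)

theorem lintegral_planar_ite {K : ℝ} (hK : 0 < K) :
    ∫⁻ z : ℝ × ℝ, ENNReal.ofReal (if z.1 ^ 2 + z.2 ^ 2 < K then K else 0) =
      ENNReal.ofReal (π * K ^ 2) := by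
  have hm : MeasurableSet {z : ℝ × ℝ | z.1 ^ 2 + z.2 ^ 2 < K} :=
    measurableSet_lt (f := fun z : ℝ × ℝ => z.1 ^ 2 + z.2 ^ 2) (by fun_prop) measurable_const
  have h : (fun z : ℝ × ℝ => ENNReal.ofReal (if z.1 ^ 2 + z.2 ^ 2 < K then K else 0)) =
      {z : ℝ × ℝ | z.1 ^ 2 + z.2 ^ 2 < K}.indicator fun _ => ENNReal.ofReal K := by
    ext z
    by_cases hz : z.1 ^ 2 + z.2 ^ 2 < K <;> simp [Set.indicator, hz]
  rw [h, lintegral_indicator_const hm, volume_disc, max_eq_left hK.le, ← ENNReal.ofReal_mul hK.le]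
  congr 1
  ring

theorem lintegral_planar_max {K : ℝ} (hK : 0 < K) :
    ∫⁻ z : ℝ × ℝ, ENNReal.ofReal (max (K - (z.1 ^ 2 + z.2 ^ 2)) 0) =
      ENNReal.ofReal (π / 2 * K ^ 2) := by
  rw [lintegral_eq_lintegral_meas_lt volume
    (f := fun z : ℝ × ℝ => max (K - (z.1 ^ 2 + z.2 ^ 2)) 0)
    (ae_of_all _ fun z => le_max_right _ _) (by fun_prop)]
  have h : ∀ t ∈ Set.Ioi (0 : ℝ), volume {z : ℝ × ℝ | t < max (K - (z.1 ^ 2 + z.2 ^ 2)) 0} =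
      (Set.Ioc 0 K).indicator (fun t => ENNReal.ofReal (π * (K - t))) t := by
    intro t ht
    have ht0 : 0 < t := ht
    have : {z : ℝ × ℝ | t < max (K - (z.1 ^ 2 + z.2 ^ 2)) 0} =
        {z : ℝ × ℝ | z.1 ^ 2 + z.2 ^ 2 < K - t} := by
      ext z
      simp only [Set.mem_ofPred_eq, lt_max_iff, not_lt.2 ht0.le, or_false]
      constructor <;> intro h <;> linarith
    rw [this, volume_disc]
    by_cases htK : t ≤ K
    · rw [Set.indicator_of_mem (show t ∈ Set.Ioc 0 K from ⟨ht0, htK⟩), max_eq_left (by linarith)]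
    · rw [Set.indicator_of_notMem (fun h => htK h.2), max_eq_right (by linarith), mul_zero,
        ENNReal.ofReal_zero]
  rw [setLIntegral_congr_fun measurableSet_Ioi h, lintegral_indicator measurableSet_Ioc,
    Measure.restrict_restrict measurableSet_Ioc,
    Set.inter_eq_left.2 (show Set.Ioc 0 K ⊆ Set.Ioi 0 from fun t ht => ht.1),
    ← ofReal_integral_eq_lintegral_ofReal, ← intervalIntegral.integral_of_le hK.le]
  · congr 1
    rw [intervalIntegral.integral_const_mul, intervalIntegral.integral_sub (by simp) (by simp),
      integral_id, intervalIntegral.integral_const]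
    simp
    ring
  · exact (Continuous.integrableOn_Icc (by fun_prop)).mono_set Set.Ioc_subset_Icc_self
  · refine (ae_restrict_iff' measurableSet_Ioc).2 (ae_of_all _ fun t ht => ?_)
    have := ht.2
    exact mul_nonneg Real.pi_pos.le (by linarith)

theorem integral_inv_sqrt_one_sub_sq : ∫ u in (0 : ℝ)..1 / 2, (√(1 - u ^ 2))⁻¹ = π / 6 := by
  have h : ∀ u ∈ Set.uIcc (0 : ℝ) (1 / 2), HasDerivAt arcsin ((√(1 - u ^ 2))⁻¹) u := by
    intro u hu
    rw [Set.uIcc_of_le (by norm_num)] at hu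
    have := hasDerivAt_arcsin (x := u) (by linarith [hu.1]) (by linarith [hu.2])
    simpa using this
  rw [intervalIntegral.integral_eq_sub_of_hasDerivAt h, arcsin_zero, sub_zero]
  · rw [← Real.sin_pi_div_six, arcsin_sin] <;> linarith [Real.pi_pos]
  · refine ContinuousOn.intervalIntegrable fun u hu => ?_
    rw [Set.uIcc_of_le (by norm_num)] at hu
    refine ContinuousAt.continuousWithinAt (ContinuousAt.inv₀ (by fun_prop) ?_)
    exact (Real.sqrt_pos.2 (by nlinarith [hu.1, hu.2])).ne'

theorem lintegral_Ioi_inv_sq {c : ℝ} (hc : 0 < c) :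
    ∫⁻ v in Set.Ioi c, ENNReal.ofReal ((v ^ 2)⁻¹) = ENNReal.ofReal c⁻¹ := by
  have h1 : ∀ v ∈ Set.Ioi c, (v ^ 2)⁻¹ = v ^ (-2 : ℝ) := by
    intro v hv
    have : 0 < v := hc.trans hv
    rw [Real.rpow_neg this.le]
    norm_num
  rw [setLIntegral_congr_fun measurableSet_Ioi (fun v hv => by rw [h1 v hv]),
    ← ofReal_integral_eq_lintegral_ofReal, integral_Ioi_rpow_of_lt (by norm_num) hc]
  · congr 1
    norm_num
    rw [Real.rpow_neg_one]
  · exact integrableOn_Ioi_rpow_of_lt (by norm_num) hc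
  · exact (ae_restrict_iff' measurableSet_Ioi).2 (ae_of_all _ fun v hv =>
      Real.rpow_nonneg (hc.trans hv).le _)

open Classical in
theorem halfDom_slice (o : Bool) {u : ℝ} :
    {v | (u, v) ∈ halfDom o} = if u ∈ (bif o then Set.Ioo 0 (1 / 2) else Set.Icc 0 (1 / 2) : Set ℝ)
      then (bif o then Set.Ioi √(1 - u ^ 2) else Set.Ici √(1 - u ^ 2)) else ∅ := by
  ext v
  cases o
  · simp only [halfDom, posB, cond_false, Set.mem_ofPred_eq, Fin.forall_fin_succ, halfDomG]
    simp
    constructor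
    · rintro ⟨hv, h1, h2, h3⟩
      exact ⟨⟨h1, by linarith⟩, Real.sqrt_le_iff.2 ⟨hv.le, by linarith⟩⟩
    · rintro ⟨⟨h1, h2⟩, hv⟩
      have h0 : 0 < √(1 - u ^ 2) := Real.sqrt_pos.2 (by nlinarith)
      have := (Real.sqrt_le_left (by linarith)).1 hv
      exact ⟨by linarith, h1, by linarith, by linarith⟩
  · simp only [halfDom, posB, cond_true, Set.mem_ofPred_eq, Fin.forall_fin_succ, halfDomG]
    simp
    constructor
    · rintro ⟨hv, h1, h2, h3⟩
      exact ⟨⟨h1, by linarith⟩, (Real.sqrt_lt' hv).2 (by linarith)⟩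
    · rintro ⟨⟨h1, h2⟩, hv⟩
      have h0 : 0 < √(1 - u ^ 2) := Real.sqrt_pos.2 (by nlinarith)
      have := (Real.sqrt_lt' (by linarith)).1 hv
      exact ⟨by linarith, h1, by linarith, by linarith⟩

theorem lintegral_halfDom_inv_sq (o : Bool) :
    ∫⁻ z in halfDom o, ENNReal.ofReal ((z.2 ^ 2)⁻¹) = ENNReal.ofReal (π / 6) := by
  set I : Set ℝ := bif o then Set.Ioo 0 (1 / 2) else Set.Icc 0 (1 / 2) with hI
  have hIm : MeasurableSet I := by cases o <;> simp [hI, measurableSet_Ioo, measurableSet_Icc]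
  have hIae : I =ᵐ[volume] Set.Ioc (0 : ℝ) (1 / 2) := by
    cases o
    · exact Ioc_ae_eq_Icc.symm
    · exact Ioo_ae_eq_Ioc
  have hpos : ∀ u ∈ Set.Ioc (0 : ℝ) (1 / 2), 0 < √(1 - u ^ 2) := fun u hu =>
    Real.sqrt_pos.2 (by nlinarith [hu.1, hu.2])
  rw [← lintegral_indicator (measurableSet_halfDom o), Measure.volume_eq_prod, lintegral_prod]
  · have h : ∀ u : ℝ, ∫⁻ v, (halfDom o).indicator (fun z => ENNReal.ofReal ((z.2 ^ 2)⁻¹)) (u, v) =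
        I.indicator (fun u => ENNReal.ofReal (√(1 - u ^ 2))⁻¹) u := by
      intro u
      have h1 : ∀ v, (halfDom o).indicator (fun z : ℝ × ℝ => ENNReal.ofReal ((z.2 ^ 2)⁻¹)) (u, v) =
          {v | (u, v) ∈ halfDom o}.indicator (fun v => ENNReal.ofReal ((v ^ 2)⁻¹)) v := fun v => rfl
      simp only [h1]
      have hsm : MeasurableSet {v | (u, v) ∈ halfDom o} :=
        measurable_prodMk_left (measurableSet_halfDom o)
      rw [lintegral_indicator hsm, halfDom_slice]
      by_cases hu : u ∈ I
      · rw [if_pos hu, Set.indicator_of_mem hu]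
        have hs : 0 < √(1 - u ^ 2) := by
          refine Real.sqrt_pos.2 ?_
          cases o <;> simp [hI] at hu <;> nlinarith [hu.1, hu.2]
        rw [← lintegral_Ioi_inv_sq hs]
        cases o
        · exact setLIntegral_congr Ioi_ae_eq_Ici.symm
        · rfl
      · rw [if_neg hu, Set.indicator_of_notMem hu]
        simp
    simp only [h]
    rw [lintegral_indicator hIm, setLIntegral_congr hIae, ← integral_inv_sqrt_one_sub_sq,
      intervalIntegral.integral_of_le (by norm_num), ofReal_integral_eq_lintegral_ofReal]
    · refine (ContinuousOn.integrableOn_Icc fun u hu => ?_).mono_set Set.Ioc_subset_Icc_self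
      refine ContinuousAt.continuousWithinAt (ContinuousAt.inv₀ (by fun_prop) ?_)
      exact (Real.sqrt_pos.2 (by nlinarith [hu.1, hu.2])).ne'
    · exact ae_of_all _ fun u => inv_nonneg.2 (Real.sqrt_nonneg _)
  · exact ((Measurable.ennreal_ofReal (by fun_prop)).indicator
      (measurableSet_halfDom o)).aemeasurable

theorem jacConst_pos (s : Bool) : 0 < jacConst s := by
  cases s <;> norm_num [jacConst]

theorem halfDom_bounds {o : Bool} {z : ℝ × ℝ} (hz : z ∈ halfDom o) :
    0 ≤ z.1 ∧ z.1 ≤ 1 / 2 ∧ 0 < z.2 ∧ 3 / 4 ≤ z.2 ^ 2 := by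
  obtain ⟨hv, h⟩ := hz
  have h0 := h 0
  have h1 := h 1
  have h2 := h 2
  cases o <;> simp [posB, halfDomG] at h0 h1 h2 <;>
    exact ⟨by linarith, by linarith, hv, by nlinarith⟩

/-- The integral over the fundamental domain of a weight, at height `a`. -/
noncomputable def layer (s : Bool) (o : Bool) (Y : ℝ) (w : ℝ → ℝ → ℝ) (a : ℝ) : ENNReal :=
  ∫⁻ z in halfDom o, ∫⁻ q : ℝ,
    ENNReal.ofReal (jacConst s * (z.2 ^ 4 * w (Y / z.2 ^ 3) (a ^ 2 + q ^ 2)))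

theorem layer_neg (s : Bool) (o : Bool) (Y : ℝ) (w : ℝ → ℝ → ℝ) (a : ℝ) :
    layer s o Y w (-a) = layer s o Y w a := by
  simp [layer]

section Layer

variable {s : Bool} {o : Bool} {Y : ℝ} {w : ℝ → ℝ → ℝ}

theorem measurable_layerFun (s : Bool) (Y : ℝ) (hw : Measurable (Function.uncurry w)) :
    Measurable fun x : ℝ × (ℝ × ℝ) × ℝ => ENNReal.ofReal
      (jacConst s * (x.2.1.2 ^ 4 * w (Y / x.2.1.2 ^ 3) (x.1 ^ 2 + x.2.2 ^ 2))) := by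
  refine Measurable.ennreal_ofReal (Measurable.const_mul (Measurable.mul (by fun_prop) ?_) _)
  exact hw.comp (f := fun x : ℝ × (ℝ × ℝ) × ℝ => (Y / x.2.1.2 ^ 3, x.1 ^ 2 + x.2.2 ^ 2))
    (by fun_prop)

theorem measurable_layerFun_right (s : Bool) (Y a : ℝ) (hw : Measurable (Function.uncurry w)) :
    Measurable fun x : (ℝ × ℝ) × ℝ => ENNReal.ofReal
      (jacConst s * (x.1.2 ^ 4 * w (Y / x.1.2 ^ 3) (a ^ 2 + x.2 ^ 2))) := by
  have := (measurable_layerFun s Y hw).comp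
    (f := fun x : (ℝ × ℝ) × ℝ => (a, x.1, x.2)) (by fun_prop)
  exact this

theorem layer_anti (hY : 0 < Y) (hw : IsWeight w) {a b : ℝ} (ha : 0 ≤ a) (hab : a ≤ b) :
    layer s o Y w b ≤ layer s o Y w a := by
  refine setLIntegral_mono' (measurableSet_halfDom o) fun z hz => lintegral_mono fun q => ?_
  have hv := (halfDom_bounds hz).2.2.1
  refine ENNReal.ofReal_le_ofReal (mul_le_mul_of_nonneg_left
    (mul_le_mul_of_nonneg_left ?_ (by positivity)) (jacConst_pos s).le)
  exact hw.anti _ (by positivity) (by nlinarith)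

theorem layer_eq_zero (hw : IsWeight w) {a : ℝ} (ha : 2 * Y ≤ a ^ 2) :
    layer s o Y w a = 0 := by
  unfold layer
  rw [setLIntegral_congr_fun (g := fun _ => 0) (measurableSet_halfDom o), lintegral_zero]
  intro z hz
  obtain ⟨-, -, hv, hv2⟩ := halfDom_bounds hz
  have hv3 : 1 / 2 ≤ z.2 ^ 3 := by nlinarith [sq_nonneg (z.2 - 3 / 4)]
  have h : ∀ q : ℝ, w (Y / z.2 ^ 3) (a ^ 2 + q ^ 2) = 0 := by
    intro q
    refine hw.eq_zero _ _ ?_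
    rw [div_le_iff₀ (by positivity)]
    nlinarith [sq_nonneg q, mul_nonneg (sq_nonneg q) (by positivity : 0 ≤ z.2 ^ 3),
      mul_le_mul_of_nonneg_left hv3 (sq_nonneg a)]
  simp [h]

theorem lintegral_weight_le (hw : IsWeight w) {K a : ℝ} (hK : 0 < K) :
    ∫⁻ q : ℝ, ENNReal.ofReal (w K (a ^ 2 + q ^ 2)) ≤
      if a ^ 2 < K then ENNReal.ofReal (2 * √K * K) else 0 := by
  have h : ∀ q : ℝ, ENNReal.ofReal (w K (a ^ 2 + q ^ 2)) ≤
      (Set.Ioo (-√K) √K).indicator (fun _ => if a ^ 2 < K then ENNReal.ofReal K else 0) q := by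
    intro q
    by_cases hq : a ^ 2 + q ^ 2 < K
    · rw [Set.indicator_of_mem, if_pos (by nlinarith [sq_nonneg q])]
      · exact ENNReal.ofReal_le_ofReal (hw.le _ _ hK (by positivity))
      · exact abs_lt.1 (Real.lt_sqrt (abs_nonneg q) |>.2 (by rw [sq_abs]; nlinarith [sq_nonneg a]))
    · rw [hw.eq_zero _ _ (not_lt.1 hq)]
      simp
  refine (lintegral_mono h).trans ?_
  rw [lintegral_indicator_const measurableSet_Ioo, Real.volume_Ioo]
  split_ifs
  · rw [← ENNReal.ofReal_mul hK.le]
    exact ENNReal.ofReal_le_ofReal (by linarith)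
  · simp

theorem layer_le (hY : 0 < Y) (hw : IsWeight w) {a : ℝ} (ha : 0 < a) :
    layer s o Y w a ≤
      ENNReal.ofReal (2 * jacConst s * Y ^ (5 / 3 : ℝ) * a ^ (-(1 / 3) : ℝ)) := by
  have hκ := jacConst_pos s
  set T : ℝ := (Y / a ^ 2) ^ (1 / 3 : ℝ) with hT
  have hT0 : 0 < T := by positivity
  have hT3 : T ^ 3 = Y / a ^ 2 := by
    rw [hT, ← Real.rpow_natCast, ← Real.rpow_mul (by positivity)]
    norm_num
  have h1 : ∀ z ∈ halfDom o, ∫⁻ q : ℝ,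
      ENNReal.ofReal (jacConst s * (z.2 ^ 4 * w (Y / z.2 ^ 3) (a ^ 2 + q ^ 2))) ≤
      (Set.Icc (0 : ℝ) (1 / 2) ×ˢ Set.Ioc 0 T).indicator
        (fun z => ENNReal.ofReal (2 * jacConst s * Y ^ (3 / 2 : ℝ) * z.2 ^ (-(1 / 2) : ℝ))) z := by
    intro z hz
    obtain ⟨hu0, hu1, hv, -⟩ := halfDom_bounds hz
    have hK : 0 < Y / z.2 ^ 3 := by positivity
    have h2 : ∀ q : ℝ, ENNReal.ofReal (jacConst s * (z.2 ^ 4 * w (Y / z.2 ^ 3) (a ^ 2 + q ^ 2))) =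
        ENNReal.ofReal (jacConst s * z.2 ^ 4) *
          ENNReal.ofReal (w (Y / z.2 ^ 3) (a ^ 2 + q ^ 2)) := fun q => by
      rw [← ENNReal.ofReal_mul (by positivity), mul_assoc]
    simp only [h2]
    rw [lintegral_const_mul' _ _ ENNReal.ofReal_ne_top]
    refine (mul_le_mul_right (lintegral_weight_le hw hK) _).trans ?_
    split_ifs with h3
    · rw [Set.indicator_of_mem, ← ENNReal.ofReal_mul (by positivity)]
      · refine ENNReal.ofReal_le_ofReal (le_of_eq ?_)
        have h4 : √(Y / z.2 ^ 3) = Y ^ (1 / 2 : ℝ) * z.2 ^ (-(3 / 2) : ℝ) := by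
          rw [Real.sqrt_eq_rpow, Real.div_rpow hY.le (by positivity), Real.rpow_neg hv.le,
            ← Real.rpow_natCast z.2 3, ← Real.rpow_mul hv.le]
          norm_num [div_eq_mul_inv]
        have h5 : Y ^ (3 / 2 : ℝ) = Y * Y ^ (1 / 2 : ℝ) := by
          rw [← Real.rpow_one_add' hY.le (by norm_num)]
          norm_num
        have h6 : z.2 ^ (-(1 / 2) : ℝ) = z.2 * z.2 ^ (-(3 / 2) : ℝ) := by
          rw [← Real.rpow_one_add' hv.le (by norm_num)]
          norm_num
        rw [h4, h5, h6]
        field_simp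
      · refine ⟨⟨hu0, hu1⟩, hv, ?_⟩
        rw [lt_div_iff₀ (by positivity)] at h3
        refine le_of_lt (lt_of_pow_lt_pow_left₀ 3 hT0.le ?_)
        rw [hT3, lt_div_iff₀ (by positivity)]
        linarith
    · simp
  have hm : MeasurableSet (Set.Icc (0 : ℝ) (1 / 2) ×ˢ Set.Ioc 0 T) :=
    measurableSet_Icc.prod measurableSet_Ioc
  refine (setLIntegral_mono' (measurableSet_halfDom o) h1).trans ((setLIntegral_le_lintegral _ _).trans ?_)
  rw [lintegral_indicator hm, Measure.volume_eq_prod, ← Measure.prod_restrict, lintegral_prod]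
  · simp only [lintegral_const, Measure.restrict_apply_univ, Real.volume_Icc]
    rw [← ofReal_integral_eq_lintegral_ofReal, ← intervalIntegral.integral_of_le hT0.le,
      intervalIntegral.integral_const_mul, integral_rpow (by norm_num),
      ← ENNReal.ofReal_mul']
    · refine ENNReal.ofReal_le_ofReal (le_of_eq ?_)
      have h7 : T ^ (1 / 2 : ℝ) = Y ^ (1 / 6 : ℝ) * a ^ (-(1 / 3) : ℝ) := by
        rw [hT, ← Real.rpow_mul (by positivity), Real.div_rpow hY.le (by positivity),
          ← Real.rpow_natCast a 2, ← Real.rpow_mul ha.le, Real.rpow_neg ha.le]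
        norm_num [div_eq_mul_inv]
      have h8 : Y ^ (5 / 3 : ℝ) = Y ^ (3 / 2 : ℝ) * Y ^ (1 / 6 : ℝ) := by
        rw [← Real.rpow_add hY]
        norm_num
      rw [h8, show (-(1 / 2) : ℝ) + 1 = 1 / 2 by norm_num, Real.zero_rpow (by norm_num), h7]
      ring
    · norm_num
    · exact (((intervalIntegrable_iff_integrableOn_Ioc_of_le hT0.le).1
        (intervalIntegral.intervalIntegrable_rpow' (by norm_num))).const_mul _)
    · refine (ae_restrict_iff' measurableSet_Ioc).2 (ae_of_all _ fun v hv => ?_)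
      have := hv.1
      positivity
  · exact (Measurable.ennreal_ofReal (by fun_prop)).aemeasurable

theorem lintegral_layer (hY : 0 < Y) (hw : IsWeight w) {c : ℝ} (hc : 0 ≤ c)
    (h : ∀ K, 0 < K → ∫⁻ z : ℝ × ℝ, ENNReal.ofReal (w K (z.1 ^ 2 + z.2 ^ 2)) =
      ENNReal.ofReal (c * K ^ 2)) :
    ∫⁻ a, layer s o Y w a = ENNReal.ofReal (jacConst s * c * Y ^ 2 * (π / 6)) := by
  have hκ := jacConst_pos s
  unfold layer
  rw [lintegral_lintegral_swap]
  · have h1 : ∀ z ∈ halfDom o, ∫⁻ a, ∫⁻ q : ℝ,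
        ENNReal.ofReal (jacConst s * (z.2 ^ 4 * w (Y / z.2 ^ 3) (a ^ 2 + q ^ 2))) =
        ENNReal.ofReal (jacConst s * c * Y ^ 2) * ENNReal.ofReal ((z.2 ^ 2)⁻¹) := by
      intro z hz
      have hv := (halfDom_bounds hz).2.2.1
      have h2 : ∀ a q : ℝ, ENNReal.ofReal
          (jacConst s * (z.2 ^ 4 * w (Y / z.2 ^ 3) (a ^ 2 + q ^ 2))) =
          ENNReal.ofReal (jacConst s * z.2 ^ 4) *
          ENNReal.ofReal (w (Y / z.2 ^ 3) (a ^ 2 + q ^ 2)) := fun a q => by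
        rw [← ENNReal.ofReal_mul (by positivity), mul_assoc]
      simp only [h2, lintegral_const_mul' _ _ ENNReal.ofReal_ne_top]
      have h3 := h (Y / z.2 ^ 3) (by positivity)
      rw [Measure.volume_eq_prod, lintegral_prod] at h3
      · rw [h3, ← ENNReal.ofReal_mul (by positivity), ← ENNReal.ofReal_mul (by positivity)]
        congr 1
        field_simp
      · exact ((hw.measurable.comp (f := fun z' : ℝ × ℝ => (Y / z.2 ^ 3, z'.1 ^ 2 + z'.2 ^ 2))
          (by fun_prop)).ennreal_ofReal).aemeasurable
    rw [setLIntegral_congr_fun (measurableSet_halfDom o) h1,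
      lintegral_const_mul' _ _ ENNReal.ofReal_ne_top, lintegral_halfDom_inv_sq,
      ← ENNReal.ofReal_mul (by positivity)]
  · refine Measurable.aemeasurable ?_
    have := (measurable_layerFun s Y hw.measurable).comp
      (f := fun x : (ℝ × (ℝ × ℝ)) × ℝ => (x.1.1, x.1.2, x.2)) (by fun_prop)
    exact this.lintegral_prod_right'

end Layer

theorem volume_redSlice_add_layer {s o : Bool} {Y a : ℝ} (hY : 0 < Y) (ha : a ≠ 0) :
    volume (redSlice s o (discConst s * Y ^ 2) a) + layer s o Y (fun K t => max (K - t) 0) a =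
      layer s o Y (fun K t => if t < K then K else 0) a := by
  have hκ := jacConst_pos s
  have hw : Measurable (Function.uncurry fun K t : ℝ => if t < K then t else 0) :=
    Measurable.ite (measurableSet_lt measurable_snd measurable_fst) measurable_snd
      measurable_const
  have h1 : volume (redSlice s o (discConst s * Y ^ 2) a) =
      layer s o Y (fun K t => if t < K then t else 0) a := by
    rw [volume_redSlice_eq hY ha, ← lintegral_indicator (measurableSet_paramDom o Y a),
      Measure.volume_eq_prod, lintegral_prod_symm]
    · unfold layer
      rw [← lintegral_indicator (measurableSet_halfDom o)]
      refine lintegral_congr fun z => ?_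
      by_cases hz : z ∈ halfDom o
      · rw [Set.indicator_of_mem hz]
        refine lintegral_congr fun q => ?_
        have hv := (halfDom_bounds hz).2.2.1
        have : (q, z) ∈ paramDom o Y a ↔ a ^ 2 + q ^ 2 < Y / z.2 ^ 3 := by
          rw [lt_div_iff₀ (by positivity)]
          exact and_iff_right hz
        by_cases h : a ^ 2 + q ^ 2 < Y / z.2 ^ 3
        · rw [Set.indicator_of_mem (this.2 h)]
          simp [h]
        · rw [Set.indicator_of_notMem (fun h' => h (this.1 h'))]
          simp [h]
      · rw [Set.indicator_of_notMem hz]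
        have : ∀ q, (q, z) ∉ paramDom o Y a := fun q hq => hz hq.1
        simp [this]
    · exact ((Measurable.ennreal_ofReal (by fun_prop)).indicator
        (measurableSet_paramDom o Y a)).aemeasurable
  rw [h1]
  unfold layer
  rw [← lintegral_add_left]
  · refine setLIntegral_congr_fun (measurableSet_halfDom o) fun z hz => ?_
    have hv := (halfDom_bounds hz).2.2.1
    dsimp only
    rw [← lintegral_add_left]
    · refine lintegral_congr fun q => ?_
      rw [← ENNReal.ofReal_add]
      · congr 1
        split_ifs with h
        · rw [max_eq_left (by linarith)]
          ring
        · rw [max_eq_right (by linarith)]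
          ring
      · split_ifs <;> positivity
      · have := le_max_right (Y / z.2 ^ 3 - (a ^ 2 + q ^ 2)) 0
        positivity
    · exact (measurable_layerFun_right s Y a hw).comp (f := fun q : ℝ => (z, q)) (by fun_prop)
  · exact (measurable_layerFun_right s Y a hw).lintegral_prod_right'

/-- Comparing the sum of an antitone function along an arithmetic progression with its integral. -/
theorem abs_sum_sub_integral_le {A : ℝ → ℝ} {B I e : ℝ} {N : ℕ} (he : 0 < e)
    (hA : AntitoneOn A (Set.Ioi 0)) (h0 : ∀ t, 0 < t → 0 ≤ A t)
    (hB : ∀ t, 0 < t → A t ≤ B * t ^ (-(1 / 3) : ℝ)) (hN : ∀ t, e * N ≤ t → A t = 0)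
    (hi : IntegrableOn A (Set.Ioi 0)) (hI : ∫ t in Set.Ioi 0, A t = I) :
    |∑ k ∈ Finset.range N, A (e * (k + 1)) - I / e| ≤ 3 / 2 * B * e ^ (-(1 / 3) : ℝ) := by
  have hii : ∀ x y : ℝ, 0 ≤ x → x ≤ y → IntervalIntegrable A volume x y := fun x y hx hxy =>
    (intervalIntegrable_iff_integrableOn_Ioc_of_le hxy).2
      (hi.mono_set fun t ht => hx.trans_lt ht.1)
  have hend : ∫ t in (0 : ℝ)..e * N, A t = I := by
    rw [intervalIntegral.integral_of_le (by positivity), ← hI]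
    refine (setIntegral_eq_of_subset_of_forall_sdiff_eq_zero measurableSet_Ioi
      (fun t ht => ht.1) fun t ht => ?_).symm
    refine hN t (le_of_lt ?_)
    by_contra h
    exact ht.2 ⟨ht.1, not_lt.1 h⟩
  have hup : e * ∑ k ∈ Finset.range N, A (e * (k + 1)) ≤ I := by
    have h := intervalIntegral.sum_integral_adjacent_intervals (f := A) (μ := volume)
      (a := fun k : ℕ => e * k) (n := N) fun k _ => hii _ _ (by positivity) (by
        push_cast
        nlinarith)
    simp only [Nat.cast_zero, mul_zero] at h
    rw [← hend, ← h, Finset.mul_sum]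
    refine Finset.sum_le_sum fun k _ => ?_
    have hle : e * (k : ℝ) ≤ e * (k + 1 : ℕ) := by push_cast; nlinarith
    have hc : ∫ _t in e * (k : ℝ)..e * (k + 1 : ℕ), A (e * (k + 1)) = e * A (e * (k + 1)) := by
      rw [intervalIntegral.integral_const, smul_eq_mul]
      push_cast
      ring
    rw [← hc]
    refine intervalIntegral.integral_mono_on_of_le_Ioo hle (by simp)
      (hii _ _ (by positivity) hle) fun t ht => ?_
    have ht0 : 0 < t := lt_of_le_of_lt (by positivity) ht.1
    have := ht.2.le
    push_cast at this
    exact hA ht0 (ht0.trans_le this) this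
  have hlow : ∫ t in e..e * (N + 1), A t ≤ e * ∑ k ∈ Finset.range N, A (e * (k + 1)) := by
    have h := intervalIntegral.sum_integral_adjacent_intervals (f := A) (μ := volume)
      (a := fun k : ℕ => e * (k + 1)) (n := N) fun k _ => hii _ _ (by positivity) (by
        push_cast
        nlinarith)
    simp only [Nat.cast_zero, zero_add, mul_one] at h
    rw [← h, Finset.mul_sum]
    refine Finset.sum_le_sum fun k _ => ?_
    have hle : e * ((k : ℝ) + 1) ≤ e * ((k + 1 : ℕ) + 1) := by push_cast; nlinarith
    have hc : ∫ _t in e * ((k : ℝ) + 1)..e * ((k + 1 : ℕ) + 1), A (e * (k + 1)) =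
        e * A (e * (k + 1)) := by
      rw [intervalIntegral.integral_const, smul_eq_mul]
      push_cast
      ring
    rw [← hc]
    refine intervalIntegral.integral_mono_on hle (hii _ _ (by positivity) hle) (by simp)
      fun t ht => ?_
    have ht0 : 0 < e * ((k : ℝ) + 1) := by positivity
    exact hA ht0 (ht0.trans_le ht.1) ht.1
  have hfirst : ∫ t in (0 : ℝ)..e, A t ≤ 3 / 2 * B * e ^ (2 / 3 : ℝ) := by
    have hc : ∫ t in (0 : ℝ)..e, B * t ^ (-(1 / 3) : ℝ) = 3 / 2 * B * e ^ (2 / 3 : ℝ) := by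
      rw [intervalIntegral.integral_const_mul, integral_rpow (by norm_num)]
      norm_num
      ring
    rw [← hc]
    refine intervalIntegral.integral_mono_on_of_le_Ioo he.le (hii _ _ le_rfl he.le)
      ((intervalIntegral.intervalIntegrable_rpow' (by norm_num)).const_mul _) fun t ht => hB t ht.1
  have hlast : 0 = ∫ t in e * N..e * (N + 1), A t := by
    have hle : e * (N : ℝ) ≤ e * (N + 1) := by nlinarith
    rw [intervalIntegral.integral_congr (g := fun _ => 0)]
    · simp
    · intro t ht
      rw [Set.uIcc_of_le hle] at ht
      exact hN t ht.1
  have hle : e * (N : ℝ) ≤ e * (N + 1) := by nlinarith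
  have hsplit : ∫ t in (0 : ℝ)..e, A t = I - ∫ t in e..e * (N + 1), A t := by
    have h1 := intervalIntegral.integral_add_adjacent_intervals (hii 0 (e * N) le_rfl (by positivity))
      (hii _ _ (by positivity) hle)
    have h2 := intervalIntegral.integral_add_adjacent_intervals (hii 0 e le_rfl he.le)
      (hii e (e * (N + 1)) he.le (by nlinarith [(Nat.cast_nonneg N : (0 : ℝ) ≤ N)]))
    linarith
  have hpow : e ^ (2 / 3 : ℝ) = e * e ^ (-(1 / 3) : ℝ) := by
    rw [← Real.rpow_one_add' he.le (by norm_num)]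
    norm_num
  rw [hpow] at hfirst
  set S := ∑ k ∈ Finset.range N, A (e * (k + 1))
  have hB0 : 0 ≤ B * e ^ (-(1 / 3) : ℝ) := (h0 e he).trans (hB e he)
  have hIe : I = e * (I / e) := by field_simp
  rw [abs_le]
  constructor
  · refine le_of_mul_le_mul_left ?_ he
    nlinarith
  · refine (sub_nonpos.2 ?_).trans (by linarith)
    rw [le_div_iff₀ he]
    linarith

section Sum

variable {s o : Bool} {Y : ℝ} {w : ℝ → ℝ → ℝ}

theorem abs_sum_layer_sub_le (hY : 0 < Y) (hw : IsWeight w) {c : ℝ} (hc : 0 ≤ c)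
    (h : ∀ K, 0 < K → ∫⁻ z : ℝ × ℝ, ENNReal.ofReal (w K (z.1 ^ 2 + z.2 ^ 2)) =
      ENNReal.ofReal (c * K ^ 2)) {e : ℝ} (he : 0 < e) {N : ℕ} (hN : 2 * Y ≤ (e * N) ^ 2) :
    |∑ k ∈ Finset.range N, (layer s o Y w (e * (k + 1))).toReal -
      jacConst s * c * Y ^ 2 * (π / 6) / 2 / e| ≤
      3 * jacConst s * Y ^ (5 / 3 : ℝ) * e ^ (-(1 / 3) : ℝ) := by
  have hκ := jacConst_pos s
  have htop : ∀ t, 0 < t → layer s o Y w t ≠ ⊤ := fun t ht =>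
    ((layer_le hY hw ht).trans_lt ENNReal.ofReal_lt_top).ne
  have hmeas : Measurable (layer s o Y w) := by
    have := (measurable_layerFun s Y hw.measurable).comp
      (f := fun x : (ℝ × (ℝ × ℝ)) × ℝ => (x.1.1, x.1.2, x.2)) (by fun_prop)
    exact this.lintegral_prod_right'.lintegral_prod_right'
  have hint := lintegral_layer (s := s) (o := o) hY hw hc h
  have hIfull : ∫ t, (layer s o Y w t).toReal = jacConst s * c * Y ^ 2 * (π / 6) := by
    rw [integral_toReal hmeas.aemeasurable (ae_lt_top hmeas (by rw [hint]; simp)), hint,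
      ENNReal.toReal_ofReal (by positivity)]
  have hI : ∫ t in Set.Ioi 0, (layer s o Y w t).toReal =
      jacConst s * c * Y ^ 2 * (π / 6) / 2 := by
    have habs : ∀ t, (layer s o Y w |t|).toReal = (layer s o Y w t).toReal := by
      intro t
      rcases abs_choice t with ht | ht <;> simp [ht, layer_neg]
    have := integral_comp_abs (f := fun t => (layer s o Y w t).toReal)
    simp only [habs] at this
    rw [hIfull] at this
    linarith
  have hcalc := abs_sum_sub_integral_le (A := fun t => (layer s o Y w t).toReal)
    (B := 2 * jacConst s * Y ^ (5 / 3 : ℝ)) (N := N) he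
    (fun x hx y hy hxy => ENNReal.toReal_mono (htop x hx) (layer_anti hY hw (le_of_lt hx) hxy))
    (fun t _ => ENNReal.toReal_nonneg)
    (fun t ht => ENNReal.toReal_le_of_le_ofReal (by positivity) (layer_le hY hw ht))
    (fun t ht => by
      rw [layer_eq_zero hw (hN.trans (pow_le_pow_left₀ (by positivity) ht 2)), ENNReal.toReal_zero])
    (integrable_toReal_of_lintegral_ne_top hmeas.aemeasurable (by rw [hint]; simp)).integrableOn hI
  refine hcalc.trans (le_of_eq ?_)
  ring

theorem abs_sum_volume_sub_le (s o : Bool) (hY : 0 < Y) {e : ℝ} (he : 0 < e) {N : ℕ}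
    (hN : 2 * Y ≤ (e * N) ^ 2) :
    |∑ k ∈ Finset.range N, volume.real (redSlice s o (discConst s * Y ^ 2) (e * (k + 1))) -
      jacConst s * π ^ 2 * Y ^ 2 / 24 / e| ≤
      6 * jacConst s * Y ^ (5 / 3 : ℝ) * e ^ (-(1 / 3) : ℝ) := by
  have h1 := abs_sum_layer_sub_le (s := s) (o := o) hY isWeight_ite Real.pi_pos.le
    (fun K hK => lintegral_planar_ite hK) he hN
  have h2 := abs_sum_layer_sub_le (s := s) (o := o) hY isWeight_max (by positivity : 0 ≤ π / 2)
    (fun K hK => lintegral_planar_max hK) he hN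
  have h3 : ∀ k : ℕ, volume.real (redSlice s o (discConst s * Y ^ 2) (e * (k + 1))) =
      (layer s o Y (fun K t => if t < K then K else 0) (e * (k + 1))).toReal -
      (layer s o Y (fun K t => max (K - t) 0) (e * (k + 1))).toReal := by
    intro k
    have hpos : 0 < e * (k + 1) := by positivity
    have h4 := volume_redSlice_add_layer (s := s) (o := o) hY hpos.ne'
    have h5 : layer s o Y (fun K t => if t < K then K else 0) (e * (k + 1)) ≠ ⊤ :=
      ((layer_le hY isWeight_ite hpos).trans_lt ENNReal.ofReal_lt_top).ne
    rw [← h4] at h5 ⊢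
    rw [ENNReal.toReal_add (ENNReal.add_ne_top.1 h5).1 (ENNReal.add_ne_top.1 h5).2, measureReal_def]
    ring
  simp only [h3, Finset.sum_sub_distrib]
  rw [abs_le] at h1 h2 ⊢
  constructor <;> ring_nf at h1 h2 ⊢ <;> linarith [h1.1, h1.2, h2.1, h2.2]

end Sum

theorem exists_sum_rpow_le {θ : ℝ} (hθ : θ < -1) :
    ∃ C > 0, ∀ S : Finset ℕ, ∑ k ∈ S, (k : ℝ) ^ θ ≤ C := by
  have hs : Summable fun k : ℕ => (k : ℝ) ^ θ := Real.summable_nat_rpow.2 hθ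
  refine ⟨∑' k : ℕ, (k : ℝ) ^ θ + 1, ?_, fun S => ?_⟩
  · have : 0 ≤ ∑' k : ℕ, (k : ℝ) ^ θ := tsum_nonneg fun k => by positivity
    linarith
  · have := hs.sum_le_tsum S fun k _ => by positivity
    linarith

/-- Summing an even function over the nonzero multiples of `e` in an interval. -/
theorem sum_filter_dvd_eq {G : ℤ → ℝ} {M e : ℕ} (he : 0 < e) (hG : ∀ a, G (-a) = G a)
    (h0 : ∀ a : ℤ, (M : ℤ) ≤ |a| → G a = 0) :
    ∑ a ∈ (Finset.Ico (-(M : ℤ)) M).filter (fun a => a ≠ 0 ∧ (e : ℤ) ∣ a), G a =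
      2 * ∑ k ∈ Finset.range M, G (e * (k + 1)) := by
  have he' : (0 : ℤ) < e := by exact_mod_cast he
  set P := (Finset.range M).image fun k : ℕ => (e : ℤ) * (k + 1) with hP
  set Q := (Finset.range M).image fun k : ℕ => -((e : ℤ) * (k + 1)) with hQ
  have hPpos : ∀ a ∈ P, 0 < a := by
    intro a ha
    obtain ⟨k, -, rfl⟩ := Finset.mem_image.1 ha
    positivity
  have hQneg : ∀ a ∈ Q, a < 0 := by
    intro a ha
    obtain ⟨k, -, rfl⟩ := Finset.mem_image.1 ha
    have : 0 < (e : ℤ) * (k + 1) := by positivity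
    linarith
  have hinj : ∀ k l : ℕ, (e : ℤ) * (k + 1) = e * (l + 1) → k = l := by
    intro k l h
    have := mul_left_cancel₀ he'.ne' h
    exact_mod_cast (add_right_cancel this)
  have hdisj : Disjoint P Q := Finset.disjoint_left.2 fun a h1 h2 => by
    linarith [hPpos a h1, hQneg a h2]
  have hsub : (Finset.Ico (-(M : ℤ)) M).filter (fun a => a ≠ 0 ∧ (e : ℤ) ∣ a) ⊆ P ∪ Q := by
    intro a ha
    obtain ⟨ha1, ha0, j, rfl⟩ := Finset.mem_filter.1 ha
    rw [Finset.mem_Ico] at ha1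
    have hj0 : j ≠ 0 := fun h => ha0 (by simp [h])
    rcases lt_or_gt_of_ne hj0 with hj | hj
    · refine Finset.mem_union_right _ (Finset.mem_image.2 ⟨(-j - 1).toNat, ?_, ?_⟩)
      · rw [Finset.mem_range]
        have : -j ≤ M := by nlinarith
        omega
      · rw [Int.toNat_of_nonneg (by omega)]
        ring
    · refine Finset.mem_union_left _ (Finset.mem_image.2 ⟨(j - 1).toNat, ?_, ?_⟩)
      · rw [Finset.mem_range]
        have : j ≤ M := by nlinarith
        omega
      · rw [Int.toNat_of_nonneg (by omega)]
        ring
  rw [Finset.sum_subset hsub, Finset.sum_union hdisj, Finset.sum_image, Finset.sum_image]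
  · simp only [hG]
    ring
  · exact fun k _ l _ h => hinj k l (neg_injective h)
  · exact fun k _ l _ h => hinj k l h
  · intro a ha hna
    refine h0 a ?_
    by_contra h
    rw [not_le, abs_lt] at h
    refine hna (Finset.mem_filter.2 ⟨Finset.mem_Ico.2 ⟨h.1.le, h.2⟩, ?_, ?_⟩)
    · rcases Finset.mem_union.1 ha with h' | h'
      · exact (hPpos a h').ne'
      · exact (hQneg a h').ne
    · rcases Finset.mem_union.1 ha with h' | h' <;> obtain ⟨k, -, rfl⟩ := Finset.mem_image.1 h'
      · exact dvd_mul_right _ _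
      · exact (dvd_mul_right _ _).neg_right

theorem redSlice_eq_empty {s o : Bool} {Y a : ℝ} (hY : 0 < Y) (haY : 2 * Y < a ^ 2) :
    redSlice s o (discConst s * Y ^ 2) a = ∅ := by
  have ha : a ≠ 0 := by
    rintro rfl
    norm_num at haY
    linarith
  rw [Set.eq_empty_iff_forall_notMem]
  rintro ⟨b, c, d⟩ h
  exact absurd (coeff_bounds hY ha h).1 (not_le.2 haY)

theorem volume_redSlice_neg {s o : Bool} {Y a : ℝ} (hY : 0 < Y) :
    volume.real (redSlice s o (discConst s * Y ^ 2) (-a)) =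
      volume.real (redSlice s o (discConst s * Y ^ 2) a) := by
  rcases eq_or_ne a 0 with rfl | ha
  · rw [neg_zero]
  · rw [measureReal_def, measureReal_def, volume_redSlice_eq hY ha,
      volume_redSlice_eq hY (neg_ne_zero.2 ha)]
    simp [paramDom]

open Classical in
/-- The number of pairs of a form with leading coefficient `a` in the reduced region and a root
modulo `m` of its dehomogenization. -/
noncomputable def sliceSum (s o : Bool) (Y : ℝ) (M m : ℕ) (a : ℤ) : ℝ :=
  ∑ x ∈ Finset.range m, ∑ b ∈ Finset.Ico (-(M : ℤ)) M, ∑ c ∈ Finset.Ico (-(M : ℤ)) M,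
    ∑ d ∈ Finset.Ico (-(M : ℤ)) M,
      if castF (a, b, c, d) ∈ redRegion s o (discConst s * Y ^ 2) ∧
        (m : ℤ) ∣ a * x ^ 3 + b * x ^ 2 + c * x + d then (1 : ℝ) else 0

theorem abs_sliceSum_sub_le (s o : Bool) {Y : ℝ} (hY : 1 / 11 ≤ Y) {M m : ℕ} (hm : 0 < m)
    {a : ℤ} (ha : a ≠ 0) (hM : 200 * Y + 15 < M) :
    |sliceSum s o Y M m a - volume.real (redSlice s o (discConst s * Y ^ 2) a)| ≤
      if (a : ℝ) ^ 2 ≤ 2 * Y then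
        4000000 * (8 * √m * (Y ^ (5 / 3 : ℝ) * |(a : ℝ)| ^ (-(4 / 3) : ℝ)) + m * √Y) else 0 := by
  have hY0 : 0 < Y := by linarith
  have hm' : (0 : ℝ) < m := by exact_mod_cast hm
  split_ifs with haY
  · set V := volume.real (redSlice s o (discConst s * Y ^ 2) a)
    have hA : 0 < |(a : ℝ)| := abs_pos.2 (by exact_mod_cast ha)
    have hE : (Y ^ 2 / |(a : ℝ)|) ^ (1 / 3 : ℝ) * (Y / |(a : ℝ)|) =
        Y ^ (5 / 3 : ℝ) * |(a : ℝ)| ^ (-(4 / 3) : ℝ) := by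
      rw [Real.div_rpow (by positivity) hA.le, ← Real.rpow_natCast, ← Real.rpow_mul hY0.le,
        show (5 / 3 : ℝ) = (2 : ℕ) * (1 / 3) + 1 by norm_num, Real.rpow_add_one hY0.ne',
        Real.rpow_neg hA.le, show (4 / 3 : ℝ) = 1 / 3 + 1 by norm_num, Real.rpow_add_one hA.ne']
      field_simp
    have hV : V = ∑ _x ∈ Finset.range m, V / m := by
      rw [Finset.sum_const, Finset.card_range, nsmul_eq_mul]
      field_simp
    rw [hV, sliceSum, ← Finset.sum_sub_distrib]
    refine (Finset.abs_sum_le_sum_abs _ _).trans ((Finset.sum_le_sum fun x _ =>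
      abs_slice_count_sub_le s o hY hm x ha haY hM).trans ?_)
    rw [← Finset.mul_sum, Finset.sum_add_distrib, hE]
    simp only [div_eq_mul_one_div (Y ^ (5 / 3 : ℝ) * |(a : ℝ)| ^ (-(4 / 3) : ℝ)), ← Finset.mul_sum]
    rw [Finset.sum_const, Finset.card_range, nsmul_eq_mul]
    have := mul_le_mul_of_nonneg_left (sum_inv_shortNorm_le hm)
      (by positivity : 0 ≤ Y ^ (5 / 3 : ℝ) * |(a : ℝ)| ^ (-(4 / 3) : ℝ))
    linarith
  · rw [not_le] at haY
    have hemp := redSlice_eq_empty (s := s) (o := o) hY0 haY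
    have h0 : sliceSum s o Y M m a = 0 := by
      unfold sliceSum
      refine Finset.sum_eq_zero fun x _ => Finset.sum_eq_zero fun b _ =>
        Finset.sum_eq_zero fun c _ => Finset.sum_eq_zero fun d _ => if_neg fun h => ?_
      have : ((b : ℝ), (c : ℝ), (d : ℝ)) ∈ redSlice s o (discConst s * Y ^ 2) a := h.1
      rw [hemp] at this
      exact this
    rw [h0, hemp]
    simp

theorem exists_abs_sum_sliceSum_sub_le (s o : Bool) : ∃ C > 0, ∀ (Y : ℝ) (e m M : ℕ),
    1 / 11 ≤ Y → 0 < e → 0 < m → 200 * Y + 15 < M →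
    |∑ a ∈ (Finset.Ico (-(M : ℤ)) M).filter (fun a => a ≠ 0 ∧ (e : ℤ) ∣ a), sliceSum s o Y M m a -
      jacConst s * π ^ 2 * Y ^ 2 / 12 / e| ≤
      C * (√m * Y ^ (5 / 3 : ℝ) * (e : ℝ) ^ (-(4 / 3) : ℝ) + m * Y / e + Y ^ (5 / 3 : ℝ)) := by
  obtain ⟨C₁, hC₁, hsum⟩ := exists_sum_rpow_le (θ := -(4 / 3)) (by norm_num)
  have hκ := jacConst_pos s
  refine ⟨64000000 * C₁ + 16000000 + 12 * jacConst s, by positivity, ?_⟩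
  intro Y e m M hY he hm hM
  have hY0 : 0 < Y := by linarith
  have he1 : (1 : ℝ) ≤ e := by exact_mod_cast he
  have he0 : (0 : ℝ) < e := by linarith
  have hm' : (0 : ℝ) < m := by exact_mod_cast hm
  set V : ℤ → ℝ := fun a => volume.real (redSlice s o (discConst s * Y ^ 2) a) with hV
  set A := (Finset.Ico (-(M : ℤ)) M).filter (fun a => a ≠ 0 ∧ (e : ℤ) ∣ a) with hA
  have hMsq : 2 * Y < (M : ℝ) ^ 2 := by nlinarith
  have hbig : ∀ a : ℤ, (M : ℤ) ≤ |a| → 2 * Y < (a : ℝ) ^ 2 := by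
    intro a ha
    have h1 : (M : ℝ) ≤ |(a : ℝ)| := by exact_mod_cast ha
    have := pow_le_pow_left₀ (Nat.cast_nonneg M) h1 2
    rw [sq_abs] at this
    linarith
  have hvol : |∑ a ∈ A, V a - jacConst s * π ^ 2 * Y ^ 2 / 12 / e| ≤
      12 * jacConst s * Y ^ (5 / 3 : ℝ) := by
    rw [hA, sum_filter_dvd_eq he (fun a => by simpa [hV] using volume_redSlice_neg hY0)
      (fun a ha => by simp only [hV]; rw [redSlice_eq_empty hY0 (hbig a ha)]; simp)]
    have h1 := abs_sum_volume_sub_le s o hY0 he0 (N := M) (by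
      rw [mul_pow]
      nlinarith [one_le_pow₀ he1 (n := 2), sq_nonneg (M : ℝ)])
    have h2 : (e : ℝ) ^ (-(1 / 3) : ℝ) ≤ 1 :=
      Real.rpow_le_one_of_one_le_of_nonpos he1 (by norm_num)
    have h3 := mul_le_mul_of_nonneg_left h2 (by positivity : 0 ≤ 6 * jacConst s * Y ^ (5 / 3 : ℝ))
    have h4 : ∀ k : ℕ, V (e * (k + 1)) =
        volume.real (redSlice s o (discConst s * Y ^ 2) (e * (k + 1))) := fun k => by
      simp [hV]
    simp only [h4]
    rw [abs_le] at h1 ⊢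
    constructor <;> ring_nf at h1 h3 ⊢ <;> linarith [h1.1, h1.2]
  set G : ℤ → ℝ := fun a => if (a : ℝ) ^ 2 ≤ 2 * Y then
        4000000 * (8 * √m * (Y ^ (5 / 3 : ℝ) * |(a : ℝ)| ^ (-(4 / 3) : ℝ)) + m * √Y) else 0 with hG
  have herr : |∑ a ∈ A, sliceSum s o Y M m a - ∑ a ∈ A, V a| ≤ ∑ a ∈ A, G a := by
    rw [← Finset.sum_sub_distrib]
    refine (Finset.abs_sum_le_sum_abs _ _).trans (Finset.sum_le_sum fun a ha => ?_)
    exact abs_sliceSum_sub_le s o hY hm (Finset.mem_filter.1 ha).2.1 hM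
  have hGsum : ∑ a ∈ A, G a ≤ 64000000 * C₁ * (√m * Y ^ (5 / 3 : ℝ) * (e : ℝ) ^ (-(4 / 3) : ℝ)) +
      16000000 * (m * Y / e) := by
    rw [hA, sum_filter_dvd_eq he (fun a => by simp [hG])
      (fun a ha => by simp only [hG]; rw [if_neg (not_le.2 (hbig a ha))])]
    have h1 : ∀ k : ℕ, G (e * (k + 1)) ≤
        32000000 * (√m * Y ^ (5 / 3 : ℝ) * (e : ℝ) ^ (-(4 / 3) : ℝ)) *
          ((k + 1 : ℕ) : ℝ) ^ (-(4 / 3) : ℝ) +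
        4000000 * (m * √Y) * (if (e * (k + 1) : ℝ) ^ 2 ≤ 2 * Y then 1 else 0) := by
      intro k
      have h2 : |(((e : ℤ) * (k + 1) : ℤ) : ℝ)| = e * ((k + 1 : ℕ) : ℝ) := by
        push_cast
        exact abs_of_pos (by positivity)
      simp only [hG]
      rw [h2, Real.mul_rpow he0.le (by positivity)]
      push_cast
      have : 0 ≤ √m * Y ^ (5 / 3 : ℝ) * (e : ℝ) ^ (-(4 / 3) : ℝ) * ((k : ℝ) + 1) ^ (-(4 / 3) : ℝ) := by
        positivity
      split_ifs <;> nlinarith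
    have h3 : ∑ k ∈ Finset.range M, ((k + 1 : ℕ) : ℝ) ^ (-(4 / 3) : ℝ) ≤ C₁ := by
      have := hsum ((Finset.range M).map (addRightEmbedding 1))
      rwa [Finset.sum_map] at this
    have h4 : ∑ k ∈ Finset.range M, (if (e * (k + 1) : ℝ) ^ 2 ≤ 2 * Y then (1 : ℝ) else 0) ≤
        2 * √Y / e := by
      rw [Finset.sum_boole]
      have hle : (Finset.range M).filter (fun k : ℕ => (e * (k + 1) : ℝ) ^ 2 ≤ 2 * Y) ⊆
          Finset.range ⌊2 * √Y / e⌋₊ := by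
        intro k hk
        have h5 := (Finset.mem_filter.1 hk).2
        rw [Finset.mem_range, Nat.lt_iff_add_one_le, Nat.le_floor_iff (by positivity),
          le_div_iff₀ he0]
        push_cast
        have h6 : (e * (k + 1) : ℝ) ^ 2 ≤ (2 * √Y) ^ 2 := by
          rw [mul_pow 2, Real.sq_sqrt hY0.le]
          linarith
        have := (le_abs_self _).trans (abs_le_of_sq_le_sq h6 (by positivity))
        linarith
      calc ((_ : ℕ) : ℝ) ≤ ((⌊2 * √Y / e⌋₊ : ℕ) : ℝ) := by
            exact_mod_cast (Finset.card_le_card hle).trans_eq (Finset.card_range _)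
        _ ≤ _ := Nat.floor_le (by positivity)
    calc 2 * ∑ k ∈ Finset.range M, G (e * (k + 1)) ≤ 2 * (32000000 *
          (√m * Y ^ (5 / 3 : ℝ) * (e : ℝ) ^ (-(4 / 3) : ℝ)) * C₁ +
          4000000 * (m * √Y) * (2 * √Y / e)) := by
          refine mul_le_mul_of_nonneg_left ((Finset.sum_le_sum fun k _ => h1 k).trans ?_) (by norm_num)
          rw [Finset.sum_add_distrib, ← Finset.mul_sum, ← Finset.mul_sum]
          exact add_le_add (mul_le_mul_of_nonneg_left h3 (by positivity))
            (mul_le_mul_of_nonneg_left h4 (by positivity))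
      _ = _ := by
          have : m * √Y * (√Y / e) = m * Y / e := by
            rw [mul_assoc, ← mul_div_assoc, Real.mul_self_sqrt hY0.le, mul_div_assoc]
          linear_combination 16000000 * this
  have h1 : 0 ≤ √m * Y ^ (5 / 3 : ℝ) * (e : ℝ) ^ (-(4 / 3) : ℝ) := by positivity
  have h2 : 0 ≤ m * Y / e := by positivity
  have h3 : 0 ≤ Y ^ (5 / 3 : ℝ) := by positivity
  calc _ ≤ |∑ a ∈ A, sliceSum s o Y M m a - ∑ a ∈ A, V a| +
        |∑ a ∈ A, V a - jacConst s * π ^ 2 * Y ^ 2 / 12 / e| := abs_sub_le _ _ _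
    _ ≤ _ := by
      set U := √m * Y ^ (5 / 3 : ℝ) * (e : ℝ) ^ (-(4 / 3) : ℝ)
      set W := m * Y / e
      set Z := Y ^ (5 / 3 : ℝ)
      have h4 := mul_nonneg hC₁.le h1
      have h5 := mul_nonneg hκ.le h1
      have h6 := mul_nonneg hC₁.le h2
      have h7 := mul_nonneg hκ.le h2
      have h8 := mul_nonneg hC₁.le h3
      nlinarith

theorem rootCount_eq_sum {m : ℕ} (hm : 0 < m) (f : BinaryCubic) :
    rootCount m f = ∑ x ∈ Finset.range m,
      if (m : ℤ) ∣ f.1 * x ^ 3 + f.2.1 * x ^ 2 + f.2.2.1 * x + f.2.2.2 then 1 else 0 := by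
  have : NeZero m := ⟨hm.ne'⟩
  have h : ∀ x : ℕ, evalForm (reduceForm m f) ((x : ZMod m), 1) = 0 ↔
      (m : ℤ) ∣ f.1 * x ^ 3 + f.2.1 * x ^ 2 + f.2.2.1 * x + f.2.2.2 := by
    intro x
    rw [← ZMod.intCast_zmod_eq_zero_iff_dvd]
    simp [evalForm, reduceForm]
  rw [rootCount, Nat.card_eq_fintype_card, Fintype.card_subtype, ← Finset.card_filter]
  symm
  refine Finset.card_bij (fun x _ => (x : ZMod m)) ?_ ?_ ?_
  · intro x hx
    simpa [h] using (Finset.mem_filter.1 hx).2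
  · intro x hx y hy hxy
    have h1 := Finset.mem_range.1 (Finset.mem_filter.1 hx).1
    have h2 := Finset.mem_range.1 (Finset.mem_filter.1 hy).1
    rw [ZMod.natCast_eq_natCast_iff'] at hxy
    rwa [Nat.mod_eq_of_lt h1, Nat.mod_eq_of_lt h2] at hxy
  · intro t ht
    refine ⟨t.val, Finset.mem_filter.2 ⟨Finset.mem_range.2 (ZMod.val_lt t), ?_⟩, by simp⟩
    rw [← h]
    simpa using (Finset.mem_filter.1 ht).2

open Classical in
/-- The integral forms with nonzero leading coefficient in the reduced region. -/
noncomputable def formSet (s o : Bool) (Y : ℝ) (M : ℕ) : Finset BinaryCubic :=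
  (Finset.Ico (-(M : ℤ)) M ×ˢ Finset.Ico (-(M : ℤ)) M ×ˢ Finset.Ico (-(M : ℤ)) M ×ˢ
    Finset.Ico (-(M : ℤ)) M).filter
    fun f => f.1 ≠ 0 ∧ castF f ∈ redRegion s o (discConst s * Y ^ 2)

open Classical in
theorem sum_formSet_wn (s o : Bool) (Y : ℝ) (M : ℕ) {n : ℕ} (hn : Squarefree n) :
    ((∑ f ∈ formSet s o Y M, wn n f : ℕ) : ℝ) = ∑ e ∈ n.divisors,
      ∑ a ∈ (Finset.Ico (-(M : ℤ)) M).filter (fun a => a ≠ 0 ∧ (e : ℤ) ∣ a),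
        sliceSum s o Y M (n / e) a := by
  have hn0 := Nat.pos_of_ne_zero hn.ne_zero
  simp only [wn_eq_sum hn]
  rw [Finset.sum_comm, Nat.cast_sum]
  refine Finset.sum_congr rfl fun e he => ?_
  have hm : 0 < n / e := Nat.div_pos (Nat.divisor_le he) (Nat.pos_of_mem_divisors he)
  rw [formSet, Finset.sum_filter, Finset.sum_product, Finset.sum_filter, Nat.cast_sum]
  refine Finset.sum_congr rfl fun a _ => ?_
  by_cases ha : a ≠ 0 ∧ (e : ℤ) ∣ a
  · rw [if_pos ha, sliceSum]
    simp only [Finset.sum_product, rootCount_eq_sum hm, Nat.cast_sum]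
    conv_rhs => rw [Finset.sum_comm]
    refine Finset.sum_congr rfl fun b _ => ?_
    conv_rhs => rw [Finset.sum_comm]
    refine Finset.sum_congr rfl fun c _ => ?_
    conv_rhs => rw [Finset.sum_comm]
    refine Finset.sum_congr rfl fun d _ => ?_
    by_cases h : castF (a, b, c, d) ∈ redRegion s o (discConst s * Y ^ 2)
    · simp [h, ha.1, ha.2]
    · simp [h]
  · rw [if_neg ha, Nat.cast_eq_zero]
    refine Finset.sum_eq_zero fun y _ => ?_
    rw [not_and_or, not_not] at ha
    rcases ha with ha | ha <;> simp [ha]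

theorem exists_abs_sum_formSet_sub_le (s o : Bool) : ∃ C > 0, ∀ (Y : ℝ) (n M : ℕ),
    1 / 11 ≤ Y → Squarefree n → 200 * Y + 15 < M →
    |((∑ f ∈ formSet s o Y M, wn n f : ℕ) : ℝ) -
      (∑ d ∈ n.divisors, (d : ℝ)) / n * (jacConst s * π ^ 2 * Y ^ 2 / 12)| ≤
      C * (√n * Y ^ (5 / 3 : ℝ) + n * Y) := by
  obtain ⟨C₀, hC₀, hmain⟩ := exists_abs_sum_sliceSum_sub_le s o
  obtain ⟨C₁, hC₁, h1⟩ := exists_sum_rpow_le (θ := -(4 / 3)) (by norm_num)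
  obtain ⟨C₂, hC₂, h2⟩ := exists_sum_rpow_le (θ := -2) (by norm_num)
  obtain ⟨C₃, hC₃, h3⟩ := pow_card_primeFactors_le 2 (by norm_num) (1 / 2) (by norm_num)
  refine ⟨C₀ * (C₁ + C₂ + C₃), by positivity, ?_⟩
  intro Y n M hY hn hM
  have hY0 : 0 < Y := by linarith
  have hn0 := Nat.pos_of_ne_zero hn.ne_zero
  have hn' : (0 : ℝ) < n := by exact_mod_cast hn0
  have hσ : (∑ d ∈ n.divisors, (d : ℝ)) / n = ∑ e ∈ n.divisors, 1 / (e : ℝ) := by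
    rw [← Nat.sum_div_divisors n (fun d => (d : ℝ)), Finset.sum_div]
    refine Finset.sum_congr rfl fun e he => ?_
    rw [Nat.cast_div (Nat.dvd_of_mem_divisors he) (by
      exact_mod_cast (Nat.pos_of_mem_divisors he).ne')]
    field_simp
  rw [sum_formSet_wn s o Y M hn, hσ, Finset.sum_mul, ← Finset.sum_sub_distrib]
  have hterm : ∀ e ∈ n.divisors,
      |∑ a ∈ (Finset.Ico (-(M : ℤ)) M).filter (fun a => a ≠ 0 ∧ (e : ℤ) ∣ a),
        sliceSum s o Y M (n / e) a - 1 / e * (jacConst s * π ^ 2 * Y ^ 2 / 12)| ≤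
      C₀ * (√n * Y ^ (5 / 3 : ℝ) * (e : ℝ) ^ (-(4 / 3) : ℝ) + n * Y * (e : ℝ) ^ (-2 : ℝ) +
        Y ^ (5 / 3 : ℝ)) := by
    intro e he
    have he0 := Nat.pos_of_mem_divisors he
    have he' : (0 : ℝ) < e := by exact_mod_cast he0
    have h := hmain Y e (n / e) M hY he0
      (Nat.div_pos (Nat.divisor_le he) he0) hM
    rw [one_div_mul_eq_div]
    refine h.trans (mul_le_mul_of_nonneg_left ?_ hC₀.le)
    have hle : ((n / e : ℕ) : ℝ) ≤ n / e := Nat.cast_div_le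
    gcongr
    · exact Nat.div_le_self n e
    · rw [Real.rpow_neg he'.le, Real.rpow_two]
      calc ((n / e : ℕ) : ℝ) * Y / e ≤ n / e * Y / e := by gcongr
        _ = _ := by field_simp
  refine (Finset.abs_sum_le_sum_abs _ _).trans ((Finset.sum_le_sum hterm).trans ?_)
  rw [← Finset.mul_sum, Finset.sum_add_distrib, Finset.sum_add_distrib, ← Finset.mul_sum,
    ← Finset.mul_sum, Finset.sum_const, nsmul_eq_mul, mul_assoc C₀]
  refine mul_le_mul_of_nonneg_left ?_ hC₀.le
  have h4 := mul_le_mul_of_nonneg_left (h1 n.divisors) (by positivity : 0 ≤ √n * Y ^ (5 / 3 : ℝ))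
  have h5 := mul_le_mul_of_nonneg_left (h2 n.divisors) (by positivity : 0 ≤ n * Y)
  have h6 : (n.divisors.card : ℝ) ≤ C₃ * √n := by
    rw [card_divisors_of_squarefree hn, Real.sqrt_eq_rpow]
    have := h3 n hn
    push_cast
    exact this
  have h7 := mul_le_mul_of_nonneg_right h6 (by positivity : 0 ≤ Y ^ (5 / 3 : ℝ))
  have h8 : 0 ≤ √n * Y ^ (5 / 3 : ℝ) := by positivity
  have h9 : 0 ≤ n * Y := by positivity
  nlinarith [mul_nonneg hC₁.le h9, mul_nonneg hC₂.le h8, mul_nonneg hC₃.le h9]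

/-! ### Reducible forms -/

open Classical in
theorem exists_card_quadruple_le {θ : ℝ} (hθ : 1 < θ) : ∃ C > 0, ∀ (T : ℝ)
    (S : Finset (ℤ × ℤ × ℤ × ℤ)), 0 < T →
    (∀ x ∈ S, x.1 ≠ 0 ∧ x.2.1 ≠ 0 ∧ x.2.2.1 ≠ 0 ∧ x.2.2.2 ≠ 0 ∧
      |(x.1 : ℝ)| * |(x.2.1 : ℝ)| * |(x.2.2.1 : ℝ)| * |(x.2.2.2 : ℝ)| ≤ T) →
    (S.card : ℝ) ≤ C * T ^ θ := by
  have hs := Real.summable_abs_int_rpow hθ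
  set σ := ∑' n : ℤ, |(n : ℝ)| ^ (-θ) with hσ
  have hσ0 : 0 ≤ σ := tsum_nonneg fun n => by positivity
  refine ⟨σ ^ 4 + 1, by positivity, fun T S hT hS => ?_⟩
  set g : ℤ → ℝ := fun n => |(n : ℝ)| ^ (-θ) with hg
  have hg0 : ∀ n, 0 ≤ g n := fun n => by positivity
  have h1 : ∀ x ∈ S, (1 : ℝ) ≤ T ^ θ * (g x.1 * (g x.2.1 * (g x.2.2.1 * g x.2.2.2))) := by
    intro x hx
    obtain ⟨h1, h2, h3, h4, h5⟩ := hS x hx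
    have h1' : 0 < |(x.1 : ℝ)| := abs_pos.2 (by exact_mod_cast h1)
    have h2' : 0 < |(x.2.1 : ℝ)| := abs_pos.2 (by exact_mod_cast h2)
    have h3' : 0 < |(x.2.2.1 : ℝ)| := abs_pos.2 (by exact_mod_cast h3)
    have h4' : 0 < |(x.2.2.2 : ℝ)| := abs_pos.2 (by exact_mod_cast h4)
    have h6 : T ^ θ * (g x.1 * (g x.2.1 * (g x.2.2.1 * g x.2.2.2))) =
        (T / (|(x.1 : ℝ)| * |(x.2.1 : ℝ)| * |(x.2.2.1 : ℝ)| * |(x.2.2.2 : ℝ)|)) ^ θ := by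
      rw [Real.div_rpow hT.le (by positivity), Real.mul_rpow (by positivity) h4'.le,
        Real.mul_rpow (by positivity) h3'.le, Real.mul_rpow h1'.le h2'.le]
      simp only [hg, Real.rpow_neg (abs_nonneg _)]
      field_simp
    rw [h6]
    exact Real.one_le_rpow ((one_le_div (by positivity)).2 h5) (by linarith)
  set A := S.image fun x => x.1
  set B := S.image fun x => x.2.1
  set C := S.image fun x => x.2.2.1
  set D := S.image fun x => x.2.2.2
  have hsub : S ⊆ A ×ˢ B ×ˢ C ×ˢ D := by
    intro x hx
    simp only [Finset.mem_product]
    exact ⟨Finset.mem_image_of_mem _ hx, Finset.mem_image_of_mem (fun x => x.2.1) hx,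
      Finset.mem_image_of_mem (fun x => x.2.2.1) hx, Finset.mem_image_of_mem (fun x => x.2.2.2) hx⟩
  have hle : ∀ P : Finset ℤ, ∑ n ∈ P, g n ≤ σ := fun P => hs.sum_le_tsum P fun n _ => hg0 n
  have hnn : ∀ P : Finset ℤ, 0 ≤ ∑ n ∈ P, g n := fun P => Finset.sum_nonneg fun n _ => hg0 n
  calc (S.card : ℝ) = ∑ x ∈ S, (1 : ℝ) := by simp
    _ ≤ ∑ x ∈ S, T ^ θ * (g x.1 * (g x.2.1 * (g x.2.2.1 * g x.2.2.2))) := Finset.sum_le_sum h1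
    _ ≤ ∑ x ∈ A ×ˢ B ×ˢ C ×ˢ D, T ^ θ * (g x.1 * (g x.2.1 * (g x.2.2.1 * g x.2.2.2))) :=
        Finset.sum_le_sum_of_subset_of_nonneg hsub fun x _ _ => by
          have := hg0 x.1
          have := hg0 x.2.1
          have := hg0 x.2.2.1
          have := hg0 x.2.2.2
          positivity
    _ = T ^ θ * ((∑ n ∈ A, g n) * ((∑ n ∈ B, g n) * ((∑ n ∈ C, g n) * ∑ n ∈ D, g n))) := by
        rw [← Finset.mul_sum]
        simp only [Finset.sum_product, ← Finset.mul_sum, ← Finset.sum_mul]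
    _ ≤ T ^ θ * (σ * (σ * (σ * σ))) := by
        have := hnn A
        have := hnn B
        have := hnn C
        have := hnn D
        have := hle A
        have := hle B
        have := hle C
        have := hle D
        gcongr
    _ ≤ (σ ^ 4 + 1) * T ^ θ := by
        have : 0 < T ^ θ := by positivity
        nlinarith

/-- The size constraints satisfied by the coefficients of reduced forms. -/
def CoeffBound (Z : ℝ) (f : BinaryCubic) : Prop :=
  f.1 ≠ 0 ∧ (f.1 : ℝ) ^ 2 ≤ 2 * Z ∧ (f.2.1 : ℝ) ^ 2 ≤ 200 * Z ∧
    |(f.1 : ℝ)| * |(f.2.2.2 : ℝ)| ≤ 200 * Z ∧ |(f.1 : ℝ)| * |(f.2.2.1 : ℝ)| ≤ 200 * Z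

/-- Reassembling a form from its second coefficient and a quadruple of integers, recording a
factorization of the outer coefficients along a rational root. -/
def assemble (i : Fin 3) (b : ℤ) (x : ℤ × ℤ × ℤ × ℤ) : BinaryCubic :=
  ![(x.2.1 * x.2.2.1, b,
      -(x.2.1 * x.2.2.1 * x.1 ^ 3 + b * x.1 ^ 2 * x.2.1 + x.1 * x.2.2.2 * x.2.1 ^ 3) /
        (x.1 * x.2.1 ^ 2), x.1 * x.2.2.2),
    (x.1, b, x.2.1, 0), (x.1, b, 0, 0)] i

theorem exists_assemble {Z : ℝ} {f : BinaryCubic} (hf : CoeffBound Z f) (hirr : ¬IrredForm f) :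
    ∃ i x, assemble i f.2.1 x = f ∧ x.1 ≠ 0 ∧ x.2.1 ≠ 0 ∧ x.2.2.1 ≠ 0 ∧ x.2.2.2 ≠ 0 ∧
      |(x.1 : ℝ)| * |(x.2.1 : ℝ)| * |(x.2.2.1 : ℝ)| * |(x.2.2.2 : ℝ)| ≤ 200 * Z := by
  obtain ⟨a, b, c, d⟩ := f
  obtain ⟨ha, ha2, -, had, hac⟩ := hf
  simp only at ha ha2 had hac
  by_cases hd : d = 0
  · subst hd
    by_cases hc : c = 0
    · subst hc
      refine ⟨2, (a, 1, 1, 1), rfl, ha, one_ne_zero, one_ne_zero, one_ne_zero, ?_⟩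
      have h1 : (1 : ℝ) ≤ |(a : ℝ)| := by exact_mod_cast Int.one_le_abs ha
      have h2 := sq_abs (a : ℝ)
      norm_num
      nlinarith
    · refine ⟨1, (a, c, 1, 1), rfl, ha, hc, one_ne_zero, one_ne_zero, ?_⟩
      norm_num
      exact hac
  · rw [irredForm_iff] at hirr
    push Not at hirr
    obtain ⟨r, t, hrt, hne⟩ := hirr
    have hrt0 : ¬(r = 0 ∧ t = 0) := fun h => hne h.1 h.2
    obtain ⟨r₁, t₁, g, hg, hcop⟩ : ∃ r₁ t₁ g : ℤ, g ≠ 0 ∧ IsCoprime r₁ t₁ ∧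
        r = g * r₁ ∧ t = g * t₁ := by
      have hg0 : (Int.gcd r t : ℤ) ≠ 0 := by
        rw [Ne, Nat.cast_eq_zero, Int.gcd_eq_zero_iff]
        exact hrt0
      refine ⟨r / Int.gcd r t, t / Int.gcd r t, Int.gcd r t, hg0, ?_, ?_, ?_⟩
      · rw [Int.isCoprime_iff_gcd_eq_one]
        exact Int.gcd_ediv_gcd_ediv_gcd (Nat.pos_of_ne_zero (by exact_mod_cast hg0))
      · exact (Int.mul_ediv_cancel' (Int.gcd_dvd_left _ _)).symm
      · exact (Int.mul_ediv_cancel' (Int.gcd_dvd_right _ _)).symm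
    obtain ⟨hcop, rfl, rfl⟩ := hcop
    have hroot : a * r₁ ^ 3 + b * r₁ ^ 2 * t₁ + c * r₁ * t₁ ^ 2 + d * t₁ ^ 3 = 0 := by
      have h3 : g ^ 3 * (a * r₁ ^ 3 + b * r₁ ^ 2 * t₁ + c * r₁ * t₁ ^ 2 + d * t₁ ^ 3) = 0 := by
        rw [← hrt]
        simp only [evalForm]
        ring
      exact (mul_eq_zero.1 h3).resolve_left (pow_ne_zero 3 hg)
    have hr0 : r₁ ≠ 0 := by
      rintro rfl
      have : d * t₁ ^ 3 = 0 := by linear_combination hroot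
      have ht : t₁ = 0 := by simpa [hd] using this
      exact hrt0 (by simp [ht])
    have ht0 : t₁ ≠ 0 := by
      rintro rfl
      have : a * r₁ ^ 3 = 0 := by linear_combination hroot
      exact hr0 (by simpa [ha] using this)
    obtain ⟨p, rfl⟩ : t₁ ∣ a := by
      have : t₁ ∣ a * r₁ ^ 3 :=
        ⟨-(b * r₁ ^ 2 + c * r₁ * t₁ + d * t₁ ^ 2), by linear_combination hroot⟩
      exact (hcop.symm.pow_right).dvd_of_dvd_mul_right this
    obtain ⟨q, rfl⟩ : r₁ ∣ d := by
      have : r₁ ∣ d * t₁ ^ 3 :=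
        ⟨-(t₁ * p * r₁ ^ 2 + b * r₁ * t₁ + c * t₁ ^ 2), by linear_combination hroot⟩
      exact (hcop.pow_right).dvd_of_dvd_mul_right this
    refine ⟨0, (r₁, t₁, p, q), ?_, hr0, ht0, right_ne_zero_of_mul ha, right_ne_zero_of_mul hd, ?_⟩
    · have hden : r₁ * t₁ ^ 2 ≠ 0 := by positivity
      have : c = -(t₁ * p * r₁ ^ 3 + b * r₁ ^ 2 * t₁ + r₁ * q * t₁ ^ 3) / (r₁ * t₁ ^ 2) :=
        (Int.ediv_eq_of_eq_mul_right hden (by linear_combination -hroot)).symm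
      change (t₁ * p, b, -(t₁ * p * r₁ ^ 3 + b * r₁ ^ 2 * t₁ + r₁ * q * t₁ ^ 3) / (r₁ * t₁ ^ 2),
        r₁ * q) = _
      rw [← this]
    · simp only
      push_cast at had
      rw [abs_mul, abs_mul] at had
      linarith

open Classical in
theorem exists_card_reducible_le : ∃ C > 0, ∀ (Z : ℝ) (S : Finset BinaryCubic), 0 < Z →
    (∀ f ∈ S, CoeffBound Z f ∧ ¬IrredForm f) → (S.card : ℝ) ≤ C * Z ^ (8 / 5 : ℝ) := by
  obtain ⟨C, hC, hquad⟩ := exists_card_quadruple_le (θ := 11 / 10) (by norm_num)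
  refine ⟨3 * (40 * (C * 200 ^ (11 / 10 : ℝ))), by positivity, fun Z S hZ hS => ?_⟩
  rcases S.eq_empty_or_nonempty with rfl | ⟨f₀, hf₀⟩
  · simp only [Finset.card_empty, Nat.cast_zero]
    positivity
  have hZ1 : 1 / 2 ≤ Z := by
    obtain ⟨⟨ha, ha2, -⟩, -⟩ := hS f₀ hf₀
    have h1 : (1 : ℝ) ≤ |(f₀.1 : ℝ)| := by exact_mod_cast Int.one_le_abs ha
    have h2 := sq_abs (f₀.1 : ℝ)
    nlinarith
  choose i x hx h1 h2 h3 h4 h5 using fun f : S => exists_assemble (hS f f.2).1 (hS f f.2).2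
  set Q := Finset.univ.image x with hQ
  set B := (S.image fun f => f.2.1).filter fun b : ℤ => |(b : ℝ)| ≤ √(200 * Z) with hB
  have hQcard : (Q.card : ℝ) ≤ C * (200 * Z) ^ (11 / 10 : ℝ) := by
    refine hquad _ _ (by positivity) fun y hy => ?_
    obtain ⟨f, -, rfl⟩ := Finset.mem_image.1 hy
    exact ⟨h1 f, h2 f, h3 f, h4 f, h5 f⟩
  have hBcard : (B.card : ℝ) ≤ 40 * √Z := by
    refine (card_filter_abs_le _ (Real.sqrt_nonneg _)).trans ?_
    have h6 : √(200 * Z) ≤ 15 * √Z := by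
      rw [Real.sqrt_le_left (by positivity), mul_pow, Real.sq_sqrt hZ.le]
      linarith
    have h7 : (1 / 2 : ℝ) ≤ √Z := Real.le_sqrt_of_sq_le (by linarith)
    linarith
  have hsub : S ⊆ (Finset.univ ×ˢ B ×ˢ Q).image fun y => assemble y.1 y.2.1 y.2.2 := by
    intro f hf
    refine Finset.mem_image.2 ⟨(i ⟨f, hf⟩, f.2.1, x ⟨f, hf⟩), ?_, hx ⟨f, hf⟩⟩
    simp only [Finset.mem_product, Finset.mem_univ, true_and]
    refine ⟨Finset.mem_filter.2 ⟨Finset.mem_image_of_mem _ hf, ?_⟩,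
      Finset.mem_image_of_mem _ (Finset.mem_univ _)⟩
    exact Real.abs_le_sqrt (hS f hf).1.2.2.1
  have hcard : S.card ≤ 3 * (B.card * Q.card) := by
    refine (Finset.card_le_card hsub).trans (Finset.card_image_le.trans ?_)
    simp [Finset.card_product]
  calc (S.card : ℝ) ≤ 3 * (B.card * Q.card) := by exact_mod_cast hcard
    _ ≤ 3 * (40 * √Z * (C * (200 * Z) ^ (11 / 10 : ℝ))) := by gcongr
    _ = _ := by
      rw [Real.mul_rpow (by norm_num) hZ.le, Real.sqrt_eq_rpow,
        show (8 / 5 : ℝ) = 1 / 2 + 11 / 10 by norm_num, Real.rpow_add hZ]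
      ring

open Classical in
theorem exists_sum_reducible_wn_le (s o : Bool) : ∃ C > 0, ∀ (Y : ℝ) (n M : ℕ), 1 / 11 ≤ Y →
    Squarefree n →
    ((∑ f ∈ (formSet s o Y M).filter fun f => ¬IrredForm f, wn n f : ℕ) : ℝ) ≤
      C * (√n * Y ^ (5 / 3 : ℝ)) := by
  obtain ⟨C₁, hC₁, hred⟩ := exists_card_reducible_le
  obtain ⟨C₂, hC₂, hpow⟩ := pow_card_primeFactors_le 6 (by norm_num) (1 / 2) (by norm_num)
  obtain ⟨C₃, hC₃, hsum⟩ := exists_sum_rpow_le (θ := -(11 / 5)) (by norm_num)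
  refine ⟨C₂ * (C₁ * C₃) * 11, by positivity, fun Y n M hY hn => ?_⟩
  have hY0 : 0 < Y := by linarith
  set S := (formSet s o Y M).filter fun f => ¬IrredForm f with hS
  have hS' : ∀ f ∈ S, CoeffBound Y f ∧ ¬IrredForm f := by
    intro f hf
    obtain ⟨hf1, hirr⟩ := Finset.mem_filter.1 hf
    obtain ⟨-, ha, hmem⟩ := Finset.mem_filter.1 hf1
    have := coeff_bounds hY0 (a := f.1) (b := f.2.1) (c := f.2.2.1) (d := f.2.2.2)
      (by exact_mod_cast ha) hmem
    exact ⟨⟨ha, this.1, this.2.1, this.2.2.2.1, this.2.2.2.2.2⟩, hirr⟩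
  have hcount : ∀ g ∈ n.divisors, ((S.filter fun f => g ∣ contF f).card : ℝ) * g ≤
      C₁ * Y ^ (8 / 5 : ℝ) * (g : ℝ) ^ (-(11 / 5) : ℝ) := by
    intro g hg
    have hg0 : 0 < g := Nat.pos_of_mem_divisors hg
    have hg' : (0 : ℝ) < g := by exact_mod_cast hg0
    have hgz : (g : ℤ) ≠ 0 := by exact_mod_cast hg0.ne'
    set dv : BinaryCubic → BinaryCubic := fun f => (f.1 / g, f.2.1 / g, f.2.2.1 / g, f.2.2.2 / g)
    have hdv : ∀ f ∈ S.filter (fun f => g ∣ contF f), f =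
        ((g : ℤ) * (dv f).1, (g : ℤ) * (dv f).2.1, (g : ℤ) * (dv f).2.2.1,
          (g : ℤ) * (dv f).2.2.2) := by
      intro f hf
      obtain ⟨h1, h2, h3, h4⟩ := (dvd_contF_iff).1 (Finset.mem_filter.1 hf).2
      simp [dv, Int.mul_ediv_cancel' h1, Int.mul_ediv_cancel' h2, Int.mul_ediv_cancel' h3,
        Int.mul_ediv_cancel' h4]
    have hinj : Set.InjOn dv (S.filter fun f => g ∣ contF f) := by
      intro f hf f' hf' h
      rw [hdv f hf, hdv f' hf', h]
    rw [← Finset.card_image_of_injOn hinj]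
    have h1 := hred (Y / g ^ 2) ((S.filter fun f => g ∣ contF f).image dv) (by positivity) ?_
    · refine (mul_le_mul_of_nonneg_right h1 hg'.le).trans (le_of_eq ?_)
      rw [Real.div_rpow hY0.le (by positivity), ← Real.rpow_natCast, ← Real.rpow_mul hg'.le,
        show (-(11 / 5) : ℝ) = 1 - (2 : ℕ) * (8 / 5) by norm_num, Real.rpow_sub hg', Real.rpow_one]
      ring
    · intro f' hf'
      obtain ⟨f, hf, rfl⟩ := Finset.mem_image.1 hf'
      obtain ⟨⟨ha, h2, h3, h4, h5⟩, hirr⟩ := hS' f (Finset.mem_filter.1 hf).1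
      have hff := hdv f hf
      generalize dv f = k at hff ⊢
      subst hff
      simp only at ha h2 h3 h4 h5
      push_cast at h2 h3 h4 h5
      rw [abs_mul, abs_mul, abs_of_pos hg'] at h4 h5
      refine ⟨⟨right_ne_zero_of_mul ha, ?_, ?_, ?_, ?_⟩, ?_⟩
      · rw [← mul_div_assoc, le_div_iff₀ (by positivity)]
        linarith
      · rw [← mul_div_assoc, le_div_iff₀ (by positivity)]
        linarith
      · rw [← mul_div_assoc, le_div_iff₀ (by positivity)]
        linarith
      · rw [← mul_div_assoc, le_div_iff₀ (by positivity)]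
        linarith
      · intro hk
        refine hirr ((irredForm_iff _).2 fun r t hrt => (irredForm_iff _).1 hk r t ?_)
        have h6 : (g : ℤ) * evalForm k (r, t) = 0 := by
          rw [← hrt]
          simp only [evalForm]
          ring
        exact (mul_eq_zero.1 h6).resolve_left hgz
  have hgcd : ∀ f ∈ S, Nat.gcd n (contF f) ≤ ∑ g ∈ n.divisors, if g ∣ contF f then g else 0 := by
    intro f _
    have hmem : Nat.gcd n (contF f) ∈ n.divisors :=
      Nat.mem_divisors.2 ⟨Nat.gcd_dvd_left _ _, hn.ne_zero⟩
    refine le_trans ?_ (Finset.single_le_sum (fun _ _ => Nat.zero_le _) hmem)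
    rw [if_pos (Nat.gcd_dvd_right _ _)]
  have hgsum : ((∑ f ∈ S, Nat.gcd n (contF f) : ℕ) : ℝ) ≤ C₁ * Y ^ (8 / 5 : ℝ) * C₃ := by
    have h1 : ∑ f ∈ S, Nat.gcd n (contF f) ≤
        ∑ g ∈ n.divisors, (S.filter fun f => g ∣ contF f).card * g := by
      refine (Finset.sum_le_sum hgcd).trans (le_of_eq ?_)
      rw [Finset.sum_comm]
      refine Finset.sum_congr rfl fun g _ => ?_
      rw [← Finset.sum_filter, Finset.sum_const, smul_eq_mul]
    calc ((∑ f ∈ S, Nat.gcd n (contF f) : ℕ) : ℝ) ≤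
          ((∑ g ∈ n.divisors, (S.filter fun f => g ∣ contF f).card * g : ℕ) : ℝ) := by
          exact_mod_cast h1
      _ ≤ ∑ g ∈ n.divisors, C₁ * Y ^ (8 / 5 : ℝ) * (g : ℝ) ^ (-(11 / 5) : ℝ) := by
          push_cast
          exact Finset.sum_le_sum hcount
      _ ≤ _ := by
          rw [← Finset.mul_sum]
          exact mul_le_mul_of_nonneg_left (hsum _) (by positivity)
  have hwn : ((∑ f ∈ S, wn n f : ℕ) : ℝ) ≤
      (6 : ℝ) ^ n.primeFactors.card * ((∑ f ∈ S, Nat.gcd n (contF f) : ℕ) : ℝ) := by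
    have h1 := Finset.sum_le_sum fun f (_ : f ∈ S) => wn_le hn f
    rw [← Finset.mul_sum] at h1
    exact_mod_cast h1
  have hYpow : Y ^ (8 / 5 : ℝ) ≤ 11 * Y ^ (5 / 3 : ℝ) := by
    have h1 : Y ^ (5 / 3 : ℝ) = Y ^ (8 / 5 : ℝ) * Y ^ (1 / 15 : ℝ) := by
      rw [← Real.rpow_add hY0]
      norm_num
    have h2 : (1 / 11 : ℝ) ≤ Y ^ (1 / 15 : ℝ) := by
      calc (1 / 11 : ℝ) = (1 / 11 : ℝ) ^ (1 : ℝ) := (Real.rpow_one _).symm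
        _ ≤ (1 / 11 : ℝ) ^ (1 / 15 : ℝ) :=
          Real.rpow_le_rpow_of_exponent_ge (by norm_num) (by norm_num) (by norm_num)
        _ ≤ _ := Real.rpow_le_rpow (by norm_num) hY (by norm_num)
    have h3 : 0 < Y ^ (8 / 5 : ℝ) := by positivity
    rw [h1]
    nlinarith
  have h6 : (6 : ℝ) ^ n.primeFactors.card ≤ C₂ * √n := by
    rw [Real.sqrt_eq_rpow]
    exact hpow n hn
  calc _ ≤ C₂ * √n * (C₁ * (11 * Y ^ (5 / 3 : ℝ)) * C₃) := by
        refine hwn.trans (mul_le_mul h6 (hgsum.trans ?_) (by positivity) (by positivity))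
        gcongr
    _ = _ := by ring

theorem mem_formSet {s o : Bool} {Y : ℝ} {M : ℕ} (hY : 0 < Y) (hM : 200 * Y + 15 < M)
    {f : BinaryCubic} (ha : f.1 ≠ 0) (hf : castF f ∈ redRegion s o (discConst s * Y ^ 2)) :
    f ∈ formSet s o Y M := by
  obtain ⟨a, b, c, d⟩ := f
  have ha' : (1 : ℝ) ≤ |(a : ℝ)| := by exact_mod_cast Int.one_le_abs ha
  obtain ⟨h1, h2, -, h3, -, h4⟩ := coeff_bounds hY (by exact_mod_cast ha) hf
  simp only at h1 h2 h3 h4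
  have key : ∀ z : ℤ, |(z : ℝ)| < M → z ∈ Finset.Ico (-(M : ℤ)) M := by
    intro z hz
    have h5 : |z| < (M : ℤ) := by exact_mod_cast hz
    rw [abs_lt] at h5
    exact Finset.mem_Ico.2 ⟨h5.1.le, h5.2⟩
  have key2 : ∀ z : ℝ, z ^ 2 ≤ 200 * Y → |z| < M := by
    intro z hz
    rw [← sq_abs] at hz
    nlinarith [sq_nonneg (|z| - 1)]
  have key3 : ∀ z : ℝ, |(a : ℝ)| * |z| ≤ 200 * Y → |z| < M := by
    intro z hz
    nlinarith [abs_nonneg z, mul_le_mul_of_nonneg_right ha' (abs_nonneg z)]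
  simp only [formSet, Finset.mem_filter, Finset.mem_product]
  exact ⟨⟨key _ (key2 _ (by linarith)), key _ (key2 _ h2), key _ (key3 _ h4), key _ (key3 _ h3)⟩,
    ha, hf⟩

open Classical in
theorem exists_abs_sum_irred_sub_le (s o : Bool) : ∃ C > 0, ∀ (Y : ℝ) (n M : ℕ),
    1 / 11 ≤ Y → Squarefree n → 200 * Y + 15 < M →
    |((∑ f ∈ (formSet s o Y M).filter IrredForm, wn n f : ℕ) : ℝ) -
      (∑ d ∈ n.divisors, (d : ℝ)) / n * (jacConst s * π ^ 2 * Y ^ 2 / 12)| ≤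
      C * (√n * Y ^ (5 / 3 : ℝ) + n * Y) := by
  obtain ⟨C₁, hC₁, h1⟩ := exists_abs_sum_formSet_sub_le s o
  obtain ⟨C₂, hC₂, h2⟩ := exists_sum_reducible_wn_le s o
  refine ⟨C₁ + C₂, by positivity, fun Y n M hY hn hM => ?_⟩
  have e1 := h1 Y n M hY hn hM
  have e2 := h2 Y n M hY hn
  have hsum : ((∑ f ∈ formSet s o Y M, wn n f : ℕ) : ℝ) =
      ((∑ f ∈ (formSet s o Y M).filter IrredForm, wn n f : ℕ) : ℝ) +
      ((∑ f ∈ (formSet s o Y M).filter (fun f => ¬ IrredForm f), wn n f : ℕ) : ℝ) := by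
    exact_mod_cast (Finset.sum_filter_add_sum_filter_not _ _ _).symm
  rw [hsum] at e1
  have h3 : (0 : ℝ) ≤ ((∑ f ∈ (formSet s o Y M).filter (fun f => ¬ IrredForm f), wn n f : ℕ) : ℝ) :=
    Nat.cast_nonneg _
  have hY0 : 0 < Y := by linarith
  have h4 : 0 ≤ C₂ * (n * Y) := by positivity
  rw [abs_le] at e1 ⊢
  constructor <;> nlinarith

theorem mul_sqrt_le {n X : ℝ} (hn : 1 ≤ n) (hX : 1 ≤ X) :
    n * √X ≤ n ^ (3 : ℝ) + X ^ (5 / 6 : ℝ) * n ^ (1 / 2 : ℝ) := by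
  have hn0 : 0 < n := by linarith
  have hX0 : 0 < X := by linarith
  rw [Real.sqrt_eq_rpow]
  rcases le_total (n ^ (3 / 2 : ℝ)) X with h | h
  · have h1 : n ^ (1 / 2 : ℝ) ≤ X ^ (1 / 3 : ℝ) := by
      calc n ^ (1 / 2 : ℝ) = (n ^ (3 / 2 : ℝ)) ^ (1 / 3 : ℝ) := by
            rw [← Real.rpow_mul hn0.le]; norm_num
        _ ≤ _ := Real.rpow_le_rpow (by positivity) h (by norm_num)
    have h2 : n = n ^ (1 / 2 : ℝ) * n ^ (1 / 2 : ℝ) := by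
      rw [← Real.rpow_add hn0]; norm_num
    have h3 : X ^ (5 / 6 : ℝ) = X ^ (1 / 3 : ℝ) * X ^ (1 / 2 : ℝ) := by
      rw [← Real.rpow_add hX0]; norm_num
    have h4 : n * X ^ (1 / 2 : ℝ) ≤ X ^ (5 / 6 : ℝ) * n ^ (1 / 2 : ℝ) := by
      rw [h3]
      nth_rewrite 1 [h2]
      calc n ^ (1 / 2 : ℝ) * n ^ (1 / 2 : ℝ) * X ^ (1 / 2 : ℝ) ≤
            X ^ (1 / 3 : ℝ) * n ^ (1 / 2 : ℝ) * X ^ (1 / 2 : ℝ) := by gcongr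
        _ = _ := by ring
    have : 0 ≤ n ^ (3 : ℝ) := by positivity
    linarith
  · have h1 : X ^ (1 / 2 : ℝ) ≤ n ^ (2 : ℝ) := by
      calc X ^ (1 / 2 : ℝ) ≤ (n ^ (3 / 2 : ℝ)) ^ (1 / 2 : ℝ) :=
            Real.rpow_le_rpow hX0.le h (by norm_num)
        _ = n ^ (3 / 4 : ℝ) := by rw [← Real.rpow_mul hn0.le]; norm_num
        _ ≤ _ := Real.rpow_le_rpow_of_exponent_le hn (by norm_num)
    have h2 : n ^ (3 : ℝ) = n * n ^ (2 : ℝ) := by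
      nth_rewrite 2 [← Real.rpow_one n]
      rw [← Real.rpow_add hn0]; norm_num
    have h3 : 0 ≤ X ^ (5 / 6 : ℝ) * n ^ (1 / 2 : ℝ) := by positivity
    rw [h2]
    nlinarith

open Classical in
theorem exists_abs_classSum_sub_le (s : Bool) : ∃ C > 0, ∀ (n : ℕ), Squarefree n → ∀ X : ℝ, 1 ≤ X →
    |((classSum (ClassProp s X) (wn n) : ℕ) : ℝ) -
      (∑ d ∈ n.divisors, (d : ℝ)) / n * (jacConst s * π ^ 2 / (24 * discConst s)) * X| ≤
      C * ((n : ℝ) ^ (3 : ℝ) + X ^ (5 / 6 : ℝ) * (n : ℝ) ^ (1 / 2 : ℝ)) := by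
  obtain ⟨C₁, hC₁, h1⟩ := exists_abs_sum_irred_sub_le s false
  obtain ⟨C₂, hC₂, h2⟩ := exists_abs_sum_irred_sub_le s true
  refine ⟨(2 * C₁ + C₂) * 2, by positivity, fun n hn X hX => ?_⟩
  have hX0 : 0 < X := by linarith
  have : NeZero n := ⟨hn.ne_zero⟩
  have hn1 : (1 : ℝ) ≤ n := by exact_mod_cast Nat.one_le_iff_ne_zero.2 hn.ne_zero
  have hc := discConst_pos s
  have hc4 : 4 ≤ discConst s := by cases s <;> norm_num [discConst]
  have hc121 : discConst s ≤ 121 := by cases s <;> norm_num [discConst]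
  set Y := √(X / discConst s) with hYdef
  have hYsq : Y ^ 2 = X / discConst s := Real.sq_sqrt (by positivity)
  have hXY : discConst s * Y ^ 2 = X := by rw [hYsq]; field_simp
  have hY : 1 / 11 ≤ Y := by
    apply Real.le_sqrt_of_sq_le
    rw [le_div_iff₀ hc]
    linarith
  have hY0 : 0 < Y := by linarith
  have hYX : Y ≤ √X := Real.sqrt_le_sqrt (div_le_self hX0.le (by linarith))
  obtain ⟨M, hM⟩ := exists_nat_gt (200 * Y + 15)
  have hS : ∀ o : Bool, ∀ f, f ∈ (formSet s o Y M).filter IrredForm ↔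
      IrredForm f ∧ castF f ∈ redRegion s o X := by
    intro o f
    rw [Finset.mem_filter]
    constructor
    · rintro ⟨hf, hi⟩
      refine ⟨hi, ?_⟩
      have := (Finset.mem_filter.1 hf).2.2
      rwa [hXY] at this
    · rintro ⟨hi, hf⟩
      exact ⟨mem_formSet hY0 hM hi.fst_ne_zero (by rwa [hXY]), hi⟩
  obtain ⟨b1, b2⟩ := classSum_bounds (n := n) (hS false) (hS true)
  have b1' : ((∑ f ∈ (formSet s true Y M).filter IrredForm, wn n f : ℕ) : ℝ) ≤
      2 * ((classSum (ClassProp s X) (wn n) : ℕ) : ℝ) := by exact_mod_cast b1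
  have b2' : 2 * ((classSum (ClassProp s X) (wn n) : ℕ) : ℝ) +
      ((∑ f ∈ (formSet s true Y M).filter IrredForm, wn n f : ℕ) : ℝ) ≤
      2 * ((∑ f ∈ (formSet s false Y M).filter IrredForm, wn n f : ℕ) : ℝ) := by
    exact_mod_cast b2
  have e1 := h1 Y n M hY hn hM
  have e2 := h2 Y n M hY hn hM
  have hmain : (∑ d ∈ n.divisors, (d : ℝ)) / n * (jacConst s * π ^ 2 * Y ^ 2 / 12) =
      2 * ((∑ d ∈ n.divisors, (d : ℝ)) / n * (jacConst s * π ^ 2 / (24 * discConst s)) * X) := by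
    rw [hYsq]
    field_simp
    ring
  rw [hmain] at e1 e2
  set E := √(n : ℝ) * Y ^ (5 / 3 : ℝ) + n * Y with hE
  have hEle : E ≤ 2 * ((n : ℝ) ^ (3 : ℝ) + X ^ (5 / 6 : ℝ) * (n : ℝ) ^ (1 / 2 : ℝ)) := by
    have h3 : Y ^ (5 / 3 : ℝ) ≤ X ^ (5 / 6 : ℝ) := by
      calc Y ^ (5 / 3 : ℝ) ≤ (√X) ^ (5 / 3 : ℝ) := Real.rpow_le_rpow hY0.le hYX (by norm_num)
        _ = _ := by rw [Real.sqrt_eq_rpow, ← Real.rpow_mul hX0.le]; norm_num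
    have h4 := mul_sqrt_le hn1 hX
    have h5 : (n : ℝ) * Y ≤ n * √X := by gcongr
    have h6 : √(n : ℝ) * Y ^ (5 / 3 : ℝ) ≤ X ^ (5 / 6 : ℝ) * (n : ℝ) ^ (1 / 2 : ℝ) := by
      rw [← Real.sqrt_eq_rpow, mul_comm]
      gcongr
    have h7 : 0 ≤ (n : ℝ) ^ (3 : ℝ) := by positivity
    linarith
  have hE0 : 0 ≤ E := by positivity
  have hfin : (2 * C₁ + C₂) * E ≤ (2 * C₁ + C₂) * 2 *
      ((n : ℝ) ^ (3 : ℝ) + X ^ (5 / 6 : ℝ) * (n : ℝ) ^ (1 / 2 : ℝ)) := by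
    rw [mul_assoc]
    gcongr
  refine le_trans ?_ hfin
  have p1 : 0 ≤ C₁ * E := by positivity
  have p2 : 0 ≤ C₂ * E := by positivity
  rw [abs_le] at e1 e2 ⊢
  constructor <;> nlinarith

theorem weighted_class_count (ε : ℝ) (hε : 0 < ε) :
    (∃ C : ℝ, ∀ n : ℕ, Squarefree n → ∀ X : ℝ, 1 ≤ X →
      |((classSum (fun f => IrredForm f ∧ 0 < (discF f : ℝ) ∧ (discF f : ℝ) < X)
            (wn n) : ℕ) : ℝ) -
          ((∑ d ∈ n.divisors, (d : ℝ)) / (n : ℝ)) * (π ^ 2 / 72) * X| ≤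
        C * ((n : ℝ) ^ ((3 : ℝ) + ε) + X ^ ((5 : ℝ) / 6) * (n : ℝ) ^ ((1 : ℝ) / 2))) ∧
    (∃ C : ℝ, ∀ n : ℕ, Squarefree n → ∀ X : ℝ, 1 ≤ X →
      |((classSum (fun f => IrredForm f ∧ -X < (discF f : ℝ) ∧ (discF f : ℝ) < 0)
            (wn n) : ℕ) : ℝ) -
          ((∑ d ∈ n.divisors, (d : ℝ)) / (n : ℝ)) * (π ^ 2 / 24) * X| ≤
        C * ((n : ℝ) ^ ((3 : ℝ) + ε) + X ^ ((5 : ℝ) / 6) * (n : ℝ) ^ ((1 : ℝ) / 2))) := by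
  have hpow : ∀ n : ℕ, Squarefree n → (n : ℝ) ^ (3 : ℝ) ≤ (n : ℝ) ^ ((3 : ℝ) + ε) := fun n hn =>
    Real.rpow_le_rpow_of_exponent_le
      (by exact_mod_cast Nat.one_le_iff_ne_zero.2 hn.ne_zero) (by linarith)
  constructor
  · obtain ⟨C, hC, h⟩ := exists_abs_classSum_sub_le true
    refine ⟨C, fun n hn X hX => ?_⟩
    have e : (fun f : BinaryCubic => IrredForm f ∧ 0 < (discF f : ℝ) ∧ (discF f : ℝ) < X) =
        ClassProp true X := by
      funext f
      simp [ClassProp, sdisc, discR_castF]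
    have hc : π ^ 2 / 72 = jacConst true * π ^ 2 / (24 * discConst true) := by
      simp only [jacConst, discConst, cond_true]
      ring
    rw [e, hc]
    refine (h n hn X hX).trans ?_
    have := hpow n hn
    gcongr
  · obtain ⟨C, hC, h⟩ := exists_abs_classSum_sub_le false
    refine ⟨C, fun n hn X hX => ?_⟩
    have e : (fun f : BinaryCubic => IrredForm f ∧ -X < (discF f : ℝ) ∧ (discF f : ℝ) < 0) =
        ClassProp false X := by
      funext f
      simp only [ClassProp, sdisc, discR_castF, cond_false, eq_iff_iff]
      refine and_congr_right fun _ => ⟨fun h => ⟨?_, ?_⟩, fun h => ⟨?_, ?_⟩⟩ <;>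
        linarith [h.1, h.2]
    have hc : π ^ 2 / 24 = jacConst false * π ^ 2 / (24 * discConst false) := by
      simp only [jacConst, discConst, cond_false]
      ring
    rw [e, hc]
    refine (h n hn X hX).trans ?_
    have := hpow n hn
    gcongr
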